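/- Fix θ ∈ [1/4, 1) and β with 0 < β ≤ min{θ, 1/2}, and with β ≠ 1/2 in the case θ = 1/2. There is a constant C > 0 depending only on θ and β with the following property. Let Y₁ and Y₂ each be as in the context, both satisfying the well-stretched condition with constant λ > 0 and ‖Y₁‖_{Ḣ^{2+θ}(𝕋)}, ‖Y₂‖_{Ḣ^{2+θ}(𝕋)} < ∞, and let g_{Y₁} and g_{Y₂} be as in the context. Then ‖g_{Y₁} − g_{Y₂}‖_{Ḣ¹(𝕋)} ≤ C λ^{−3} ( ‖Y₁‖_{Ḣ^{2+θ}(𝕋)} + ‖Y₂‖_{Ḣ^{2+θ}(𝕋)} )³ ‖Y₁ − Y₂‖_{Ḣ^{3/2−β}(𝕋)}. -/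

import Mathlib

open MeasureTheory Real Filter Topology
open scoped RealInnerProductSpace ENNReal

noncomputable section

abbrev E2 : Type := EuclideanSpace ℝ (Fin 2)

/-- Squared modulus of the `k`-th Fourier coefficient
`ĝ_k = ∫_{-π}^{π} g(s) e^{-iks} ds` (componentwise complexified). -/
def coefSq (g : ℝ → E2) (k : ℤ) : ℝ :=
  ∑ j : Fin 2,
    Complex.normSq (∫ s in (-π)..π, (g s j : ℂ) * Complex.exp (-Complex.I * (k : ℂ) * (s : ℂ)))

/-- Summand of the homogeneous Sobolev seminorm: `|k|^{2σ} |ĝ_k|²` for `k ≠ 0`. -/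
def sobSummand (σ : ℝ) (g : ℝ → E2) (k : ℤ) : ℝ :=
  if k = 0 then 0 else (|k| : ℝ) ^ (2 * σ) * coefSq g k

/-- The homogeneous Sobolev seminorm `‖g‖_{Ḣ^σ(𝕋)} = (Σ_{k≠0} |k|^{2σ} |ĝ_k|²)^{1/2}`. -/
def sobNorm (σ : ℝ) (g : ℝ → E2) : ℝ := Real.sqrt (∑' k : ℤ, sobSummand σ g k)

/-- The `L²(𝕋)` norm (vector-valued). -/
def normL2v (g : ℝ → E2) : ℝ := Real.sqrt (∫ s in (-π)..π, ‖g s‖ ^ 2)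

/-- The nonlinear remainder `g_Y` in the contour dynamic equation (Hookean case):
`g_Y(s) = (1/4π) ∫_{−π}^{π} [ (−|Y'(s+τ)|²/|L|² + 2(L·Y'(s+τ))²/|L|⁴ − 1) L/τ
+ (1/τ − τ/(4 sin²(τ/2))) L ] dτ` with `L = (Y(s+τ) − Y(s))/τ`. -/
def gY (Y Y' : ℝ → E2) (s : ℝ) : E2 :=
  ((4 * π)⁻¹ : ℝ) • ∫ τ in (-π)..π,
    (((-‖Y' (s + τ)‖ ^ 2 / ‖τ⁻¹ • (Y (s + τ) - Y s)‖ ^ 2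
          + 2 * (⟪τ⁻¹ • (Y (s + τ) - Y s), Y' (s + τ)⟫) ^ 2 /
              ‖τ⁻¹ • (Y (s + τ) - Y s)‖ ^ 4
          - 1) / τ
        + (1 / τ - τ / (4 * Real.sin (τ / 2) ^ 2))) • (τ⁻¹ • (Y (s + τ) - Y s)))


/-- Fourier coefficient of a complex function. -/
def fc (f : ℝ → ℂ) (k : ℤ) : ℂ :=
  ∫ s in (-π)..π, f s * Complex.exp (-Complex.I * (k : ℂ) * (s : ℂ))

/-- Lebesgue measure on one period. -/
abbrev mu : Measure ℝ := volume.restrict (Set.Ioc (-π) π)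

lemma negpi_lt_pi : (-π : ℝ) < π := by linarith [Real.pi_pos]

lemma fc_eq_fourierCoeffOn (f : ℝ → ℂ) (k : ℤ) :
    fc f k = (2 * π : ℝ) • fourierCoeffOn negpi_lt_pi f k := by
  rw [fourierCoeffOn_eq_integral, smul_smul]
  have h2 : (2 * π) * (1 / (π - -π)) = 1 := by
    have := Real.pi_ne_zero
    field_simp
    ring
  rw [h2, one_smul, fc]
  refine intervalIntegral.integral_congr fun s _ => ?_
  simp only [fourier_coe_apply, smul_eq_mul]
  rw [mul_comm]
  congr 2
  have := Real.pi_ne_zero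
  have h3 : (π : ℂ) ≠ 0 := by exact_mod_cast this
  push_cast
  field_simp
  ring

lemma eLpNorm_sq (f : ℝ → ℂ) (ν : Measure ℝ) :
    eLpNorm f 2 ν ^ 2 = ∫⁻ s, ‖f s‖ₑ ^ 2 ∂ν := by
  rw [eLpNorm_eq_lintegral_rpow_enorm_toReal (by norm_num) (by norm_num)]
  rw [← ENNReal.rpow_natCast, ← ENNReal.rpow_mul]
  simp

lemma memLp_cont {f : ℝ → ℂ} (hf : Continuous f) : MemLp f 2 mu := by
  obtain ⟨C, hC⟩ := isCompact_Icc.exists_bound_of_continuousOn (s := Set.Icc (-π) π) hf.continuousOn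
  refine MemLp.of_bound hf.aestronglyMeasurable C ?_
  filter_upwards [ae_restrict_mem measurableSet_Ioc] with s hs
  exact hC s (Set.Ioc_subset_Icc_self hs)

lemma parseval {f : ℝ → ℂ} (hf : MemLp f 2 mu) :
    HasSum (fun k => ‖fc f k‖ ^ 2) (2 * π * ∫ s in (-π)..π, ‖f s‖ ^ 2) := by
  have h := hasSum_sq_fourierCoeffOn negpi_lt_pi hf
  have h' := h.mul_left ((2 * π) ^ 2)
  convert! h' using 1
  · ext k
    rw [fc_eq_fourierCoeffOn, norm_smul, mul_pow]
    simp [abs_of_pos Real.pi_pos]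
  · have := Real.pi_ne_zero
    rw [smul_eq_mul]
    field_simp
    ring

lemma parsevalE {f : ℝ → ℂ} (hf : Continuous f) :
    ∑' k, ‖fc f k‖ₑ ^ 2 = ENNReal.ofReal (2 * π) * eLpNorm f 2 mu ^ 2 := by
  have h := parseval (memLp_cont hf)
  have h1 : ∀ k, ‖fc f k‖ₑ ^ 2 = ENNReal.ofReal (‖fc f k‖ ^ 2) := fun k => by
    rw [ENNReal.ofReal_pow (norm_nonneg _), ofReal_norm]
  simp_rw [h1]
  rw [← ENNReal.ofReal_tsum_of_nonneg (fun _ => by positivity) h.summable, h.tsum_eq,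
    ENNReal.ofReal_mul (by positivity), eLpNorm_sq,
    intervalIntegral.integral_of_le negpi_lt_pi.le,
    ofReal_integral_eq_lintegral_ofReal]
  · congr 1
    refine lintegral_congr fun s => ?_
    rw [ENNReal.ofReal_pow (norm_nonneg _), ofReal_norm]
  · have : MemLp f 2 mu := memLp_cont hf
    exact this.integrable_norm_pow (by norm_num)
  · exact ae_of_all _ fun _ => by positivity

lemma fc_periodic_exp (k : ℤ) (s : ℝ) :
    Complex.exp (-Complex.I * (k : ℂ) * ((s + 2 * π : ℝ) : ℂ)) =
      Complex.exp (-Complex.I * (k : ℂ) * (s : ℂ)) := by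
  have : -Complex.I * (k : ℂ) * ((s + 2 * π : ℝ) : ℂ)
      = -Complex.I * (k : ℂ) * (s : ℂ) + ((-k : ℤ) : ℂ) * (2 * π * Complex.I) := by
    push_cast; ring
  rw [this, Complex.exp_add, Complex.exp_int_mul_two_pi_mul_I, mul_one]

/-- shift of a periodic integrand -/
lemma integral_shift {f : ℝ → ℂ} (hf : Function.Periodic f (2 * π)) (t : ℝ) :
    ∫ s in (-π)..π, f (s + t) = ∫ s in (-π)..π, f s := by
  rw [intervalIntegral.integral_comp_add_right]
  have := hf.intervalIntegral_add_eq (-π + t) (-π)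
  convert this using 2 <;> ring

lemma fc_shift {f : ℝ → ℂ} (hf : Function.Periodic f (2 * π)) (t : ℝ) (k : ℤ) :
    fc (fun s => f (s + t)) k = Complex.exp (Complex.I * k * t) * fc f k := by
  unfold fc
  rw [← integral_shift (f := fun s => f s * Complex.exp (-Complex.I * (k : ℂ) * (s : ℂ))) _ t,
    ← intervalIntegral.integral_const_mul]
  · refine intervalIntegral.integral_congr fun s _ => ?_
    have : Complex.exp (-Complex.I * (k : ℂ) * (s : ℂ)) = Complex.exp (Complex.I * k * t) *
      Complex.exp (-Complex.I * (k : ℂ) * ((s + t : ℝ) : ℂ)) := by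
      rw [← Complex.exp_add]; congr 1; push_cast; ring
    simp only [this]; ring
  · intro s
    simp only [hf s, fc_periodic_exp]

lemma cont_exp (k : ℤ) : Continuous fun s : ℝ => Complex.exp (-Complex.I * (k : ℂ) * (s : ℂ)) := by
  fun_prop

lemma fc_add {f g : ℝ → ℂ} (hf : Continuous f) (hg : Continuous g) (k : ℤ) :
    fc (fun s => f s + g s) k = fc f k + fc g k := by
  unfold fc
  rw [← intervalIntegral.integral_add]
  · refine intervalIntegral.integral_congr fun s _ => ?_
    simp only; ring
  · exact (hf.mul (cont_exp k)).intervalIntegrable _ _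
  · exact (hg.mul (cont_exp k)).intervalIntegrable _ _

lemma fc_const_mul (c : ℂ) (f : ℝ → ℂ) (k : ℤ) :
    fc (fun s => c * f s) k = c * fc f k := by
  unfold fc
  rw [← intervalIntegral.integral_const_mul]
  refine intervalIntegral.integral_congr fun s _ => ?_
  simp only; ring

lemma fc_sub {f g : ℝ → ℂ} (hf : Continuous f) (hg : Continuous g) (k : ℤ) :
    fc (fun s => f s - g s) k = fc f k - fc g k := by
  unfold fc
  rw [← intervalIntegral.integral_sub]
  · refine intervalIntegral.integral_congr fun s _ => ?_
    simp only; ring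
  · exact (hf.mul (cont_exp k)).intervalIntegrable _ _
  · exact (hg.mul (cont_exp k)).intervalIntegrable _ _

lemma hasDerivAt_cexp (k : ℤ) (s : ℝ) :
    HasDerivAt (fun s : ℝ => Complex.exp (-Complex.I * (k : ℂ) * (s : ℂ)))
      (-Complex.I * (k : ℂ) * Complex.exp (-Complex.I * (k : ℂ) * (s : ℂ))) s := by
  have h1 : HasDerivAt (fun s : ℝ => -Complex.I * (k : ℂ) * (s : ℂ)) (-Complex.I * (k : ℂ)) s := by
    simpa using (Complex.ofRealCLM.hasDerivAt (x := s)).const_mul (-Complex.I * (k : ℂ))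
  have := h1.cexp
  rwa [mul_comm (Complex.exp _)] at this

lemma fc_deriv {f f' : ℝ → ℂ} (hp : Function.Periodic f (2 * π))
    (hf : ∀ s, HasDerivAt f (f' s) s) (hf' : Continuous f') (k : ℤ) :
    fc f' k = Complex.I * k * fc f k := by
  unfold fc
  have h := intervalIntegral.integral_mul_deriv_eq_deriv_mul
    (a := -π) (b := π) (u := f) (u' := f')
    (v := fun s : ℝ => Complex.exp (-Complex.I * (k : ℂ) * (s : ℂ)))
    (v' := fun s : ℝ => -Complex.I * (k : ℂ) * Complex.exp (-Complex.I * (k : ℂ) * (s : ℂ)))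
    (fun s _ => hf s) (fun s _ => hasDerivAt_cexp k s)
    (hf'.intervalIntegrable _ _)
    ((continuous_const.mul (cont_exp k)).intervalIntegrable _ _)
  have h1 : f π = f (-π) := by
    have := hp (-π); rw [← this]; congr 1; ring
  have h2 := fc_periodic_exp k (-π)
  have h3 : (-π + 2 * π : ℝ) = π := by ring
  rw [h3] at h2
  rw [h1, h2, sub_self, zero_sub] at h
  have h4 : (∫ s in (-π)..π, f s * (-Complex.I * (k : ℂ) * Complex.exp (-Complex.I * k * s))) =
      -Complex.I * k * ∫ s in (-π)..π, f s * Complex.exp (-Complex.I * k * s) := by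
    rw [← intervalIntegral.integral_const_mul]
    refine intervalIntegral.integral_congr fun s _ => ?_
    ring
  rw [h4] at h
  linear_combination h

lemma hasSum_fc {f : ℝ → ℂ} (hp : Function.Periodic f (2 * π)) (hf : Continuous f)
    (hs : Summable fun k => ‖fc f k‖) (s : ℝ) :
    HasSum (fun k : ℤ => (2 * π : ℂ)⁻¹ * fc f k * Complex.exp (Complex.I * k * s)) (f s) := by
  have : Fact (0 < 2 * π) := ⟨by positivity⟩
  let F : C(AddCircle (2 * π), ℂ) :=
    ⟨hp.lift, by exact continuous_coinduced_dom.mpr hf⟩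
  have hF : ∀ s : ℝ, F (s : AddCircle (2 * π)) = f s := fun s => rfl
  have hc : ∀ k, fourierCoeff F k = (2 * π : ℂ)⁻¹ * fc f k := by
    intro k
    rw [fourierCoeff_eq_intervalIntegral _ _ (-π)]
    have : -π + 2 * π = π := by ring
    rw [this, fc]
    rw [Complex.real_smul]
    congr 1
    · push_cast; simp
    · refine intervalIntegral.integral_congr fun s _ => ?_
      simp only [fourier_coe_apply, smul_eq_mul, hF]
      rw [mul_comm]
      congr 2
      have := Real.pi_ne_zero
      have h3 : (π : ℂ) ≠ 0 := by exact_mod_cast this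
      push_cast
      field_simp
  have hsum : Summable (fourierCoeff F) := by
    refine Summable.of_norm ?_
    simp_rw [hc, norm_mul]
    exact hs.mul_left _
  have := has_pointwise_sum_fourier_series_of_summable hsum (s : AddCircle (2 * π))
  rw [hF] at this
  convert! this using 2 with k
  rw [hc, smul_eq_mul, fourier_coe_apply]
  congr 2
  have := Real.pi_ne_zero
  have h3 : (π : ℂ) ≠ 0 := by exact_mod_cast this
  push_cast
  field_simp

open scoped ComplexConjugate

lemma swap_cont {F : ℝ → ℝ → ℂ} {a b : ℝ} (hab : a ≤ b)
    (hF : ContinuousOn (Function.uncurry F) (Set.univ ×ˢ Set.Icc a b)) :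
    ∫ s in (-π)..π, ∫ t in a..b, F s t = ∫ t in a..b, ∫ s in (-π)..π, F s t := by
  apply intervalIntegral_intervalIntegral_swap
  rw [Set.uIoc_of_le negpi_lt_pi.le, Set.uIoc_of_le hab]
  have : IntegrableOn (Function.uncurry F) (Set.Icc (-π) π ×ˢ Set.Icc a b) :=
    (hF.mono (Set.prod_mono (Set.subset_univ _) le_rfl)).integrableOn_compact
      (isCompact_Icc.prod isCompact_Icc)
  exact this.mono_set (Set.prod_mono Set.Ioc_subset_Icc_self Set.Ioc_subset_Icc_self)

lemma cont_param {F : ℝ → ℝ → ℂ} {a b : ℝ} (hab : a ≤ b)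
    (hF : ContinuousOn (Function.uncurry F) (Set.univ ×ˢ Set.Icc a b)) :
    Continuous fun s => ∫ t in a..b, F s t := by
  have h1 : ∀ s, ∫ t in a..b, F s t = ∫ t in a..b, F s (Set.projIcc a b hab t) := fun s => by
    refine intervalIntegral.integral_congr fun t ht => ?_
    rw [Set.uIcc_of_le hab] at ht
    simp only [Set.projIcc_of_mem hab ht]
  simp_rw [h1]
  apply intervalIntegral.continuous_parametric_intervalIntegral_of_continuous'
  have : Continuous fun p : ℝ × ℝ => ((p.1, (Set.projIcc a b hab p.2 : ℝ)) : ℝ × ℝ) := by fun_prop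
  exact hF.comp_continuous this fun p => ⟨Set.mem_univ _, (Set.projIcc a b hab p.2).2⟩

lemma weak_abs {F G : ℝ → ℝ → ℂ} {a b : ℝ} (hab : a ≤ b)
    (hF : ContinuousOn (Function.uncurry F) (Set.univ ×ˢ Set.Icc a b))
    (hG : ContinuousOn (Function.uncurry G) (Set.univ ×ˢ Set.Icc a b))
    (pF : ∀ t, Function.Periodic (fun s => F s t) (2 * π))
    (pG : ∀ t, Function.Periodic (fun s => G s t) (2 * π))
    (hd : ∀ s, ∀ t ∈ Set.Icc a b, HasDerivAt (fun t => F (s - t) t) (-G (s - t) t) t) (k : ℤ) :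
    Complex.I * k * fc (fun s => ∫ t in a..b, F s t) k =
      fc (fun s => (∫ t in a..b, G s t) + (F s b - F s a)) k := by
  set φ : ℝ → ℂ := fun s => Complex.exp (-Complex.I * (k : ℂ) * (s : ℂ)) with hφ
  have cφ : Continuous φ := cont_exp k
  have pφ : ∀ s, φ (s + 2 * π) = φ s := fun s => fc_periodic_exp k s
  have hsh : ∀ H : ℝ → ℝ → ℂ, ContinuousOn (Function.uncurry H) (Set.univ ×ˢ Set.Icc a b) →
      ContinuousOn (Function.uncurry fun s t => H (s - t) t) (Set.univ ×ˢ Set.Icc a b) := by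
    intro H hH
    have : Continuous fun p : ℝ × ℝ => ((p.1 - p.2, p.2) : ℝ × ℝ) := by fun_prop
    exact hH.comp this.continuousOn fun p hp => ⟨Set.mem_univ _, hp.2⟩
  have hmul : ∀ H : ℝ → ℝ → ℂ, ContinuousOn (Function.uncurry H) (Set.univ ×ˢ Set.Icc a b) →
      ContinuousOn (Function.uncurry fun s t => H s t * φ s) (Set.univ ×ˢ Set.Icc a b) := by
    intro H hH
    exact hH.mul (cφ.comp continuous_fst).continuousOn
  have key : ∀ H : ℝ → ℝ → ℂ, ContinuousOn (Function.uncurry H) (Set.univ ×ˢ Set.Icc a b) →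
      (∀ t, Function.Periodic (fun s => H s t) (2 * π)) →
      fc (fun s => ∫ t in a..b, H s t) k =
        ∫ s in (-π)..π, ∫ t in a..b, H (s - t) t * φ (s - t) := by
    intro H hH pH
    unfold fc
    simp_rw [← intervalIntegral.integral_mul_const]
    rw [swap_cont hab (hmul H hH), swap_cont (F := fun s t => H (s - t) t * φ (s - t)) hab]
    · refine intervalIntegral.integral_congr fun t _ => ?_
      have := integral_shift (f := fun s => H s t * φ s) (fun s => by
        simp only [pφ, pH t s]) (-t)
      simp only [← sub_eq_add_neg] at this
      rw [← this]
    · exact hsh _ (hmul H hH)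
  have hFs := hsh F hF
  have hGs := hsh G hG
  have slice : ∀ H : ℝ → ℝ → ℂ, ContinuousOn (Function.uncurry H) (Set.univ ×ˢ Set.Icc a b) →
      ∀ s, ContinuousOn (H s) (Set.Icc a b) := by
    intro H hH s
    have : Continuous fun t : ℝ => ((s, t) : ℝ × ℝ) := by fun_prop
    exact hH.comp this.continuousOn fun t ht => ⟨Set.mem_univ _, ht⟩
  have slice2 : ∀ H : ℝ → ℝ → ℂ, ContinuousOn (Function.uncurry H) (Set.univ ×ˢ Set.Icc a b) →
      ∀ t ∈ Set.Icc a b, Continuous fun s => H s t := by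
    intro H hH t ht
    have : Continuous fun s : ℝ => ((s, t) : ℝ × ℝ) := by fun_prop
    exact hH.comp_continuous this fun s => ⟨Set.mem_univ _, ht⟩
  have ha : a ∈ Set.Icc a b := ⟨le_rfl, hab⟩
  have hb : b ∈ Set.Icc a b := ⟨hab, le_rfl⟩
  have cS : Continuous fun s => F s b - F s a := (slice2 F hF b hb).sub (slice2 F hF a ha)
  rw [fc_add (cont_param hab hG) cS,
    fc_sub (slice2 F hF b hb) (slice2 F hF a ha), key F hF pF, key G hG pG,
    ← intervalIntegral.integral_const_mul]
  have hbd : ∀ t ∈ Set.Icc a b,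
      fc (fun s => F s t) k = ∫ s in (-π)..π, F (s - t) t * φ (s - t) := by
    intro t ht
    have := integral_shift (f := fun s => F s t * φ s) (fun s => by simp only [pφ, pF t s]) (-t)
    simp only [← sub_eq_add_neg] at this
    rw [this, fc]
  rw [hbd a ha, hbd b hb]
  have c1 : ∀ t ∈ Set.Icc a b, Continuous fun s => F (s - t) t * φ (s - t) := fun t ht =>
    slice2 (fun s t => F (s - t) t * φ (s - t)) (hsh _ (hmul F hF)) t ht
  have cG : Continuous fun s => ∫ t in a..b, G (s - t) t * φ (s - t) :=
    cont_param (F := fun s t => G (s - t) t * φ (s - t)) hab (hsh _ (hmul G hG))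
  have cT : Continuous fun s => F (s - b) b * φ (s - b) - F (s - a) a * φ (s - a) :=
    (c1 b hb).sub (c1 a ha)
  rw [← intervalIntegral.integral_sub ((c1 b hb).intervalIntegrable _ _)
    ((c1 a ha).intervalIntegrable _ _),
    ← intervalIntegral.integral_add (cG.intervalIntegrable _ _)
      (cT.intervalIntegrable _ _)]
  refine intervalIntegral.integral_congr fun s _ => ?_
  have hv : ∀ t : ℝ, HasDerivAt (fun t : ℝ => φ (s - t)) (Complex.I * k * φ (s - t)) t := by
    intro t
    have := (hasDerivAt_cexp k (s - t)).scomp t ((hasDerivAt_id t).const_sub s)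
    convert! this using 1
    simp [hφ]
  have hI := intervalIntegral.integral_mul_deriv_eq_deriv_mul (a := a) (b := b)
    (u := fun t => F (s - t) t) (u' := fun t => -G (s - t) t)
    (v := fun t => φ (s - t)) (v' := fun t => Complex.I * k * φ (s - t))
    (fun t ht => hd s t (by rwa [Set.uIcc_of_le hab] at ht)) (fun t _ => hv t)
    (by
      apply ContinuousOn.intervalIntegrable
      rw [Set.uIcc_of_le hab]
      exact (slice _ hGs s).neg)
    (by
      apply Continuous.intervalIntegrable
      fun_prop)
  have e1 : Complex.I * k * ∫ t in a..b, F (s - t) t * φ (s - t) =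
      ∫ t in a..b, F (s - t) t * (Complex.I * k * φ (s - t)) := by
    rw [← intervalIntegral.integral_const_mul]
    refine intervalIntegral.integral_congr fun t _ => ?_
    ring
  have e2 : ∫ t in a..b, -G (s - t) t * φ (s - t) = -∫ t in a..b, G (s - t) t * φ (s - t) := by
    rw [← intervalIntegral.integral_neg]
    refine intervalIntegral.integral_congr fun t _ => ?_
    ring
  rw [e1, hI, e2]
  ring

/-- difference quotient -/
def ell (X : ℝ → ℂ) (s τ : ℝ) : ℂ := (X (s + τ) - X s) / (τ : ℂ)
def rho (X x : ℝ → ℂ) (s τ : ℝ) : ℂ := (x (s + τ) - ell X s τ) / (τ : ℂ)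
def kap (X x : ℝ → ℂ) (s τ : ℝ) : ℂ := (ell X s τ - x s) / (τ : ℂ)

def F0c (l r t : ℂ) : ℂ :=
  r + conj r * l / conj l + t / 2 * (r ^ 2 / l + l * conj r ^ 2 / conj l ^ 2)
def rc (l r k t : ℂ) : ℂ :=
  1 / 2 * (r ^ 2 / l + l * conj r ^ 2 / conj l ^ 2) - r * k / l - l * conj r * conj k / conj l ^ 2
    - r * conj k / conj l + conj r * k / conj l - t / 2 * (r ^ 2 * k / l ^ 2
    - conj r ^ 2 * k / conj l ^ 2) - t * l * conj r ^ 2 * conj k / conj l ^ 3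
def Vc (l k : ℂ) : ℂ := k + conj k * l / conj l

/-- Regular periodic curve with the well-stretched condition, constant one. -/
structure Nice (X x : ℝ → ℂ) : Prop where
  per : Function.Periodic X (2 * π)
  der : ∀ s, HasDerivAt X (x s) s
  cont : Continuous x
  str : ∀ s τ : ℝ, |τ| ≤ π → |τ| ≤ ‖X (s + τ) - X s‖

lemma Nice.contX {X x : ℝ → ℂ} (h : Nice X x) : Continuous X :=
  continuous_iff_continuousAt.2 fun s => (h.der s).continuousAt

lemma Nice.perx {X x : ℝ → ℂ} (h : Nice X x) : Function.Periodic x (2 * π) := by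
  intro s
  have h1 := (h.der (s + 2 * π)).scomp s ((hasDerivAt_id s).add_const (2 * π))
  have h2 : (X ∘ fun s => id s + 2 * π) = X := funext fun s => h.per s
  rw [h2] at h1
  simpa using h1.unique (h.der s)

lemma Nice.one_le {X x : ℝ → ℂ} (h : Nice X x) {s τ : ℝ} (h0 : τ ≠ 0) (hτ : |τ| ≤ π) :
    1 ≤ ‖ell X s τ‖ := by
  have := h.str s τ hτ
  have h1 : 0 < |τ| := abs_pos.2 h0
  rw [ell, norm_div, Complex.norm_real, Real.norm_eq_abs, le_div_iff₀ h1, one_mul]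
  exact this

lemma Nice.ne {X x : ℝ → ℂ} (h : Nice X x) {s τ : ℝ} (h0 : τ ≠ 0) (hτ : |τ| ≤ π) :
    ell X s τ ≠ 0 := by
  have := h.one_le (s := s) h0 hτ
  intro h; rw [h] at this; norm_num at this

/-- the region where kernels are continuous -/
def reg : Set (ℝ × ℝ) := {p | p.2 ≠ 0 ∧ |p.2| ≤ π}

lemma cont_ell {X : ℝ → ℂ} (h : Continuous X) :
    ContinuousOn (Function.uncurry (ell X)) reg := by
  unfold ell Function.uncurry
  refine ContinuousOn.div (by fun_prop) (by fun_prop) fun p hp => ?_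
  exact_mod_cast hp.1

lemma cont_rho {X x : ℝ → ℂ} (h : Continuous X) (h' : Continuous x) :
    ContinuousOn (Function.uncurry (rho X x)) reg := by
  have := cont_ell h
  unfold rho Function.uncurry at *
  refine ContinuousOn.div ?_ (by fun_prop) fun p hp => by exact_mod_cast hp.1
  exact ContinuousOn.sub (by fun_prop) this

lemma cont_kap {X x : ℝ → ℂ} (h : Continuous X) (h' : Continuous x) :
    ContinuousOn (Function.uncurry (kap X x)) reg := by
  have := cont_ell h
  unfold kap Function.uncurry at *
  refine ContinuousOn.div ?_ (by fun_prop) fun p hp => by exact_mod_cast hp.1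
  exact ContinuousOn.sub this (by fun_prop)

section
variable {X x : ℝ → ℂ}

def F0 (X x : ℝ → ℂ) (s τ : ℝ) : ℂ := F0c (ell X s τ) (rho X x s τ) τ
def rr (X x : ℝ → ℂ) (s τ : ℝ) : ℂ := rc (ell X s τ) (rho X x s τ) (kap X x s τ) τ
def V (X x : ℝ → ℂ) (s τ : ℝ) : ℂ := Vc (ell X s τ) (kap X x s τ)
def W (X x : ℝ → ℂ) (s τ : ℝ) : ℂ := F0 X x s τ + V X x s τ
/-- tau derivative of V -/
def dV (X x : ℝ → ℂ) (s τ : ℝ) : ℂ :=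
  let l := ell X s τ
  let r := rho X x s τ
  let k := kap X x s τ
  (r - k) / τ + (conj (r - k) / τ) * l / conj l + conj k * (r / conj l - l * conj r / conj l ^ 2)

lemma cont_conj {E : Type*} [TopologicalSpace E] {f : E → ℂ} {s : Set E} (hf : ContinuousOn f s) :
    ContinuousOn (fun p => conj (f p)) s := Complex.continuous_conj.comp_continuousOn hf

lemma contAlg {E : Type*} [TopologicalSpace E] {S : Set E} {l r k lb rb kb t : E → ℂ}
    (h1 : ContinuousOn l S) (h2 : ContinuousOn r S) (h3 : ContinuousOn k S)
    (h4 : ContinuousOn lb S) (h5 : ContinuousOn rb S) (h6 : ContinuousOn kb S)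
    (h7 : ContinuousOn t S) (n1 : ∀ p ∈ S, l p ≠ 0) (n2 : ∀ p ∈ S, lb p ≠ 0)
    (n3 : ∀ p ∈ S, t p ≠ 0) :
    ContinuousOn (fun p => r p + rb p * l p / lb p + t p / 2 * (r p ^ 2 / l p +
      l p * rb p ^ 2 / lb p ^ 2)) S ∧
    ContinuousOn (fun p => 1 / 2 * (r p ^ 2 / l p + l p * rb p ^ 2 / lb p ^ 2) - r p * k p / l p -
      l p * rb p * kb p / lb p ^ 2 - r p * kb p / lb p + rb p * k p / lb p -
      t p / 2 * (r p ^ 2 * k p / l p ^ 2 - rb p ^ 2 * k p / lb p ^ 2) -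
      t p * l p * rb p ^ 2 * kb p / lb p ^ 3) S ∧
    ContinuousOn (fun p => k p + kb p * l p / lb p) S ∧
    ContinuousOn (fun p => (r p - k p) / t p + ((rb p - kb p) / t p) * l p / lb p +
      kb p * (r p / lb p - l p * rb p / lb p ^ 2)) S := by
  have m1 : ∀ n : ℕ, ∀ p ∈ S, l p ^ n ≠ 0 := fun n p hp => pow_ne_zero _ (n1 p hp)
  have m2 : ∀ n : ℕ, ∀ p ∈ S, lb p ^ n ≠ 0 := fun n p hp => pow_ne_zero _ (n2 p hp)
  refine ⟨?_, ?_, ?_, ?_⟩ <;>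
  fun_prop (disch := first | assumption | exact m1 _ | exact m2 _ | norm_num)

lemma contOns (h : Nice X x) : ContinuousOn (Function.uncurry (F0 X x)) reg ∧
    ContinuousOn (Function.uncurry (rr X x)) reg ∧ ContinuousOn (Function.uncurry (V X x)) reg ∧
    ContinuousOn (Function.uncurry (dV X x)) reg := by
  have h1 := cont_ell h.contX
  have h2 := cont_rho h.contX h.cont
  have h3 := cont_kap h.contX h.cont
  have ht : ContinuousOn (fun p : ℝ × ℝ => (p.2 : ℂ)) reg := by fun_prop
  have n0 : ∀ p ∈ reg, (p.2 : ℂ) ≠ 0 := fun p hp => by exact_mod_cast hp.1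
  have n1 : ∀ p ∈ reg, ell X p.1 p.2 ≠ 0 := fun p hp => h.ne hp.1 hp.2
  have n1' : ∀ p ∈ reg, conj (ell X p.1 p.2) ≠ 0 := fun p hp => by
    simpa using n1 p hp
  have := contAlg h1 h2 h3 (cont_conj h1) (cont_conj h2) (cont_conj h3) ht n1 n1' n0
  refine ⟨this.1, this.2.1, this.2.2.1, ?_⟩
  have h4 := this.2.2.2
  unfold dV Function.uncurry at *
  simp only [map_sub]
  exact h4

lemma hasDeriv_ell (h : Nice X x) {s τ : ℝ} (h0 : τ ≠ 0) :
    HasDerivAt (fun t => ell X s t) (rho X x s τ) τ := by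
  have hc : (τ : ℂ) ≠ 0 := by exact_mod_cast h0
  have h1 : HasDerivAt (fun t : ℝ => X (s + t)) (x (s + τ)) τ := by
    exact (h.der (s + τ)).comp_const_add s τ
  have h2 : HasDerivAt (fun t : ℝ => (t : ℂ)) 1 τ := Complex.ofRealCLM.hasDerivAt
  have := (h1.sub_const (X s)).div h2 hc
  convert! this using 1
  unfold rho ell
  field_simp

lemma hasDeriv_kap (h : Nice X x) {s τ : ℝ} (h0 : τ ≠ 0) :
    HasDerivAt (fun t => kap X x s t) ((rho X x s τ - kap X x s τ) / τ) τ := by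
  have hc : (τ : ℂ) ≠ 0 := by exact_mod_cast h0
  have h2 : HasDerivAt (fun t : ℝ => (t : ℂ)) 1 τ := Complex.ofRealCLM.hasDerivAt
  have := ((hasDeriv_ell h (s := s) h0).sub_const (x s)).div h2 hc
  convert! this using 1
  unfold kap
  field_simp

lemma hasDeriv_ell' (h : Nice X x) {s τ : ℝ} (h0 : τ ≠ 0) :
    HasDerivAt (fun t => ell X (s - t) t) (-kap X x (s - τ) τ) τ := by
  have hc : (τ : ℂ) ≠ 0 := by exact_mod_cast h0
  have h1 : HasDerivAt (fun t : ℝ => X (s - t)) (-x (s - τ)) τ := by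
    exact (h.der (s - τ)).comp_const_sub s τ
  have h2 : HasDerivAt (fun t : ℝ => (t : ℂ)) 1 τ := Complex.ofRealCLM.hasDerivAt
  have := (h1.const_sub (X s)).div h2 hc
  unfold kap ell
  simp only [sub_add_cancel]
  convert! this using 1
  field_simp
  ring

lemma hasDeriv_rho' (h : Nice X x) {s τ : ℝ} (h0 : τ ≠ 0) :
    HasDerivAt (fun t => rho X x (s - t) t) ((kap X x (s - τ) τ - rho X x (s - τ) τ) / τ) τ := by
  have hc : (τ : ℂ) ≠ 0 := by exact_mod_cast h0
  have h2 : HasDerivAt (fun t : ℝ => (t : ℂ)) 1 τ := Complex.ofRealCLM.hasDerivAt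
  have := ((hasDeriv_ell' h (s := s) h0).const_sub (x s)).div h2 hc
  unfold rho
  simp only [sub_add_cancel]
  convert! this using 1
  field_simp

lemma hasDeriv_V (h : Nice X x) {s τ : ℝ} (h0 : τ ≠ 0) (hτ : |τ| ≤ π) :
    HasDerivAt (fun t => V X x s t) (dV X x s τ) τ := by
  have hn := h.ne (s := s) h0 hτ
  have hn' : conj (ell X s τ) ≠ 0 := by simpa using hn
  have hl := hasDeriv_ell h (s := s) h0
  have hk := hasDeriv_kap h (s := s) h0
  have := hk.add ((hk.star.mul hl).div hl.star hn')
  have hc : (τ : ℂ) ≠ 0 := by exact_mod_cast h0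
  convert! this using 1
  unfold dV
  simp only [← starRingEnd_apply, map_sub, map_div₀, Complex.conj_ofReal, Pi.pow_apply,
    Pi.mul_apply, Pi.add_apply, Pi.div_apply]
  field_simp
  ring

lemma hasDeriv_F0 (h : Nice X x) {s τ : ℝ} (h0 : τ ≠ 0) (hτ : |τ| ≤ π) :
    HasDerivAt (fun t => F0 X x (s - t) t) (-(rr X x (s - τ) τ + dV X x (s - τ) τ)) τ := by
  have hn := h.ne (s := s - τ) h0 hτ
  have hn' : conj (ell X (s - τ) τ) ≠ 0 := by simpa using hn
  have hl := hasDeriv_ell' h (s := s) h0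
  have hr := hasDeriv_rho' h (s := s) h0
  have h2 : HasDerivAt (fun t : ℝ => (t : ℂ)) 1 τ := Complex.ofRealCLM.hasDerivAt
  have := (hr.add ((hr.star.mul hl).div hl.star hn')).add
    ((h2.div_const 2).mul (((hr.pow 2).div hl hn).add
      ((hl.mul (hr.star.pow 2)).div (hl.star.pow 2) (pow_ne_zero 2 hn'))))
  have hc : (τ : ℂ) ≠ 0 := by exact_mod_cast h0
  convert! this using 1
  unfold dV rr rc
  simp only [← starRingEnd_apply, map_sub, map_neg, map_div₀, Complex.conj_ofReal, Pi.pow_apply,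
    Pi.mul_apply, Pi.add_apply, Pi.div_apply]
  field_simp
  ring

lemma per_ell (h : Nice X x) (τ : ℝ) : Function.Periodic (fun s => ell X s τ) (2 * π) := by
  intro s
  simp only [ell, h.per s, show s + 2 * π + τ = s + τ + 2 * π by ring, h.per (s + τ)]
lemma per_rho (h : Nice X x) (τ : ℝ) : Function.Periodic (fun s => rho X x s τ) (2 * π) := by
  intro s
  have := per_ell h τ s
  simp only at this
  simp only [rho, this, show s + 2 * π + τ = s + τ + 2 * π by ring, h.perx (s + τ)]
lemma per_kap (h : Nice X x) (τ : ℝ) : Function.Periodic (fun s => kap X x s τ) (2 * π) := by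
  intro s
  have := per_ell h τ s
  simp only at this
  simp only [kap, this, h.perx s]

lemma reg_sub {a b : ℝ} (h0 : ∀ t ∈ Set.Icc a b, t ≠ 0 ∧ |t| ≤ π) :
    (Set.univ ×ˢ Set.Icc a b : Set (ℝ × ℝ)) ⊆ reg := fun p hp => h0 p.2 hp.2

lemma slice_cont {H : ℝ → ℝ → ℂ} (hH : ContinuousOn (Function.uncurry H) reg) (s : ℝ) :
    ContinuousOn (H s) {t | t ≠ 0 ∧ |t| ≤ π} := by
  have : Continuous fun t : ℝ => ((s, t) : ℝ × ℝ) := by fun_prop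
  exact hH.comp this.continuousOn fun t ht => ht

lemma slice_cont' {H : ℝ → ℝ → ℂ} (hH : ContinuousOn (Function.uncurry H) reg) {t : ℝ}
    (h0 : t ≠ 0) (ht : |t| ≤ π) : Continuous fun s => H s t := by
  have : Continuous fun s : ℝ => ((s, t) : ℝ × ℝ) := by fun_prop
  exact hH.comp_continuous this fun s => ⟨h0, ht⟩

lemma weak_F0 (h : Nice X x) {a b : ℝ} (hab : a ≤ b) (h0 : ∀ t ∈ Set.Icc a b, t ≠ 0 ∧ |t| ≤ π)
    (k : ℤ) :
    Complex.I * k * fc (fun s => ∫ t in a..b, F0 X x s t) k =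
      fc (fun s => (∫ t in a..b, rr X x s t) + (W X x s b - W X x s a)) k := by
  obtain ⟨c1, c2, c3, c4⟩ := contOns h
  have hs := reg_sub h0
  rw [weak_abs hab (c1.mono hs) (G := fun s t => rr X x s t + dV X x s t)
    ((c2.add c4).mono hs)]
  · congr 1
    ext s
    have hI : Set.Icc a b ⊆ {t | t ≠ 0 ∧ |t| ≤ π} := h0
    have i1 : IntervalIntegrable (rr X x s) volume a b := by
      apply ContinuousOn.intervalIntegrable
      rw [Set.uIcc_of_le hab]
      exact (slice_cont c2 s).mono hI
    have i2 : IntervalIntegrable (dV X x s) volume a b := by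
      apply ContinuousOn.intervalIntegrable
      rw [Set.uIcc_of_le hab]
      exact (slice_cont c4 s).mono hI
    rw [intervalIntegral.integral_add i1 i2, intervalIntegral.integral_eq_sub_of_hasDerivAt
      (f := V X x s) _ i2]
    · unfold W; ring
    · intro t ht
      rw [Set.uIcc_of_le hab] at ht
      exact hasDeriv_V h (h0 t ht).1 (h0 t ht).2
  · intro t s
    have e1 := per_ell h t s
    have e2 := per_rho h t s
    simp only at e1 e2
    simp only [F0, e1, e2]
  · intro t s
    have e1 := per_ell h t s
    have e2 := per_rho h t s
    have e3 := per_kap h t s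
    simp only at e1 e2 e3
    simp only [rr, dV, e1, e2, e3]
  · intro s t ht
    exact hasDeriv_F0 h (h0 t ht).1 (h0 t ht).2

end

lemma tri_bd {f1 f2 a1 a2 b1 b2 : ℂ} {P F : ℝ} (hf : ‖f1‖ ≤ 1) (hF : ‖f1 - f2‖ ≤ F)
    (ha1 : ‖a1‖ ≤ P) (ha2 : ‖a2‖ ≤ P) (hb2 : ‖b2‖ ≤ P) :
    ‖f1 * a1 * b1 - f2 * a2 * b2‖ ≤ P * (‖a1 - a2‖ + ‖b1 - b2‖) + P ^ 2 * F := by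
  have hP : 0 ≤ P := (norm_nonneg _).trans ha1
  have e : f1 * a1 * b1 - f2 * a2 * b2 =
      f1 * a1 * (b1 - b2) + f1 * b2 * (a1 - a2) + a2 * b2 * (f1 - f2) := by ring
  have h1 : ‖f1 * a1 * (b1 - b2)‖ ≤ 1 * P * ‖b1 - b2‖ := by
    rw [norm_mul, norm_mul]; gcongr
  have h2 : ‖f1 * b2 * (a1 - a2)‖ ≤ 1 * P * ‖a1 - a2‖ := by
    rw [norm_mul, norm_mul]; gcongr
  have h3 : ‖a2 * b2 * (f1 - f2)‖ ≤ P * P * F := by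
    rw [norm_mul, norm_mul]; gcongr
  rw [e]
  have := norm_add₃_le (a := f1 * a1 * (b1 - b2)) (b := f1 * b2 * (a1 - a2))
    (c := a2 * b2 * (f1 - f2))
  linarith

lemma tri_fr {f1 f2 f0 a1 a2 b1 b2 α β : ℂ} {P F δ η : ℝ} (hf : ‖f1‖ ≤ 1) (hF : ‖f1 - f2‖ ≤ F)
    (h0 : ‖f1 - f0‖ ≤ η) (hα : ‖α‖ ≤ P) (hβ : ‖β‖ ≤ P) (hδ1 : ‖a1 - α‖ ≤ δ) (hδ2 : ‖b2 - β‖ ≤ δ)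
    (ha2 : ‖a2‖ ≤ P) (hb2 : ‖b2‖ ≤ P) :
    ‖f1 * a1 * b1 - f2 * a2 * b2 - f0 * (α * (b1 - b2) + β * (a1 - a2))‖ ≤
      (δ + η * P) * (‖a1 - a2‖ + ‖b1 - b2‖) + P ^ 2 * F := by
  have hP : 0 ≤ P := (norm_nonneg _).trans ha2
  have hη : 0 ≤ η := (norm_nonneg _).trans h0
  have e : f1 * a1 * b1 - f2 * a2 * b2 - f0 * (α * (b1 - b2) + β * (a1 - a2)) =
      (f1 * (a1 - α) + (f1 - f0) * α) * (b1 - b2) + (f1 * (b2 - β) + (f1 - f0) * β) * (a1 - a2)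
      + a2 * b2 * (f1 - f2) := by ring
  have g : ∀ u v : ℂ, ‖u‖ ≤ δ → ‖v‖ ≤ P → ‖f1 * u + (f1 - f0) * v‖ ≤ δ + η * P := by
    intro u v hu hv
    refine (norm_add_le _ _).trans ?_
    rw [norm_mul, norm_mul]
    have : ‖f1‖ * ‖u‖ ≤ 1 * δ := by gcongr
    have : ‖f1 - f0‖ * ‖v‖ ≤ η * P := by gcongr
    linarith
  have h1 : ‖(f1 * (a1 - α) + (f1 - f0) * α) * (b1 - b2)‖ ≤ (δ + η * P) * ‖b1 - b2‖ := by
    rw [norm_mul]; exact mul_le_mul_of_nonneg_right (g _ _ hδ1 hα) (norm_nonneg _)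
  have h2 : ‖(f1 * (b2 - β) + (f1 - f0) * β) * (a1 - a2)‖ ≤ (δ + η * P) * ‖a1 - a2‖ := by
    rw [norm_mul]; exact mul_le_mul_of_nonneg_right (g _ _ hδ2 hβ) (norm_nonneg _)
  have h3 : ‖a2 * b2 * (f1 - f2)‖ ≤ P * P * F := by
    rw [norm_mul, norm_mul]; gcongr
  rw [e]
  refine (norm_add₃_le).trans ?_
  linarith

lemma cub_bd {f1 f2 a1 a2 b1 b2 c1 c2 : ℂ} {P F : ℝ} (hf : ‖f1‖ ≤ 1) (hF : ‖f1 - f2‖ ≤ F)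
    (ha1 : ‖a1‖ ≤ P) (hb1 : ‖b1‖ ≤ P) (ha2 : ‖a2‖ ≤ P) (hb2 : ‖b2‖ ≤ P) (hc2 : ‖c2‖ ≤ P) :
    ‖f1 * a1 * b1 * c1 - f2 * a2 * b2 * c2‖ ≤
      P ^ 2 * (‖a1 - a2‖ + ‖b1 - b2‖ + ‖c1 - c2‖) + P ^ 3 * F := by
  have hP : 0 ≤ P := (norm_nonneg _).trans ha1
  have e : f1 * a1 * b1 * c1 - f2 * a2 * b2 * c2 =
      f1 * a1 * b1 * (c1 - c2) + c2 * (f1 * a1 * b1 - f2 * a2 * b2) := by ring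
  have h1 : ‖f1 * a1 * b1 * (c1 - c2)‖ ≤ 1 * P * P * ‖c1 - c2‖ := by
    rw [norm_mul, norm_mul, norm_mul]; gcongr
  have h2 : ‖c2 * (f1 * a1 * b1 - f2 * a2 * b2)‖ ≤
      P * (P * (‖a1 - a2‖ + ‖b1 - b2‖) + P ^ 2 * F) := by
    rw [norm_mul]
    exact mul_le_mul hc2 (tri_bd hf hF ha1 ha2 hb2) (norm_nonneg _) hP
  rw [e]
  refine (norm_add_le _ _).trans ?_
  nlinarith

lemma inv_bd {l : ℂ} (h : 1 ≤ ‖l‖) : ‖l⁻¹‖ ≤ 1 := by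
  rw [norm_inv]; exact inv_le_one_of_one_le₀ h

lemma inv_diff {l1 l2 : ℂ} (h1 : 1 ≤ ‖l1‖) (h2 : 1 ≤ ‖l2‖) : ‖l1⁻¹ - l2⁻¹‖ ≤ ‖l1 - l2‖ := by
  have n1 : l1 ≠ 0 := by rintro rfl; norm_num at h1
  have n2 : l2 ≠ 0 := by rintro rfl; norm_num at h2
  have : l1⁻¹ - l2⁻¹ = l1⁻¹ * l2⁻¹ * -(l1 - l2) := by field_simp; ring
  rw [this, norm_mul, norm_mul, norm_neg]
  have := inv_bd h1
  have := inv_bd h2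
  calc _ ≤ 1 * 1 * ‖l1 - l2‖ := by gcongr
    _ = _ := by ring

lemma md {a1 a2 b1 b2 : ℂ} {A B : ℝ} (h1 : ‖a1‖ ≤ 1) (h2 : ‖b2‖ ≤ 1) (hA : ‖a1 - a2‖ ≤ A)
    (hB : ‖b1 - b2‖ ≤ B) : ‖a1 * b1 - a2 * b2‖ ≤ A + B := by
  have : a1 * b1 - a2 * b2 = a1 * (b1 - b2) + (a1 - a2) * b2 := by ring
  rw [this]
  refine (norm_add_le _ _).trans ?_
  rw [norm_mul, norm_mul]
  have := mul_le_mul h1 hB (norm_nonneg _) zero_le_one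
  have := mul_le_mul hA h2 (norm_nonneg _) ((norm_nonneg _).trans hA)
  linarith

lemma nconj (z : ℂ) : ‖conj z‖ = ‖z‖ := Complex.norm_conj z

lemma p_bd {l : ℂ} (h : 1 ≤ ‖l‖) : ‖l * conj l⁻¹‖ ≤ 1 := by
  rw [norm_mul, nconj, norm_inv, mul_inv_cancel₀ (by positivity)]

lemma p_diff {l1 l2 : ℂ} (h1 : 1 ≤ ‖l1‖) (h2 : 1 ≤ ‖l2‖) :
    ‖l1 * conj l1⁻¹ - l2 * conj l2⁻¹‖ ≤ 2 * ‖l1 - l2‖ := by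
  have n1 : l1 ≠ 0 := by rintro rfl; norm_num at h1
  have n2 : l2 ≠ 0 := by rintro rfl; norm_num at h2
  have n1' : conj l1 ≠ 0 := by simpa using n1
  have n2' : conj l2 ≠ 0 := by simpa using n2
  have : l1 * conj l1⁻¹ - l2 * conj l2⁻¹ =
      (l1 - l2) * conj l1⁻¹ - l2 * conj l2⁻¹ * (conj l1⁻¹ * conj (l1 - l2)) := by
    simp only [map_inv₀, map_sub]; field_simp; ring
  rw [this]
  refine (norm_sub_le _ _).trans ?_
  rw [norm_mul, norm_mul (l2 * conj l2⁻¹), norm_mul (conj l1⁻¹), nconj, nconj]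
  have i1 := inv_bd h1
  have i2 := p_bd h2
  have e1 : ‖l1 - l2‖ * ‖l1⁻¹‖ ≤ ‖l1 - l2‖ * 1 := by gcongr
  have e2 : ‖l2 * conj l2⁻¹‖ * (‖l1⁻¹‖ * ‖l1 - l2‖) ≤ 1 * (1 * ‖l1 - l2‖) := by gcongr
  linarith

/-- all coefficient bounds -/
structure Co (l1 l2 : ℂ) : Prop where
  e : ‖l1⁻¹‖ ≤ 1
  b : ‖conj l1⁻¹‖ ≤ 1
  pb : ‖l1 * conj l1⁻¹ * conj l1⁻¹‖ ≤ 1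
  ee : ‖l1⁻¹ * l1⁻¹‖ ≤ 1
  bb : ‖conj l1⁻¹ * conj l1⁻¹‖ ≤ 1
  pbb : ‖l1 * conj l1⁻¹ * conj l1⁻¹ * conj l1⁻¹‖ ≤ 1
  de : ‖l1⁻¹ - l2⁻¹‖ ≤ 4 * ‖l1 - l2‖
  db : ‖conj l1⁻¹ - conj l2⁻¹‖ ≤ 4 * ‖l1 - l2‖
  dpb : ‖l1 * conj l1⁻¹ * conj l1⁻¹ - l2 * conj l2⁻¹ * conj l2⁻¹‖ ≤ 4 * ‖l1 - l2‖
  dee : ‖l1⁻¹ * l1⁻¹ - l2⁻¹ * l2⁻¹‖ ≤ 4 * ‖l1 - l2‖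
  dbb : ‖conj l1⁻¹ * conj l1⁻¹ - conj l2⁻¹ * conj l2⁻¹‖ ≤ 4 * ‖l1 - l2‖
  dpbb : ‖l1 * conj l1⁻¹ * conj l1⁻¹ * conj l1⁻¹ - l2 * conj l2⁻¹ * conj l2⁻¹ * conj l2⁻¹‖
    ≤ 4 * ‖l1 - l2‖

lemma m1 {a b : ℂ} (h1 : ‖a‖ ≤ 1) (h2 : ‖b‖ ≤ 1) : ‖a * b‖ ≤ 1 := by
  rw [norm_mul]; exact mul_le_one₀ h1 (norm_nonneg _) h2

lemma co_of {l1 l2 : ℂ} (h1 : 1 ≤ ‖l1‖) (h2 : 1 ≤ ‖l2‖) : Co l1 l2 := by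
  have e1 := inv_bd h1
  have e2 := inv_bd h2
  have b1 : ‖conj l1⁻¹‖ ≤ 1 := by rwa [nconj]
  have b2 : ‖conj l2⁻¹‖ ≤ 1 := by rwa [nconj]
  have p1 := p_bd h1
  have p2 := p_bd h2
  have de := inv_diff h1 h2
  have db : ‖conj l1⁻¹ - conj l2⁻¹‖ ≤ ‖l1 - l2‖ := by rw [← map_sub, nconj]; exact de
  have dp := p_diff h1 h2
  have dpb := md p1 b2 dp db
  have dpbb := md (m1 p1 b1) b2 dpb db
  have n := norm_nonneg (l1 - l2)
  refine ⟨e1, b1, m1 p1 b1, m1 e1 e1, m1 b1 b1, m1 (m1 p1 b1) b1, ?_, ?_, ?_, ?_, ?_, ?_⟩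
  · linarith
  · linarith
  · linarith
  · linarith [md e1 e2 de de]
  · linarith [md b1 b2 db db]
  · linarith

lemma rc_eq (l r k : ℂ) (t : ℂ) : rc l r k t =
    1 / 2 * (l⁻¹ * r * r) + 1 / 2 * (l * conj l⁻¹ * conj l⁻¹ * conj r * conj r)
    - l⁻¹ * r * k - l * conj l⁻¹ * conj l⁻¹ * conj r * conj k - conj l⁻¹ * r * conj k
    + conj l⁻¹ * conj r * k - t / 2 * (l⁻¹ * l⁻¹ * r * r * k)
    + t / 2 * (conj l⁻¹ * conj l⁻¹ * conj r * conj r * k)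
    - t * (l * conj l⁻¹ * conj l⁻¹ * conj l⁻¹ * conj r * conj r * conj k) := by
  unfold rc
  simp only [map_inv₀, div_eq_mul_inv]
  ring

lemma cub_part {l1 l2 r1 r2 k1 k2 : ℂ} {t : ℝ} {P : ℝ} (h : Co l1 l2)
    (hr1 : ‖r1‖ ≤ P) (hr2 : ‖r2‖ ≤ P) (hk2 : ‖k2‖ ≤ P) :
    ‖- (t : ℂ) / 2 * (l1⁻¹ * l1⁻¹ * r1 * r1 * k1 - l2⁻¹ * l2⁻¹ * r2 * r2 * k2)
     + t / 2 * (conj l1⁻¹ * conj l1⁻¹ * conj r1 * conj r1 * k1 -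
        conj l2⁻¹ * conj l2⁻¹ * conj r2 * conj r2 * k2)
     - t * (l1 * conj l1⁻¹ * conj l1⁻¹ * conj l1⁻¹ * conj r1 * conj r1 * conj k1 -
       l2 * conj l2⁻¹ * conj l2⁻¹ * conj l2⁻¹ * conj r2 * conj r2 * conj k2)‖ ≤
      |t| * (4 * P ^ 2 * (‖r1 - r2‖ + ‖k1 - k2‖) + 8 * P ^ 3 * ‖l1 - l2‖) := by
  have hr1' : ‖conj r1‖ ≤ P := by rwa [nconj]
  have hr2' : ‖conj r2‖ ≤ P := by rwa [nconj]
  have hk2' : ‖conj k2‖ ≤ P := by rwa [nconj]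
  have q1 := cub_bd (c1 := k1) h.ee h.dee hr1 hr1 hr2 hr2 hk2
  have q2 := cub_bd (c1 := k1) h.bb h.dbb hr1' hr1' hr2' hr2' hk2
  have q3 := cub_bd (c1 := conj k1) h.pbb h.dpbb hr1' hr1' hr2' hr2' hk2'
  simp only [← map_sub conj, nconj] at q2 q3
  set T1 := l1⁻¹ * l1⁻¹ * r1 * r1 * k1 - l2⁻¹ * l2⁻¹ * r2 * r2 * k2
  set T2 := conj l1⁻¹ * conj l1⁻¹ * conj r1 * conj r1 * k1 -
        conj l2⁻¹ * conj l2⁻¹ * conj r2 * conj r2 * k2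
  set T3 := l1 * conj l1⁻¹ * conj l1⁻¹ * conj l1⁻¹ * conj r1 * conj r1 * conj k1 -
       l2 * conj l2⁻¹ * conj l2⁻¹ * conj l2⁻¹ * conj r2 * conj r2 * conj k2
  have hT : -(t : ℂ) / 2 * T1 + t / 2 * T2 - t * T3 = t * (-(1 / 2) * T1 + 1 / 2 * T2 - T3) := by
    ring
  rw [hT, norm_mul, Complex.norm_real, Real.norm_eq_abs]
  refine mul_le_mul_of_nonneg_left ?_ (abs_nonneg _)
  have : ‖-(1 / 2) * T1 + 1 / 2 * T2 - T3‖ ≤ 1 / 2 * ‖T1‖ + 1 / 2 * ‖T2‖ + ‖T3‖ := by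
    refine (norm_sub_le _ _).trans (add_le_add_left ((norm_add_le _ _).trans ?_) _)
    rw [norm_mul, norm_mul]
    norm_num
  have : 0 ≤ P ^ 2 * ‖k1 - k2‖ := by positivity
  linarith

lemma norm6 (a b c d e f : ℂ) : ‖1 / 2 * a + 1 / 2 * b - c - d - e + f‖ ≤
    1 / 2 * ‖a‖ + 1 / 2 * ‖b‖ + ‖c‖ + ‖d‖ + ‖e‖ + ‖f‖ := by
  have h1 := norm_add_le (1 / 2 * a + 1 / 2 * b - c - d - e) f
  have h2 := norm_sub_le (1 / 2 * a + 1 / 2 * b - c - d) e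
  have h3 := norm_sub_le (1 / 2 * a + 1 / 2 * b - c) d
  have h4 := norm_sub_le (1 / 2 * a + 1 / 2 * b) c
  have h5 := norm_add_le (1 / 2 * a) (1 / 2 * b)
  have h6 : ‖1 / 2 * a‖ = 1 / 2 * ‖a‖ := by rw [norm_mul]; norm_num
  have h7 : ‖1 / 2 * b‖ = 1 / 2 * ‖b‖ := by rw [norm_mul]; norm_num
  linarith

/-- pointwise bound, no freezing -/
lemma rc_bd {l1 l2 r1 r2 k1 k2 : ℂ} {t : ℝ} {P M : ℝ} (h1 : 1 ≤ ‖l1‖) (h2 : 1 ≤ ‖l2‖)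
    (hr1 : ‖r1‖ ≤ P) (hr2 : ‖r2‖ ≤ P) (hk1 : ‖k1‖ ≤ P) (hk2 : ‖k2‖ ≤ P) (hM : 1 ≤ M)
    (ht : |t| * P ≤ M) :
    ‖rc l1 r1 k1 t - rc l2 r2 k2 t‖ ≤
      20 * M * (P * (‖r1 - r2‖ + ‖k1 - k2‖) + 2 * P ^ 2 * ‖l1 - l2‖) := by
  have h := co_of h1 h2
  have hP : 0 ≤ P := (norm_nonneg _).trans hr1
  have hr1' : ‖conj r1‖ ≤ P := by rwa [nconj]
  have hr2' : ‖conj r2‖ ≤ P := by rwa [nconj]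
  have hk2' : ‖conj k2‖ ≤ P := by rwa [nconj]
  have q1 := tri_bd (b1 := r1) h.e h.de hr1 hr2 hr2
  have q2 := tri_bd (b1 := conj r1) h.pb h.dpb hr1' hr2' hr2'
  have q3 := tri_bd (b1 := k1) h.e h.de hr1 hr2 hk2
  have q4 := tri_bd (b1 := conj k1) h.pb h.dpb hr1' hr2' hk2'
  have q5 := tri_bd (b1 := conj k1) h.b h.db hr1 hr2 hk2'
  have q6 := tri_bd (b1 := k1) h.b h.db hr1' hr2' hk2
  simp only [← map_sub conj, nconj] at q1 q2 q3 q4 q5 q6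
  have q7 := cub_part (t := t) (k1 := k1) h hr1 hr2 hk2
  have hc : |t| * (4 * P ^ 2 * (‖r1 - r2‖ + ‖k1 - k2‖) + 8 * P ^ 3 * ‖l1 - l2‖) ≤
      M * (4 * P * (‖r1 - r2‖ + ‖k1 - k2‖) + 8 * P ^ 2 * ‖l1 - l2‖) := by
    calc _ = (|t| * P) * (4 * P * (‖r1 - r2‖ + ‖k1 - k2‖) + 8 * P ^ 2 * ‖l1 - l2‖) := by ring
      _ ≤ _ := by gcongr
  have q8 := norm6 _ _ _ _ _ _ |>.trans (add_le_add (add_le_add (add_le_add (add_le_add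
    (add_le_add (mul_le_mul_of_nonneg_left q1 (by norm_num))
    (mul_le_mul_of_nonneg_left q2 (by norm_num))) q3) q4) q5) q6)
  have q9 := (norm_add_le _ _).trans (add_le_add q8 q7)
  have a1 : 0 ≤ P * ‖r1 - r2‖ := by positivity
  have a2 : 0 ≤ P * ‖k1 - k2‖ := by positivity
  have a3 : 0 ≤ P ^ 2 * ‖l1 - l2‖ := by positivity
  have b1 := mul_le_mul_of_nonneg_right hM a1
  have b2 := mul_le_mul_of_nonneg_right hM a2
  have b3 := mul_le_mul_of_nonneg_right hM a3
  refine le_trans (le_of_eq ?_) (q9.trans ?_)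
  · rw [rc_eq, rc_eq]
    congr 1
    ring
  · nlinarith

/-- the frozen linear form -/
def Lam (v z1 z2 r k : ℂ) : ℂ :=
  1 / 2 * (v⁻¹ * (z1 * r + z2 * r)) +
  1 / 2 * (v * conj v⁻¹ * conj v⁻¹ * (conj z1 * conj r + conj z2 * conj r))
  - v⁻¹ * (z1 * k + z2 * r) - v * conj v⁻¹ * conj v⁻¹ * (conj z1 * conj k + conj z2 * conj r)
  - conj v⁻¹ * (z1 * conj k + conj z2 * r) + conj v⁻¹ * (conj z1 * k + z2 * conj r)

/-- pointwise bound with freezing -/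
lemma rc_fr {l1 l2 r1 r2 k1 k2 v z1 z2 : ℂ} {t : ℝ} {P M δ η : ℝ} (h1 : 1 ≤ ‖l1‖)
    (h2 : 1 ≤ ‖l2‖) (hv : 1 ≤ ‖v‖)
    (hr1 : ‖r1‖ ≤ P) (hr2 : ‖r2‖ ≤ P) (hk1 : ‖k1‖ ≤ P) (hk2 : ‖k2‖ ≤ P) (hM : 1 ≤ M)
    (ht : |t| * P ≤ M) (hz1 : ‖z1‖ ≤ P) (hz2 : ‖z2‖ ≤ P) (d1 : ‖r1 - z1‖ ≤ δ)
    (d2 : ‖r2 - z2‖ ≤ δ) (d4 : ‖k2 - z2‖ ≤ δ)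
    (hη : 4 * ‖l1 - v‖ ≤ η) :
    ‖rc l1 r1 k1 t - rc l2 r2 k2 t - Lam v z1 z2 (r1 - r2) (k1 - k2)‖ ≤
      20 * (δ + η * P + |t| * P ^ 2) * (‖r1 - r2‖ + ‖k1 - k2‖) + 40 * M * P ^ 2 * ‖l1 - l2‖ := by
  have h := co_of h1 h2
  have hh := co_of h1 hv
  have hP : 0 ≤ P := (norm_nonneg _).trans hr1
  have hδ : 0 ≤ δ := (norm_nonneg _).trans d1
  have hη' : 0 ≤ η := by linarith [norm_nonneg (l1 - v)]
  have hr1' : ‖conj r1‖ ≤ P := by rwa [nconj]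
  have hr2' : ‖conj r2‖ ≤ P := by rwa [nconj]
  have hk2' : ‖conj k2‖ ≤ P := by rwa [nconj]
  have hz1' : ‖conj z1‖ ≤ P := by rwa [nconj]
  have hz2' : ‖conj z2‖ ≤ P := by rwa [nconj]
  have d1' : ‖conj r1 - conj z1‖ ≤ δ := by rwa [← map_sub, nconj]
  have d2' : ‖conj r2 - conj z2‖ ≤ δ := by rwa [← map_sub, nconj]
  have d4' : ‖conj k2 - conj z2‖ ≤ δ := by rwa [← map_sub, nconj]
  have q1 := tri_fr (b1 := r1) h.e h.de (hh.de.trans hη) hz1 hz2 d1 d2 hr2 hr2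
  have q2 := tri_fr (b1 := conj r1) h.pb h.dpb (hh.dpb.trans hη) hz1' hz2' d1' d2' hr2' hr2'
  have q3 := tri_fr (b1 := k1) h.e h.de (hh.de.trans hη) hz1 hz2 d1 d4 hr2 hk2
  have q4 := tri_fr (b1 := conj k1) h.pb h.dpb (hh.dpb.trans hη) hz1' hz2' d1' d4' hr2' hk2'
  have q5 := tri_fr (b1 := conj k1) h.b h.db (hh.db.trans hη) hz1 hz2' d1 d4' hr2 hk2'
  have q6 := tri_fr (b1 := k1) h.b h.db (hh.db.trans hη) hz1' hz2 d1' d4 hr2' hk2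
  simp only [← map_sub conj, nconj] at q1 q2 q3 q4 q5 q6
  have q7 := cub_part (t := t) (k1 := k1) h hr1 hr2 hk2
  have hc : |t| * (4 * P ^ 2 * (‖r1 - r2‖ + ‖k1 - k2‖) + 8 * P ^ 3 * ‖l1 - l2‖) ≤
      4 * (|t| * P ^ 2) * (‖r1 - r2‖ + ‖k1 - k2‖) + 8 * M * P ^ 2 * ‖l1 - l2‖ := by
    calc _ = 4 * (|t| * P ^ 2) * (‖r1 - r2‖ + ‖k1 - k2‖) +
          8 * (|t| * P) * P ^ 2 * ‖l1 - l2‖ := by ring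
      _ ≤ _ := by gcongr
  have q8 := norm6 _ _ _ _ _ _ |>.trans (add_le_add (add_le_add (add_le_add (add_le_add
    (add_le_add (mul_le_mul_of_nonneg_left q1 (by norm_num))
    (mul_le_mul_of_nonneg_left q2 (by norm_num))) q3) q4) q5) q6)
  have q9 := (norm_add_le _ _).trans (add_le_add q8 q7)
  have a1 : 0 ≤ (δ + η * P + |t| * P ^ 2) * ‖r1 - r2‖ := by positivity
  have a2 : 0 ≤ (δ + η * P + |t| * P ^ 2) * ‖k1 - k2‖ := by positivity
  have a3 : 0 ≤ P ^ 2 * ‖l1 - l2‖ := by positivity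
  have a4 : 0 ≤ |t| * P ^ 2 * ‖r1 - r2‖ := by positivity
  have a5 : 0 ≤ |t| * P ^ 2 * ‖k1 - k2‖ := by positivity
  have b3 := mul_le_mul_of_nonneg_right hM a3
  refine le_trans (le_of_eq ?_) (q9.trans ?_)
  · rw [rc_eq, rc_eq, Lam]
    congr 1
    simp only [map_sub]
    ring
  · nlinarith

lemma Lam_int {v z1 z2 : ℂ} : ∃ c1 c2 c3 c4 : ℂ,
    (∀ r k, Lam v z1 z2 r k = c1 * r + c2 * conj r + c3 * k + c4 * conj k) ∧
    (∀ P, 1 ≤ ‖v‖ → ‖z1‖ ≤ P → ‖z2‖ ≤ P → ‖c1‖ ≤ 3 * P ∧ ‖c2‖ ≤ 3 * P ∧ ‖c3‖ ≤ 3 * P ∧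
      ‖c4‖ ≤ 3 * P) := by
  refine ⟨1 / 2 * (v⁻¹ * z1) + -(1 / 2) * (v⁻¹ * z2) - conj v⁻¹ * conj z2,
    1 / 2 * (v * conj v⁻¹ * conj v⁻¹ * conj z1) + -(1 / 2) * (v * conj v⁻¹ * conj v⁻¹ * conj z2)
      + conj v⁻¹ * z2,
    conj v⁻¹ * conj z1 - v⁻¹ * z1,
    -(v * conj v⁻¹ * conj v⁻¹ * conj z1) - conj v⁻¹ * z1, ?_, ?_⟩
  · intro r k; unfold Lam; ring
  · intro P hv h1 h2
    have h := co_of hv hv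
    have h1' : ‖conj z1‖ ≤ P := by rwa [nconj]
    have h2' : ‖conj z2‖ ≤ P := by rwa [nconj]
    have g : ∀ a z : ℂ, ‖a‖ ≤ 1 → ‖z‖ ≤ P → ‖a * z‖ ≤ P := by
      intro a z ha hz
      rw [norm_mul]
      calc _ ≤ 1 * P := by gcongr
        _ = P := one_mul _
    have g2 : ∀ a : ℂ, ‖a‖ ≤ P → ‖1 / 2 * a‖ ≤ P := by
      intro a ha
      refine g _ _ ?_ ha
      norm_num
    have g3 : ∀ a : ℂ, ‖a‖ ≤ P → ‖-(1 / 2) * a‖ ≤ P := by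
      intro a ha
      refine g _ _ ?_ ha
      norm_num
    have hP : 0 ≤ P := (norm_nonneg _).trans h1
    refine ⟨?_, ?_, ?_, ?_⟩
    · refine (norm_sub_le _ _).trans (le_trans (add_le_add ((norm_add_le _ _).trans (add_le_add
        (g2 _ (g _ _ h.e h1)) (g3 _ (g _ _ h.e h2)))) (g _ _ h.b h2')) (by linarith))
    · refine (norm_add_le _ _).trans (le_trans (add_le_add ((norm_add_le _ _).trans (add_le_add
        (g2 _ (g _ _ h.pb h1')) (g3 _ (g _ _ h.pb h2')))) (g _ _ h.b h2)) (by linarith))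
    · refine (norm_sub_le _ _).trans (le_trans (add_le_add
        (g _ _ h.b h1') (g _ _ h.e h1)) (by linarith))
    · have := (norm_neg _).trans_le (g _ _ h.pb h1')
      exact (norm_sub_le _ _).trans (le_trans (add_le_add this (g _ _ h.b h1)) (by linarith))

def Wc (l r k t : ℂ) : ℂ := F0c l r t + Vc l k

lemma F0c_eq (l r t : ℂ) : F0c l r t = r + l * conj l⁻¹ * conj r +
    t / 2 * (l⁻¹ * r * r + l * conj l⁻¹ * conj l⁻¹ * conj r * conj r) := by
  unfold F0c
  simp only [map_inv₀, div_eq_mul_inv]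
  ring

lemma Wc_eq (l r k t : ℂ) : Wc l r k t = (r + k) + l * conj l⁻¹ * conj (r + k) +
    t / 2 * (l⁻¹ * r * r + l * conj l⁻¹ * conj l⁻¹ * conj r * conj r) := by
  unfold Wc F0c Vc
  simp only [map_inv₀, div_eq_mul_inv, map_add]
  ring

lemma quad_bd {l r : ℂ} {P : ℝ} (h1 : 1 ≤ ‖l‖) (hr : ‖r‖ ≤ P) (t : ℝ) :
    ‖(t : ℂ) / 2 * (l⁻¹ * r * r + l * conj l⁻¹ * conj l⁻¹ * conj r * conj r)‖ ≤ |t| * P ^ 2 := by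
  have h := co_of h1 h1
  have hP : 0 ≤ P := (norm_nonneg _).trans hr
  have e1 : ‖l⁻¹ * r * r‖ ≤ 1 * P * P := by
    rw [norm_mul, norm_mul]; have := h.e; gcongr
  have e2 : ‖l * conj l⁻¹ * conj l⁻¹ * conj r * conj r‖ ≤ 1 * P * P := by
    rw [norm_mul, norm_mul, nconj]; have := h.pb; gcongr
  rw [norm_mul, norm_div, Complex.norm_real, Real.norm_eq_abs, Complex.norm_ofNat]
  calc _ ≤ |t| / 2 * (1 * P * P + 1 * P * P) := by
        gcongr; exact (norm_add_le _ _).trans (add_le_add e1 e2)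
    _ = _ := by ring

lemma F0c_bd {l r : ℂ} {t P M : ℝ} (h1 : 1 ≤ ‖l‖) (hr : ‖r‖ ≤ P) (hM : 1 ≤ M) (ht : |t| * P ≤ M) :
    ‖F0c l r t‖ ≤ 3 * M * P := by
  have hP : 0 ≤ P := (norm_nonneg _).trans hr
  rw [F0c_eq]
  refine (norm_add₃_le).trans ?_
  have e2 : ‖l * conj l⁻¹ * conj r‖ ≤ 1 * P := by
    rw [norm_mul, nconj]; have := p_bd h1; gcongr
  have e3 := quad_bd h1 hr t
  have e4 : |t| * P ^ 2 ≤ M * P := by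
    calc _ = |t| * P * P := by ring
      _ ≤ _ := by gcongr
  nlinarith

lemma pdel {p1 p2 a b : ℂ} (h : ‖p1‖ ≤ 1) :
    ‖a + p1 * conj a - (b + p2 * conj b)‖ ≤ 2 * ‖a - b‖ + ‖p1 - p2‖ * ‖b‖ := by
  have e : a + p1 * conj a - (b + p2 * conj b) =
      (a - b) + p1 * conj (a - b) + (p1 - p2) * conj b := by
    rw [map_sub]; ring
  rw [e]
  refine (norm_add₃_le).trans ?_
  rw [norm_mul, norm_mul, nconj, nconj]
  have : ‖p1‖ * ‖a - b‖ ≤ 1 * ‖a - b‖ := by gcongr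
  linarith

lemma Wc_diff {l1 l2 r1 r2 k1 k2 : ℂ} {t P : ℝ} (h1 : 1 ≤ ‖l1‖) (h2 : 1 ≤ ‖l2‖)
    (hr1 : ‖r1‖ ≤ P) (hr2 : ‖r2‖ ≤ P) (hk2 : ‖k2‖ ≤ P) :
    ‖Wc l1 r1 k1 t - Wc l2 r2 k2 t‖ ≤ 2 * ‖(r1 + k1) - (r2 + k2)‖ + 4 * P * ‖l1 - l2‖ +
      |t| * (2 * P * ‖r1 - r2‖ + 4 * P ^ 2 * ‖l1 - l2‖) := by
  have h := co_of h1 h2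
  have hP : 0 ≤ P := (norm_nonneg _).trans hr1
  have hr1' : ‖conj r1‖ ≤ P := by rwa [nconj]
  have hr2' : ‖conj r2‖ ≤ P := by rwa [nconj]
  have q1 := tri_bd (b1 := r1) h.e h.de hr1 hr2 hr2
  have q2 := tri_bd (b1 := conj r1) h.pb h.dpb hr1' hr2' hr2'
  simp only [← map_sub conj, nconj] at q1 q2
  have q3 := pdel (p2 := l2 * conj l2⁻¹) (a := r1 + k1) (b := r2 + k2) (p_bd h1)
  have q4 : ‖l1 * conj l1⁻¹ - l2 * conj l2⁻¹‖ * ‖r2 + k2‖ ≤ 2 * ‖l1 - l2‖ * (P + P) := by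
    have := p_diff h1 h2
    have := (norm_add_le r2 k2).trans (add_le_add hr2 hk2)
    gcongr
  have e : Wc l1 r1 k1 t - Wc l2 r2 k2 t =
      (r1 + k1 + l1 * conj l1⁻¹ * conj (r1 + k1) - (r2 + k2 + l2 * conj l2⁻¹ * conj (r2 + k2)))
      + t / 2 * ((l1⁻¹ * r1 * r1 - l2⁻¹ * r2 * r2) +
        (l1 * conj l1⁻¹ * conj l1⁻¹ * conj r1 * conj r1 -
         l2 * conj l2⁻¹ * conj l2⁻¹ * conj r2 * conj r2)) := by
    rw [Wc_eq, Wc_eq]; ring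
  rw [e]
  refine (norm_add_le _ _).trans ?_
  rw [norm_mul, norm_div, Complex.norm_real, Real.norm_eq_abs, Complex.norm_ofNat]
  have q5 := (norm_add_le _ _).trans (add_le_add q1 q2)
  have q6 := mul_le_mul_of_nonneg_left q5 (show 0 ≤ |t| / 2 by positivity)
  nlinarith

lemma Wc_pm {l1 l2 r1 r2 k1 k2 : ℂ} {t P : ℝ} (h1 : 1 ≤ ‖l1‖) (h2 : 1 ≤ ‖l2‖)
    (hr1 : ‖r1‖ ≤ P) (hr2 : ‖r2‖ ≤ P) (hk2 : ‖k2‖ ≤ P) (hl : ‖l1 - l2‖ ≤ |t| * (2 * P)) :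
    ‖Wc l1 r1 k1 t - Wc l2 r2 k2 (-t : ℝ)‖ ≤ 2 * ‖(r1 + k1) - (r2 + k2)‖ + 10 * |t| * P ^ 2 := by
  have hP : 0 ≤ P := (norm_nonneg _).trans hr1
  have q3 := pdel (p2 := l2 * conj l2⁻¹) (a := r1 + k1) (b := r2 + k2) (p_bd h1)
  have q4 : ‖l1 * conj l1⁻¹ - l2 * conj l2⁻¹‖ * ‖r2 + k2‖ ≤ 2 * (|t| * (2 * P)) * (P + P) := by
    have := (p_diff h1 h2).trans (mul_le_mul_of_nonneg_left hl (by norm_num))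
    have := (norm_add_le r2 k2).trans (add_le_add hr2 hk2)
    gcongr
  have q5 := quad_bd h1 hr1 t
  have q6 := quad_bd h2 hr2 (-t)
  rw [abs_neg] at q6
  rw [Wc_eq, Wc_eq]
  have g : ∀ a b c d : ℂ, ‖a + b - (c + d)‖ ≤ ‖a - c‖ + ‖b‖ + ‖d‖ := by
    intro a b c d
    have : a + b - (c + d) = (a - c) + b - d := by ring
    rw [this]
    exact (norm_sub_le _ _).trans (add_le_add_left (norm_add_le _ _) _)
  refine (g _ _ _ _).trans ?_
  nlinarith

/-- periodic C1 curve -/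
structure PC (X x : ℝ → ℂ) : Prop where
  per : Function.Periodic X (2 * π)
  der : ∀ s, HasDerivAt X (x s) s
  cont : Continuous x

lemma Nice.pc {X x : ℝ → ℂ} (h : Nice X x) : PC X x := ⟨h.per, h.der, h.cont⟩

lemma PC.sub {X x Y y : ℝ → ℂ} (h : PC X x) (h' : PC Y y) :
    PC (fun s => X s - Y s) (fun s => x s - y s) :=
  ⟨fun s => by simp only [h.per s, h'.per s], fun s => (h.der s).sub (h'.der s), h.cont.sub h'.cont⟩

lemma PC.contX {X x : ℝ → ℂ} (h : PC X x) : Continuous X :=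
  continuous_iff_continuousAt.2 fun s => (h.der s).continuousAt

lemma PC.perx {X x : ℝ → ℂ} (h : PC X x) : Function.Periodic x (2 * π) := by
  intro s
  have h1 := (h.der (s + 2 * π)).scomp s ((hasDerivAt_id s).add_const (2 * π))
  have h2 : (X ∘ fun s => id s + 2 * π) = X := funext fun s => h.per s
  rw [h2] at h1
  simpa using h1.unique (h.der s)

def mkap (ξ : ℝ) : ℂ := Complex.exp (Complex.I * ξ) - 1 - Complex.I * ξ
def mrho (ξ : ℝ) : ℂ := Complex.I * ξ * Complex.exp (Complex.I * ξ) - Complex.exp (Complex.I * ξ) + 1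

lemma norm_eI (ξ : ℝ) : ‖Complex.exp (Complex.I * ξ)‖ = 1 := by
  rw [mul_comm]; exact Complex.norm_exp_ofReal_mul_I ξ

lemma mr_eq (ξ : ℝ) : mrho ξ = Complex.exp (Complex.I * ξ) * mkap (-ξ) := by
  unfold mrho mkap
  have : Complex.exp (Complex.I * ξ) * Complex.exp (Complex.I * ((-ξ : ℝ) : ℂ)) = 1 := by
    rw [← Complex.exp_add]; simp
  push_cast at *
  linear_combination -this

lemma norm_Iξ (ξ : ℝ) : ‖Complex.I * (ξ : ℂ)‖ = |ξ| := by simp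

lemma eI_sub (ξ : ℝ) : ‖Complex.exp (Complex.I * ξ) - 1‖ ≤ |ξ| :=
  Real.norm_exp_I_mul_ofReal_sub_one_le

lemma eI_sub2 (ξ : ℝ) : ‖Complex.exp (Complex.I * ξ) - 1‖ ≤ 2 := by
  refine (norm_sub_le _ _).trans ?_
  rw [norm_eI]; norm_num

lemma mk_bd (ξ : ℝ) : ‖mkap ξ‖ ≤ 2 * |ξ| * min |ξ| 1 := by
  have h1 : ‖mkap ξ‖ ≤ 2 * |ξ| := by
    have := norm_sub_le (Complex.exp (Complex.I * ξ) - 1) (Complex.I * ξ)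
    rw [norm_Iξ] at this
    have := eI_sub ξ
    unfold mkap; linarith
  rcases le_total |ξ| 1 with h | h
  · rw [min_eq_left h]
    have := Complex.norm_exp_sub_one_sub_id_le (x := Complex.I * ξ) (by rwa [norm_Iξ])
    rw [norm_Iξ] at this
    unfold mkap
    nlinarith [sq_nonneg |ξ|]
  · rw [min_eq_right h]; linarith

lemma mr_bd (ξ : ℝ) : ‖mrho ξ‖ ≤ 2 * |ξ| * min |ξ| 1 := by
  rw [mr_eq, norm_mul, norm_eI, one_mul]
  simpa using mk_bd (-ξ)

lemma mk_fr {γ : ℝ} (hγ : 0 < γ) (hγ1 : γ ≤ 1) (ξ : ℝ) :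
    ‖mkap ξ + ξ ^ 2 / 2‖ ≤ 4 * |ξ| ^ (2 + γ) := by
  rcases le_total |ξ| 1 with h | h
  · have := Complex.exp_bound (x := Complex.I * ξ) (by rwa [norm_Iξ]) (n := 3) (by norm_num)
    rw [norm_Iξ] at this
    have e : Complex.exp (Complex.I * ξ) - ∑ m ∈ Finset.range 3, (Complex.I * ξ) ^ m / (m.factorial : ℂ)
        = mkap ξ + ξ ^ 2 / 2 := by
      simp only [Finset.sum_range_succ, Finset.sum_range_zero, mkap]
      simp only [mul_pow, Complex.I_sq]
      norm_num [Nat.factorial]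
      ring
    rw [e] at this
    have h3 : |ξ| ^ 3 ≤ |ξ| ^ (2 + γ) := by
      rcases eq_or_lt_of_le (abs_nonneg ξ) with h0 | h0
      · rw [← h0, Real.zero_rpow (by linarith)]; norm_num
      · rw [← Real.rpow_natCast]
        exact Real.rpow_le_rpow_of_exponent_ge h0 h (by push_cast; linarith)
    have h4 : |ξ| ^ 3 * ((Nat.succ 3 : ℕ) * ((Nat.factorial 3 : ℕ) * (3 : ℕ) : ℝ)⁻¹) ≤ |ξ| ^ 3 := by
      have : 0 ≤ |ξ| ^ 3 := by positivity
      norm_num [Nat.factorial]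
      nlinarith
    have : 0 ≤ |ξ| ^ (2 + γ) := by positivity
    have h5 := this.trans_eq rfl
    linarith
  · have h1 := mk_bd ξ
    rw [min_eq_right h] at h1
    have h2 : ‖(ξ : ℂ) ^ 2 / 2‖ = |ξ| ^ 2 / 2 := by simp
    have h3 := norm_add_le (mkap ξ) ((ξ : ℂ) ^ 2 / 2)
    have h4 : |ξ| ^ (2 : ℝ) ≤ |ξ| ^ (2 + γ) := Real.rpow_le_rpow_of_exponent_le h (by linarith)
    rw [Real.rpow_two] at h4
    nlinarith

lemma eI_gam {γ : ℝ} (hγ : 0 < γ) (hγ1 : γ ≤ 1) (ξ : ℝ) :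
    ‖Complex.exp (Complex.I * ξ) - 1‖ ≤ 2 * |ξ| ^ γ := by
  rcases le_total |ξ| 1 with h | h
  · have h1 := eI_sub ξ
    have h3 : |ξ| ≤ |ξ| ^ γ := by
      rcases eq_or_lt_of_le (abs_nonneg ξ) with h0 | h0
      · rw [← h0, Real.zero_rpow (by linarith)]
      · conv_lhs => rw [← Real.rpow_one |ξ|]
        exact Real.rpow_le_rpow_of_exponent_ge h0 h hγ1
    have := abs_nonneg ξ
    linarith
  · have h1 := eI_sub2 ξ
    have := Real.one_le_rpow h hγ.le
    linarith

lemma mr_fr {γ : ℝ} (hγ : 0 < γ) (hγ1 : γ ≤ 1) (ξ : ℝ) :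
    ‖mrho ξ + ξ ^ 2 / 2‖ ≤ 5 * |ξ| ^ (2 + γ) := by
  have e : mrho ξ + ξ ^ 2 / 2 = Complex.exp (Complex.I * ξ) * (mkap (-ξ) + ((-ξ : ℝ) : ℂ) ^ 2 / 2) -
      (Complex.exp (Complex.I * ξ) - 1) * (ξ ^ 2 / 2) := by
    rw [mr_eq]; push_cast; ring
  rw [e]
  refine (norm_sub_le _ _).trans ?_
  rw [norm_mul, norm_mul, norm_eI]
  have h1 := mk_fr hγ hγ1 (-ξ)
  rw [abs_neg] at h1
  have h2 : ‖(ξ : ℂ) ^ 2 / 2‖ = |ξ| ^ 2 / 2 := by simp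
  have h3 := eI_gam hγ hγ1 ξ
  have h4 : |ξ| ^ (2 + γ) = |ξ| ^ 2 * |ξ| ^ γ := by
    rcases eq_or_lt_of_le (abs_nonneg ξ) with h0 | h0
    · rw [← h0, Real.zero_rpow (by linarith)]; norm_num
    · rw [Real.rpow_add h0, Real.rpow_two]
  have h5 : ‖Complex.exp (Complex.I * ξ) - 1‖ * ‖(ξ : ℂ) ^ 2 / 2‖ ≤ 2 * |ξ| ^ γ * (|ξ| ^ 2 / 2) := by
    rw [h2]; gcongr
  nlinarith

lemma mk_pm {θ : ℝ} (hθ : 0 < θ) (hθ1 : θ ≤ 1) (ξ : ℝ) : ‖mkap ξ + mkap (-ξ)‖ ≤ 4 * |ξ| ^ (1 + θ) := by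
  have h1 := mk_bd ξ
  have h2 := mk_bd (-ξ)
  rw [abs_neg] at h2
  have h3 : |ξ| * min |ξ| 1 ≤ |ξ| ^ (1 + θ) := by
    rcases eq_or_lt_of_le (abs_nonneg ξ) with h0 | h0
    · rw [← h0, Real.zero_rpow (by linarith)]; norm_num
    rw [Real.rpow_add h0, Real.rpow_one]
    refine mul_le_mul_of_nonneg_left ?_ h0.le
    rcases le_total |ξ| 1 with h | h
    · rw [min_eq_left h]
      conv_lhs => rw [← Real.rpow_one |ξ|]
      exact Real.rpow_le_rpow_of_exponent_ge h0 h hθ1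
    · rw [min_eq_right h]; exact Real.one_le_rpow h hθ.le
  have := norm_add_le (mkap ξ) (mkap (-ξ))
  linarith

section
variable {X x : ℝ → ℂ}

lemma fc_div (f : ℝ → ℂ) (c : ℂ) (k : ℤ) : fc (fun s => f s / c) k = fc f k / c := by
  simp only [div_eq_inv_mul]
  exact fc_const_mul _ _ _

lemma fc_ell (h : PC X x) (τ : ℝ) (k : ℤ) :
    fc (fun s => ell X s τ) k = (Complex.exp (Complex.I * ((k * τ : ℝ) : ℂ)) - 1) / τ * fc X k := by
  unfold ell
  rw [fc_div, fc_sub (by have := h.contX; fun_prop) h.contX, fc_shift h.per]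
  rw [show Complex.I * ((k * τ : ℝ) : ℂ) = Complex.I * k * τ by push_cast; ring]
  ring

lemma cell (h : PC X x) (τ : ℝ) : Continuous fun s => ell X s τ := by
  have := h.contX
  unfold ell; fun_prop
lemma ckap (h : PC X x) (τ : ℝ) : Continuous fun s => kap X x s τ := by
  have := cell h τ
  have := h.cont
  unfold kap; fun_prop
lemma crho (h : PC X x) (τ : ℝ) : Continuous fun s => rho X x s τ := by
  have := cell h τ
  have := h.cont
  unfold rho; fun_prop

lemma fc_kap (h : PC X x) {τ : ℝ} (h0 : τ ≠ 0) (k : ℤ) :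
    fc (fun s => kap X x s τ) k = mkap (k * τ) / τ ^ 2 * fc X k := by
  have hc : (τ : ℂ) ≠ 0 := by exact_mod_cast h0
  unfold kap
  rw [fc_div, fc_sub (cell h τ) h.cont, fc_ell h, fc_deriv h.per h.der h.cont, mkap]
  push_cast
  field_simp

lemma fc_rho (h : PC X x) {τ : ℝ} (h0 : τ ≠ 0) (k : ℤ) :
    fc (fun s => rho X x s τ) k = mrho (k * τ) / τ ^ 2 * fc X k := by
  have hc : (τ : ℂ) ≠ 0 := by exact_mod_cast h0
  unfold rho
  rw [fc_div, fc_sub (by have := h.cont; fun_prop) (cell h τ), fc_ell h, fc_shift h.perx,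
    fc_deriv h.per h.der h.cont, mrho]
  push_cast
  rw [show Complex.I * (k * τ : ℂ) = Complex.I * k * τ by ring]
  field_simp
  ring

lemma pell (h : PC X x) (τ : ℝ) : Function.Periodic (fun s => ell X s τ) (2 * π) := by
  intro s
  simp only [ell, h.per s, show s + 2 * π + τ = s + τ + 2 * π by ring, h.per (s + τ)]
lemma prho (h : PC X x) (τ : ℝ) : Function.Periodic (fun s => rho X x s τ) (2 * π) := by
  intro s
  have := pell h τ s
  simp only at this
  simp only [rho, this, show s + 2 * π + τ = s + τ + 2 * π by ring, h.perx (s + τ)]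
lemma pkap (h : PC X x) (τ : ℝ) : Function.Periodic (fun s => kap X x s τ) (2 * π) := by
  intro s
  have := pell h τ s
  simp only at this
  simp only [kap, this, h.perx s]

lemma sup_fc {f : ℝ → ℂ} (hp : Function.Periodic f (2 * π)) (hf : Continuous f) (s : ℝ) :
    ‖f s‖ₑ ≤ ENNReal.ofReal (2 * π)⁻¹ * ∑' k, ‖fc f k‖ₑ := by
  have hpi : 0 < (2 * π)⁻¹ := by positivity
  by_cases hS : ∑' k, ‖fc f k‖ₑ = ∞
  · rw [hS, ENNReal.mul_top (by simpa using Real.pi_pos)]; exact le_top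
  have hs : Summable fun k => ‖fc f k‖ := by
    have := ENNReal.summable_toReal hS
    simpa using this
  have h := hasSum_fc hp hf hs s
  have hn : ∀ k : ℤ, ‖(2 * π : ℂ)⁻¹ * fc f k * Complex.exp (Complex.I * k * s)‖ =
      (2 * π)⁻¹ * ‖fc f k‖ := by
    intro k
    rw [norm_mul, norm_mul, show Complex.I * k * s = Complex.I * ((k * s : ℝ) : ℂ) by
      push_cast; ring, norm_eI, mul_one]
    congr 1
    rw [show (2 * π : ℂ)⁻¹ = (((2 * π)⁻¹ : ℝ) : ℂ) by push_cast; ring, Complex.norm_real,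
      Real.norm_of_nonneg hpi.le]
  have h2 : ‖f s‖ ≤ (2 * π)⁻¹ * ∑' k, ‖fc f k‖ := by
    rw [← tsum_mul_left, ← h.tsum_eq]
    refine (norm_tsum_le_tsum_norm ?_).trans_eq (tsum_congr hn)
    simp_rw [hn]; exact hs.mul_left _
  rw [← ofReal_norm]
  refine (ENNReal.ofReal_le_ofReal h2).trans_eq ?_
  rw [ENNReal.ofReal_mul hpi.le, ENNReal.ofReal_tsum_of_nonneg (fun _ => norm_nonneg _) hs]
  simp_rw [ofReal_norm]

/-- squared L2 norm -/
def Q (f : ℝ → ℂ) : ℝ≥0∞ := ∫⁻ s, ‖f s‖ₑ ^ 2 ∂mu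

lemma Q_fc {f : ℝ → ℂ} (hf : Continuous f) :
    Q f = ENNReal.ofReal (2 * π)⁻¹ * ∑' k, ‖fc f k‖ₑ ^ 2 := by
  rw [parsevalE hf, eLpNorm_sq, ← mul_assoc, ← ENNReal.ofReal_mul (by positivity),
    inv_mul_cancel₀ (by positivity), ENNReal.ofReal_one, one_mul, Q]

lemma supF_mul {f X : ℝ → ℂ} (hp : Function.Periodic f (2 * π)) (hf : Continuous f) {m : ℤ → ℂ}
    (hm : ∀ k, fc f k = m k * fc X k) {b : ℤ → ℝ} {c : ℝ} (hc : c ≤ 2 * π)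
    (hb : ∀ k, ‖m k‖ ≤ c * b k) (hb0 : ∀ k, 0 ≤ b k)
    {a : ℤ → ℝ≥0∞} (ha : ∀ k, ‖fc X k‖ₑ ≤ a k) (s : ℝ) :
    ‖f s‖ₑ ≤ ∑' k, a k * ENNReal.ofReal (b k) := by
  refine (sup_fc hp hf s).trans ?_
  rw [← ENNReal.tsum_mul_left]
  refine ENNReal.tsum_le_tsum fun k => ?_
  have h1 : ‖m k‖ₑ ≤ ENNReal.ofReal (2 * π) * ENNReal.ofReal (b k) := by
    rw [← ofReal_norm, ← ENNReal.ofReal_mul (by positivity)]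
    exact ENNReal.ofReal_le_ofReal ((hb k).trans (mul_le_mul_of_nonneg_right hc (hb0 k)))
  calc _ ≤ ENNReal.ofReal (2 * π)⁻¹ * (ENNReal.ofReal (2 * π) * ENNReal.ofReal (b k) * a k) := by
        rw [hm, enorm_mul]; gcongr; exact ha k
    _ = (ENNReal.ofReal (2 * π)⁻¹ * ENNReal.ofReal (2 * π)) * (a k * ENNReal.ofReal (b k)) := by ring
    _ = _ := by
      rw [← ENNReal.ofReal_mul (by positivity), inv_mul_cancel₀ (by positivity),
        ENNReal.ofReal_one, one_mul]

lemma Q_mul {f X : ℝ → ℂ} (hf : Continuous f) {m : ℤ → ℂ}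
    (hm : ∀ k, fc f k = m k * fc X k) {b : ℤ → ℝ} 
    (hb : ∀ k, ‖m k‖ ≤ 2 * b k) :
    Q f ≤ ∑' k, ‖fc X k‖ₑ ^ 2 * ENNReal.ofReal (b k ^ 2) := by
  rw [Q_fc hf, ← ENNReal.tsum_mul_left]
  refine ENNReal.tsum_le_tsum fun k => ?_
  have hb0 : 0 ≤ b k := by linarith [norm_nonneg (m k), hb k]
  have h1 : ‖m k‖ₑ ^ 2 ≤ ENNReal.ofReal (2 * π) * ENNReal.ofReal (b k ^ 2) := by
    rw [← ofReal_norm, ← ENNReal.ofReal_mul (by positivity), ← ENNReal.ofReal_pow (norm_nonneg _)]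
    refine ENNReal.ofReal_le_ofReal ?_
    calc ‖m k‖ ^ 2 ≤ (2 * b k) ^ 2 := by gcongr; exact hb k
      _ = 4 * b k ^ 2 := by ring
      _ ≤ _ := by
        refine mul_le_mul_of_nonneg_right ?_ (sq_nonneg _)
        linarith [Real.two_le_pi]
  calc _ ≤ ENNReal.ofReal (2 * π)⁻¹ * (ENNReal.ofReal (2 * π) * ENNReal.ofReal (b k ^ 2)
          * ‖fc X k‖ₑ ^ 2) := by
        rw [hm, enorm_mul, mul_pow]; gcongr
    _ = (ENNReal.ofReal (2 * π)⁻¹ * ENNReal.ofReal (2 * π)) *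
        (‖fc X k‖ₑ ^ 2 * ENNReal.ofReal (b k ^ 2)) := by ring
    _ = _ := by
      rw [← ENNReal.ofReal_mul (by positivity), inv_mul_cancel₀ (by positivity),
        ENNReal.ofReal_one, one_mul]

def mw (k : ℤ) (τ : ℝ) : ℝ := |(k : ℝ)| * min |(k : ℝ)| (1 / |τ|)

lemma mw_nonneg (k : ℤ) (τ : ℝ) : 0 ≤ mw k τ := by unfold mw; positivity

lemma m_mw {τ : ℝ} (h0 : τ ≠ 0) (k : ℤ) {z : ℂ}
    (hz : ‖z‖ ≤ 2 * |(k * τ : ℝ)| * min |(k * τ : ℝ)| 1) : ‖z / (τ : ℂ) ^ 2‖ ≤ 2 * mw k τ := by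
  have ht : 0 < |τ| := abs_pos.2 h0
  have e : min |(k * τ : ℝ)| 1 = |τ| * min |(k : ℝ)| (1 / |τ|) := by
    have h1 : 1 / |τ| * |τ| = 1 := by field_simp
    have h2 := min_mul_of_nonneg |(k : ℝ)| (1 / |τ|) ht.le
    rw [h1] at h2
    rw [abs_mul, ← h2, mul_comm]
  rw [norm_div, norm_pow, Complex.norm_real, Real.norm_eq_abs, div_le_iff₀ (by positivity)]
  refine hz.trans_eq ?_
  rw [e, abs_mul, mw]
  ring

/-- the sup bound -/
def PP (a : ℤ → ℝ≥0∞) (τ : ℝ) : ℝ≥0∞ := ∑' k, a k * ENNReal.ofReal (mw k τ)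

lemma kap_sup (h : PC X x) {a : ℤ → ℝ≥0∞} (ha : ∀ k, ‖fc X k‖ₑ ≤ a k) {τ : ℝ} (h0 : τ ≠ 0) (s : ℝ) :
    ‖kap X x s τ‖ₑ ≤ PP a τ :=
  supF_mul (f := fun s => kap X x s τ) (pkap h τ) (ckap h τ) (fc_kap h h0) (c := 2)
    (by linarith [Real.two_le_pi]) (fun k => m_mw h0 k (mk_bd _)) (fun k => mw_nonneg k τ) ha s

lemma rho_sup (h : PC X x) {a : ℤ → ℝ≥0∞} (ha : ∀ k, ‖fc X k‖ₑ ≤ a k) {τ : ℝ} (h0 : τ ≠ 0) (s : ℝ) :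
    ‖rho X x s τ‖ₑ ≤ PP a τ :=
  supF_mul (f := fun s => rho X x s τ) (prho h τ) (crho h τ) (fc_rho h h0) (c := 2)
    (by linarith [Real.two_le_pi]) (fun k => m_mw h0 k (mr_bd _)) (fun k => mw_nonneg k τ) ha s

lemma ell_sup (h : PC X x) {a : ℤ → ℝ≥0∞} (ha : ∀ k, ‖fc X k‖ₑ ≤ a k) {τ : ℝ} (h0 : τ ≠ 0) (s : ℝ) :
    ‖ell X s τ‖ₑ ≤ ∑' k, a k * ENNReal.ofReal |(k : ℝ)| := by
  refine supF_mul (f := fun s => ell X s τ) (pell h τ) (cell h τ) (fc_ell h τ) (c := 1)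
    (by linarith [Real.two_le_pi]) (fun k => ?_) (fun k => abs_nonneg _) ha s
  rw [norm_div, Complex.norm_real, Real.norm_eq_abs, div_le_iff₀ (abs_pos.2 h0)]
  refine (eI_sub _).trans_eq ?_
  rw [abs_mul]; ring

lemma kap_Q (h : PC X x) {τ : ℝ} (h0 : τ ≠ 0) :
    Q (fun s => kap X x s τ) ≤ ∑' k, ‖fc X k‖ₑ ^ 2 * ENNReal.ofReal (mw k τ ^ 2) :=
  Q_mul (ckap h τ) (fc_kap h h0) (fun k => m_mw h0 k (mk_bd _))
lemma rho_Q (h : PC X x) {τ : ℝ} (h0 : τ ≠ 0) :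
    Q (fun s => rho X x s τ) ≤ ∑' k, ‖fc X k‖ₑ ^ 2 * ENNReal.ofReal (mw k τ ^ 2) :=
  Q_mul (crho h τ) (fc_rho h h0) (fun k => m_mw h0 k (mr_bd _))
lemma ell_Q (h : PC X x) {τ : ℝ} (h0 : τ ≠ 0) :
    Q (fun s => ell X s τ) ≤ ∑' k, ‖fc X k‖ₑ ^ 2 * ENNReal.ofReal (|(k : ℝ)| ^ 2) := by
  refine Q_mul (cell h τ) (fc_ell h τ) (fun k => ?_)
  rw [norm_div, Complex.norm_real, Real.norm_eq_abs, div_le_iff₀ (abs_pos.2 h0)]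
  refine (eI_sub _).trans ?_
  rw [abs_mul]
  have : 0 ≤ |(k : ℝ)| * |τ| := by positivity
  linarith

/-- the sum rho + kap -/
def sig (X x : ℝ → ℂ) (s τ : ℝ) : ℂ := rho X x s τ + kap X x s τ

lemma csig (h : PC X x) (τ : ℝ) : Continuous fun s => sig X x s τ := (crho h τ).add (ckap h τ)

lemma sig_pm_Q (h : PC X x) {θ : ℝ} (hθ : 0 < θ) (hθ1 : θ ≤ 1) {ε : ℝ} (h0 : 0 < ε) :
    Q (fun s => sig X x s ε - sig X x s (-ε)) ≤
      ∑' k, ‖fc X k‖ₑ ^ 2 * ENNReal.ofReal ((2 * ε ^ θ * |(k : ℝ)| ^ (2 + θ)) ^ 2) := by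
  have hc : (ε : ℂ) ≠ 0 := by exact_mod_cast h0.ne'
  refine Q_mul (m := fun k => Complex.I * k / ε * (mkap (k * ε) + mkap (-(k * ε))))
    ((csig h ε).sub (csig h (-ε))) (fun k => ?_) (fun k => ?_)
  · change fc (fun s => sig X x s ε - sig X x s (-ε)) k = _
    rw [fc_sub (csig h ε) (csig h (-ε))]
    unfold sig
    rw [fc_add (crho h ε) (ckap h ε),
      fc_add (crho h (-ε)) (ckap h (-ε)), fc_rho h h0.ne', fc_kap h h0.ne',
      fc_rho h (neg_ne_zero.2 h0.ne'), fc_kap h (neg_ne_zero.2 h0.ne')]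
    rw [mul_neg]
    unfold mrho mkap
    push_cast
    field_simp
    ring
  · have h1 := mk_pm hθ hθ1 (k * ε)
    rw [norm_mul, norm_div, norm_mul, Complex.norm_I, Complex.norm_real, Real.norm_of_nonneg h0.le,
      one_mul, Complex.norm_intCast]
    rcases eq_or_ne k 0 with rfl | hk
    · simp only [Int.cast_zero, abs_zero, zero_div, zero_mul]; positivity
    have hk0 : 0 < |(k : ℝ)| := abs_pos.2 (by exact_mod_cast hk)
    calc _ ≤ |(k : ℝ)| / ε * (4 * |(k * ε : ℝ)| ^ (1 + θ)) := by gcongr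
      _ = _ := by
        rw [abs_mul, abs_of_pos h0, Real.mul_rpow hk0.le h0.le, Real.rpow_add hk0, Real.rpow_add h0,
          Real.rpow_add hk0, Real.rpow_one, Real.rpow_one, Real.rpow_two]
        field_simp
        ring
end

lemma CS_lint {α : Type*} [MeasurableSpace α] (ν : Measure α) {f g : α → ℝ≥0∞}
    (hf : AEMeasurable f ν) (hg : AEMeasurable g ν) :
    (∫⁻ t, f t * g t ∂ν) ^ 2 ≤ (∫⁻ t, f t ^ 2 ∂ν) * ∫⁻ t, g t ^ 2 ∂ν := by
  have h := ENNReal.lintegral_mul_le_Lp_mul_Lq ν Real.HolderConjugate.two_two hf hg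
  simp only [ENNReal.rpow_two, Pi.mul_apply] at h
  have h2 := pow_le_pow_left₀ (by simp) h 2
  refine h2.trans_eq ?_
  rw [mul_pow, ← ENNReal.rpow_two, ← ENNReal.rpow_two, ← ENNReal.rpow_mul, ← ENNReal.rpow_mul]
  norm_num

lemma CS_tsum (f g : ℤ → ℝ≥0∞) :
    (∑' k, f k * g k) ^ 2 ≤ (∑' k, f k ^ 2) * ∑' k, g k ^ 2 := by
  simpa only [lintegral_count] using CS_lint (Measure.count (α := ℤ)) (f := f) (g := g)
    (measurable_of_countable _).aemeasurable (measurable_of_countable _).aemeasurable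

/-- the Sobolev weight -/
def wt (σ : ℝ) (k : ℤ) : ℝ≥0∞ := ENNReal.ofReal (|(k : ℝ)| ^ σ)

lemma sq_le_E {x : ℝ≥0∞} {y : ℝ} (hy : 0 ≤ y) (h : x ^ 2 ≤ ENNReal.ofReal (y ^ 2)) :
    x ≤ ENNReal.ofReal y := by
  rw [ENNReal.ofReal_pow hy] at h
  exact (ENNReal.pow_le_pow_left_iff (by norm_num)).1 h

lemma sumCS {θ σ : ℝ} (hσ : 0 < σ) (hθ : σ < θ + 3 / 2) : ∃ C : ℝ, 0 < C ∧
    ∀ (a : ℤ → ℝ≥0∞) (N : ℝ), 0 ≤ N → ∑' k, a k ^ 2 * wt (4 + 2 * θ) k ≤ ENNReal.ofReal (N ^ 2) →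
      ∑' k, a k * wt σ k ≤ ENNReal.ofReal (C * N) := by
  have hs : Summable fun k : ℤ => |(k : ℝ)| ^ (-(4 + 2 * θ - 2 * σ)) :=
    Real.summable_abs_int_rpow (by linarith)
  set T := ∑' k : ℤ, |(k : ℝ)| ^ (-(4 + 2 * θ - 2 * σ)) with hT
  have hT0 : 0 ≤ T := tsum_nonneg fun k => by positivity
  refine ⟨√(T + 1), by positivity, fun a N hN h => ?_⟩
  refine sq_le_E (by positivity) ?_
  rw [mul_pow, Real.sq_sqrt (by linarith)]
  have e : ∀ k, a k * wt σ k = (a k * wt (2 + θ) k) * wt (σ - 2 - θ) k := by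
    intro k
    rw [mul_assoc]
    congr 1
    unfold wt
    rw [← ENNReal.ofReal_mul (by positivity)]
    congr 1
    rcases eq_or_ne k 0 with rfl | hk
    · by_cases hh : 2 + θ = 0
      · linarith
      · simp [Real.zero_rpow hσ.ne', Real.zero_rpow hh]
    · have hk0 : 0 < |(k : ℝ)| := abs_pos.2 (by exact_mod_cast hk)
      rw [← Real.rpow_add hk0]; congr 1; ring
  simp_rw [e]
  refine (CS_tsum _ _).trans ?_
  have e1 : ∑' k, (a k * wt (2 + θ) k) ^ 2 = ∑' k, a k ^ 2 * wt (4 + 2 * θ) k := by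
    refine tsum_congr fun k => ?_
    rw [mul_pow]
    congr 1
    unfold wt
    rw [← ENNReal.ofReal_pow (by positivity), ← Real.rpow_natCast, ← Real.rpow_mul (abs_nonneg _)]
    congr 2; push_cast; ring
  have e2 : ∑' k, (wt (σ - 2 - θ) k) ^ 2 = ENNReal.ofReal T := by
    rw [hT, ENNReal.ofReal_tsum_of_nonneg (fun _ => by positivity) hs]
    refine tsum_congr fun k => ?_
    unfold wt
    rw [← ENNReal.ofReal_pow (by positivity), ← Real.rpow_natCast, ← Real.rpow_mul (abs_nonneg _)]
    congr 2; push_cast; ring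
  rw [e1, e2, mul_comm, ENNReal.ofReal_mul (by positivity)]
  gcongr
  linarith

lemma lint_rpow_Ioc {p c : ℝ} (hp : -1 < p) (hc : 0 ≤ c) :
    ∫⁻ x in Set.Ioc 0 c, ENNReal.ofReal (x ^ p) = ENNReal.ofReal (c ^ (p + 1) / (p + 1)) := by
  have hi : IntervalIntegrable (fun x : ℝ => x ^ p) volume 0 c := intervalIntegral.intervalIntegrable_rpow' hp
  rw [← ofReal_integral_eq_lintegral_ofReal]
  · rw [← intervalIntegral.integral_of_le hc, integral_rpow (Or.inl hp), Real.zero_rpow (by linarith)]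
    simp
  · exact (intervalIntegrable_iff_integrableOn_Ioc_of_le hc).1 hi
  · exact (ae_restrict_mem measurableSet_Ioc).mono fun x hx => Real.rpow_nonneg hx.1.le _

lemma lint_rpow_Ioi {p c : ℝ} (hp : p < -1) (hc : 0 < c) :
    ∫⁻ x in Set.Ioi c, ENNReal.ofReal (x ^ p) = ENNReal.ofReal (-c ^ (p + 1) / (p + 1)) := by
  rw [← ofReal_integral_eq_lintegral_ofReal]
  · rw [integral_Ioi_rpow_of_lt hp hc]
  · exact integrableOn_Ioi_rpow_of_lt hp hc
  · exact (ae_restrict_mem measurableSet_Ioi).mono fun x hx => Real.rpow_nonneg (hc.trans hx).le _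

lemma Jint {p q : ℝ} (hp : -1 < p) (hq : p - q < -1) : ∃ C : ℝ, 0 < C ∧ ∀ K : ℝ, 0 < K →
    ∫⁻ x in Set.Ioi (0 : ℝ), ENNReal.ofReal (x ^ p * (min K (1 / x)) ^ q) ≤
      ENNReal.ofReal (C * K ^ (q - p - 1)) := by
  refine ⟨1 / (p + 1) + 1 / (q - p - 1), by
    have : 0 < p + 1 := by linarith
    have : 0 < q - p - 1 := by linarith
    positivity, fun K hK => ?_⟩
  have h1 : 0 < p + 1 := by linarith
  have h2 : 0 < q - p - 1 := by linarith
  have hK' : (0 : ℝ) < 1 / K := by positivity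
  rw [← Set.Ioc_union_Ioi_eq_Ioi hK'.le]
  refine (lintegral_union_le _ _ _).trans ?_
  rw [add_mul, ENNReal.ofReal_add (by positivity) (by positivity)]
  refine add_le_add ?_ ?_
  · calc _ = ∫⁻ x in Set.Ioc 0 (1 / K), ENNReal.ofReal (K ^ q) * ENNReal.ofReal (x ^ p) := by
          refine setLIntegral_congr_fun measurableSet_Ioc fun x hx => ?_
          rw [← ENNReal.ofReal_mul (by positivity), min_eq_left, mul_comm]
          rw [le_div_iff₀ hx.1]
          have := hx.2
          rw [le_div_iff₀ hK] at this
          linarith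
      _ ≤ _ := by
          rw [lintegral_const_mul' _ _ ENNReal.ofReal_ne_top, lint_rpow_Ioc hp hK'.le,
            ← ENNReal.ofReal_mul (by positivity)]
          refine ENNReal.ofReal_le_ofReal (le_of_eq ?_)
          rw [one_div K, Real.inv_rpow hK.le, show q - p - 1 = q - (p + 1) by ring, Real.rpow_sub hK]
          field_simp
  · calc _ = ∫⁻ x in Set.Ioi (1 / K), ENNReal.ofReal (x ^ (p - q)) := by
          refine setLIntegral_congr_fun measurableSet_Ioi fun x hx => ?_
          have hx0 : 0 < x := hK'.trans hx
          rw [min_eq_right, one_div, Real.inv_rpow hx0.le, Real.rpow_sub hx0, div_eq_mul_inv]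
          have : 1 / K < x := hx
          rw [div_lt_iff₀ hK] at this
          rw [div_le_iff₀ hx0]; linarith
      _ ≤ _ := by
          rw [lint_rpow_Ioi hq hK']
          refine ENNReal.ofReal_le_ofReal (le_of_eq ?_)
          rw [one_div K, Real.inv_rpow hK.le, ← Real.rpow_neg hK.le,
            show -(p - q + 1) = q - p - 1 by ring, show p - q + 1 = -(q - p - 1) by ring, neg_div_neg_eq]
          ring

lemma lint_abs (f : ℝ → ℝ≥0∞) :
    ∫⁻ τ, f |τ| = 2 * ∫⁻ τ in Set.Ioi 0, f τ := by
  have h1 : ∫⁻ τ in Set.Ioi 0, f |τ| = ∫⁻ τ in Set.Ioi 0, f τ :=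
    setLIntegral_congr_fun measurableSet_Ioi fun x hx => by simp only [abs_of_pos (show 0 < x from hx)]
  have h2 : ∫⁻ τ in Set.Iio 0, f |τ| = ∫⁻ τ in Set.Ioi 0, f τ := by
    have := (Measure.measurePreserving_neg (volume : Measure ℝ)).setLIntegral_comp_preimage_emb
      (MeasurableEquiv.neg ℝ).measurableEmbedding (fun τ => f |τ|) (Set.Ioi 0)
    rw [h1] at this
    rw [← this]
    simp
  rw [← lintegral_add_compl (μ := volume) (A := Set.Ioi (0 : ℝ)) (fun τ => f |τ|) measurableSet_Ioi, h1, Set.compl_Ioi,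
    setLIntegral_congr Iio_ae_eq_Iic.symm, h2, two_mul]

/-- integral over the whole line of an even weight -/
lemma Jabs {p q : ℝ} (hp : -1 < p) (hq : p - q < -1) (hq0 : q ≠ 0) : ∃ C : ℝ, 0 < C ∧ ∀ k : ℤ,
    ∫⁻ τ : ℝ, ENNReal.ofReal (|τ| ^ p * (min |(k : ℝ)| (1 / |τ|)) ^ q) ≤
      ENNReal.ofReal (C * |(k : ℝ)| ^ (q - p - 1)) := by
  obtain ⟨C, hC, h⟩ := Jint hp hq
  refine ⟨2 * C, by positivity, fun k => ?_⟩
  rcases eq_or_ne k 0 with rfl | hk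
  · have : ∀ τ : ℝ, min |((0 : ℤ) : ℝ)| (1 / |τ|) = 0 := fun τ => by
      rw [min_eq_left] <;> simp
    simp_rw [this]
    simp [Real.zero_rpow hq0]
  have hk0 : 0 < |(k : ℝ)| := abs_pos.2 (by exact_mod_cast hk)
  rw [lint_abs (fun t => ENNReal.ofReal (t ^ p * (min |(k : ℝ)| (1 / t)) ^ q))]
  refine (mul_le_mul_right (h _ hk0) 2).trans_eq ?_
  rw [mul_assoc 2 C, ENNReal.ofReal_mul (p := 2) (by norm_num)]
  simp

lemma tsum_even (f : ℕ → ℝ≥0∞) : ∑' k : ℤ, f k.natAbs ≤ f 0 + 2 * ∑' n : ℕ, f (n + 1) := by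
  have := tsum_of_nat_of_neg_add_one (f := fun k : ℤ => f k.natAbs) ENNReal.summable ENNReal.summable
  rw [this]
  have h1 : ∀ n : ℕ, (-((n : ℤ) + 1)).natAbs = n + 1 := fun n => by omega
  simp only [h1, Int.natAbs_natCast]
  rw [tsum_eq_zero_add' ENNReal.summable, two_mul, add_assoc]

lemma dJ {p : ℝ} (hp : -2 < p) (hp1 : p < -1) : ∃ C : ℝ, 0 < C ∧ ∀ R : ℝ, 0 < R →
    ∑' k : ℤ, ENNReal.ofReal (|(k : ℝ)| ^ p * min |(k : ℝ)| R) ≤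
      ENNReal.ofReal (C * R ^ (p + 2)) := by
  obtain ⟨C, hC, h⟩ := Jint (p := p + 1) (q := 1) (by linarith) (by linarith)
  refine ⟨2 * (2 ^ (-p) * C), by positivity, fun R hR => ?_⟩
  have e0 : ∀ k : ℤ, |(k : ℝ)| = (k.natAbs : ℝ) := fun k => by
    rw [Nat.cast_natAbs]; simp
  simp_rw [e0]
  refine (tsum_even (fun n => ENNReal.ofReal ((n : ℝ) ^ p * min (n : ℝ) R))).trans ?_
  have z : ENNReal.ofReal (((0 : ℕ) : ℝ) ^ p * min ((0 : ℕ) : ℝ) R) = 0 := by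
    simp [hR.le]
  rw [z, zero_add, mul_assoc, ENNReal.ofReal_mul (by norm_num)]
  simp only [ENNReal.ofReal_ofNat]
  refine mul_le_mul_right ?_ 2
  set g : ℝ → ℝ≥0∞ := fun x => ENNReal.ofReal (2 ^ (-p) * R) * ENNReal.ofReal (x ^ (p + 1) * (min (1 / R) (1 / x)) ^ (1 : ℝ)) with hg
  have s1 : ∀ n : ℕ, ENNReal.ofReal (((n + 1 : ℕ) : ℝ) ^ p * min ((n + 1 : ℕ) : ℝ) R) ≤
      ∫⁻ x in Set.Ico ((n + 1 : ℕ) : ℝ) ((n + 1 : ℕ) + 1 : ℝ), g x := by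
    intro n
    have hn : (1 : ℝ) ≤ ((n + 1 : ℕ) : ℝ) := by push_cast; linarith [(Nat.cast_nonneg n : (0 : ℝ) ≤ n)]
    set m := ((n + 1 : ℕ) : ℝ)
    calc _ = ∫⁻ x in Set.Ico m (m + 1), ENNReal.ofReal (m ^ p * min m R) := by
          rw [setLIntegral_const, Real.volume_Ico]; simp
      _ ≤ _ := by
          refine setLIntegral_mono' measurableSet_Ico fun x hx => ?_
          have hx0 : 0 < x := by linarith [hx.1]
          rw [hg]
          simp only
          rw [← ENNReal.ofReal_mul (by positivity)]
          refine ENNReal.ofReal_le_ofReal ?_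
          have e1 : min (1 / R) (1 / x) = min x R / (x * R) := by
            rcases le_total x R with hh | hh
            · rw [min_eq_left hh, min_eq_left (one_div_le_one_div_of_le hx0 hh)]; field_simp
            · rw [min_eq_right hh, min_eq_right (one_div_le_one_div_of_le hR hh)]; field_simp
          rw [Real.rpow_one, e1, Real.rpow_add hx0, Real.rpow_one]
          have e2 : 2 ^ (-p) * R * (x ^ p * x * (min x R / (x * R))) = (x / 2) ^ p * min x R := by
            rw [Real.div_rpow hx0.le (by norm_num), Real.rpow_neg (by norm_num)]
            field_simp
          rw [e2]
          have e3 : m ^ p ≤ (x / 2) ^ p :=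
            Real.rpow_le_rpow_of_nonpos (by positivity) (by linarith [hx.2]) (by linarith)
          have e4 : min m R ≤ min x R := min_le_min_right _ hx.1
          have : 0 ≤ min m R := le_min (by linarith) hR.le
          gcongr
  refine (ENNReal.tsum_le_tsum s1).trans ?_
  rw [← lintegral_iUnion (fun n => measurableSet_Ico)]
  · refine (lintegral_mono_set (t := Set.Ioi 0) ?_).trans ?_
    · refine Set.iUnion_subset fun n x hx => ?_
      have : (0 : ℝ) ≤ n := Nat.cast_nonneg n
      have h2 := hx.1
      push_cast at h2
      exact Set.mem_Ioi.2 (by linarith)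
    · rw [lintegral_const_mul' _ _ ENNReal.ofReal_ne_top]
      refine (mul_le_mul_right (h (1 / R) (by positivity)) _).trans ?_
      rw [← ENNReal.ofReal_mul (by positivity)]
      refine ENNReal.ofReal_le_ofReal (le_of_eq ?_)
      rw [one_div, Real.inv_rpow hR.le, ← Real.rpow_neg hR.le, show -(1 - (p + 1) - 1) = p + 1 by ring,
        show p + 2 = p + 1 + 1 by ring, Real.rpow_add_one hR.ne' (p + 1)]
      ring
  · intro i j hij
    refine Set.disjoint_left.2 fun x hx hy => hij ?_
    have h1 := hx.1; have h2 := hx.2; have h3 := hy.1; have h4 := hy.2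
    have h5 : ((i + 1 : ℕ) : ℝ) < ((j + 1 : ℕ) : ℝ) + 1 := by linarith
    have h6 : ((j + 1 : ℕ) : ℝ) < ((i + 1 : ℕ) : ℝ) + 1 := by linarith
    have h7 : (i + 1 : ℕ) < (j + 1 : ℕ) + 1 := by exact_mod_cast h5
    have h8 : (j + 1 : ℕ) < (i + 1 : ℕ) + 1 := by exact_mod_cast h6
    omega

lemma PP_int {θ : ℝ} (hθ : 0 < θ) (hθ1 : θ < 1 / 2) : ∃ C : ℝ, 0 < C ∧
    ∀ (a : ℤ → ℝ≥0∞) (N : ℝ), 0 ≤ N → ∑' k, a k ^ 2 * wt (4 + 2 * θ) k ≤ ENNReal.ofReal (N ^ 2) →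
      ∫⁻ τ : ℝ, PP a τ ^ 2 * ENNReal.ofReal (|τ| ^ (-(2 * θ))) ≤ ENNReal.ofReal (C * N ^ 2) := by
  obtain ⟨C1, hC1, h1⟩ := dJ (p := -3 / 2 - θ) (by linarith) (by linarith)
  obtain ⟨C2, hC2, h2⟩ := Jabs (p := -θ - 1 / 2) (q := 1) (by linarith) (by linarith) one_ne_zero
  refine ⟨C1 * C2, by positivity, fun a N hN hh => ?_⟩
  have key : ∀ τ : ℝ, τ ≠ 0 → PP a τ ^ 2 * ENNReal.ofReal (|τ| ^ (-(2 * θ))) ≤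
      ENNReal.ofReal C1 * ∑' k, a k ^ 2 * wt (7 / 2 + θ) k *
        ENNReal.ofReal (|τ| ^ (-θ - 1 / 2) * (min |(k : ℝ)| (1 / |τ|)) ^ (1 : ℝ)) := by
    intro τ h0
    have ht : 0 < |τ| := abs_pos.2 h0
    have c := CS_tsum (fun k => ENNReal.ofReal (√(|(k : ℝ)| ^ (-3 / 2 - θ) * min |(k : ℝ)| (1 / |τ|))))
      (fun k => a k * ENNReal.ofReal (√(|(k : ℝ)| ^ (7 / 2 + θ) * min |(k : ℝ)| (1 / |τ|))))
    have e1 : PP a τ = ∑' k : ℤ, ENNReal.ofReal (√(|(k : ℝ)| ^ (-3 / 2 - θ) * min |(k : ℝ)| (1 / |τ|))) *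
        (a k * ENNReal.ofReal (√(|(k : ℝ)| ^ (7 / 2 + θ) * min |(k : ℝ)| (1 / |τ|)))) := by
      unfold PP
      refine tsum_congr fun k => ?_
      rw [mul_left_comm, ← ENNReal.ofReal_mul (by positivity), ← Real.sqrt_mul (by positivity)]
      congr 2
      symm
      rw [Real.sqrt_eq_iff_mul_self_eq (by positivity) (mw_nonneg _ _)]
      unfold mw
      rcases eq_or_ne k 0 with rfl | hk
      · simp
      · have hk0 : 0 < |(k : ℝ)| := abs_pos.2 (by exact_mod_cast hk)
        have : |(k : ℝ)| ^ (7 / 2 + θ) * |(k : ℝ)| ^ (-3 / 2 - θ) = |(k : ℝ)| ^ 2 := by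
          rw [← Real.rpow_add hk0, ← Real.rpow_two]; congr 1; ring
        linear_combination ((min |(k : ℝ)| (1 / |τ|)) ^ 2) * this
    rw [e1]
    refine (mul_le_mul_left c _).trans ?_
    have e2 : ∑' k : ℤ, ENNReal.ofReal (√(|(k : ℝ)| ^ (-3 / 2 - θ) * min |(k : ℝ)| (1 / |τ|))) ^ 2 ≤
        ENNReal.ofReal (C1 * |τ| ^ (θ - 1 / 2)) := by
      refine le_trans (le_of_eq (tsum_congr fun k => ?_)) ((h1 (1 / |τ|) (by positivity)).trans_eq ?_)
      · rw [← ENNReal.ofReal_pow (by positivity), Real.sq_sqrt (by positivity)]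
      · rw [one_div, Real.inv_rpow ht.le, ← Real.rpow_neg ht.le]; congr 3; ring
    have e3 : ∀ k : ℤ, (a k * ENNReal.ofReal (√(|(k : ℝ)| ^ (7 / 2 + θ) * min |(k : ℝ)| (1 / |τ|)))) ^ 2 =
        a k ^ 2 * wt (7 / 2 + θ) k * ENNReal.ofReal (min |(k : ℝ)| (1 / |τ|)) := by
      intro k
      rw [mul_pow, ← ENNReal.ofReal_pow (by positivity), Real.sq_sqrt (by positivity),
        ENNReal.ofReal_mul (by positivity), wt, mul_assoc]
    simp_rw [e3]
    calc _ ≤ ENNReal.ofReal (C1 * |τ| ^ (θ - 1 / 2)) * (∑' k : ℤ, a k ^ 2 * wt (7 / 2 + θ) k *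
            ENNReal.ofReal (min |(k : ℝ)| (1 / |τ|))) * ENNReal.ofReal (|τ| ^ (-(2 * θ))) := by gcongr
      _ = ENNReal.ofReal C1 * (ENNReal.ofReal (|τ| ^ (-θ - 1 / 2)) *
          (∑' k : ℤ, a k ^ 2 * wt (7 / 2 + θ) k * ENNReal.ofReal (min |(k : ℝ)| (1 / |τ|)))) := by
        have : ENNReal.ofReal (|τ| ^ (-θ - 1 / 2)) =
            ENNReal.ofReal (|τ| ^ (θ - 1 / 2)) * ENNReal.ofReal (|τ| ^ (-(2 * θ))) := by
          rw [← ENNReal.ofReal_mul (by positivity), ← Real.rpow_add ht]; congr 2; ring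
        rw [this, ENNReal.ofReal_mul hC1.le]; ring
      _ ≤ _ := by
        rw [← ENNReal.tsum_mul_left]
        refine mul_le_mul_right (ENNReal.tsum_le_tsum fun k => ?_) _
        rw [Real.rpow_one, ENNReal.ofReal_mul (by positivity)]
        exact le_of_eq (by ring)
  calc _ ≤ ∫⁻ τ : ℝ, ENNReal.ofReal C1 * ∑' k, a k ^ 2 * wt (7 / 2 + θ) k *
        ENNReal.ofReal (|τ| ^ (-θ - 1 / 2) * (min |(k : ℝ)| (1 / |τ|)) ^ (1 : ℝ)) := by
        refine lintegral_mono_ae ?_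
        filter_upwards [compl_mem_ae_iff.2 (measure_singleton (μ := (volume : Measure ℝ)) (0 : ℝ))] with τ hτ
        exact key τ hτ
    _ = ENNReal.ofReal C1 * ∑' k : ℤ, a k ^ 2 * wt (7 / 2 + θ) k * ∫⁻ τ : ℝ,
        ENNReal.ofReal (|τ| ^ (-θ - 1 / 2) * (min |(k : ℝ)| (1 / |τ|)) ^ (1 : ℝ)) := by
        rw [lintegral_const_mul' _ _ ENNReal.ofReal_ne_top, lintegral_tsum]
        · congr 1
          refine tsum_congr fun k => ?_
          rw [lintegral_const_mul]
          fun_prop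
        · intro k; fun_prop
    _ ≤ ENNReal.ofReal C1 * ∑' k : ℤ, ENNReal.ofReal C2 * (a k ^ 2 * wt (4 + 2 * θ) k) := by
        refine mul_le_mul_right (ENNReal.tsum_le_tsum fun k => ?_) _
        refine (mul_le_mul_right (h2 k) _).trans_eq ?_
        rw [ENNReal.ofReal_mul hC2.le]
        have : wt (4 + 2 * θ) k = wt (7 / 2 + θ) k * ENNReal.ofReal (|(k : ℝ)| ^ (1 - (-θ - 1 / 2) - 1)) := by
          unfold wt
          rw [← ENNReal.ofReal_mul (by positivity), ← Real.rpow_add_of_nonneg (abs_nonneg _) (by linarith) (by linarith)]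
          congr 2; ring
        rw [this]; ring
    _ ≤ _ := by
        rw [ENNReal.tsum_mul_left, ← mul_assoc, ENNReal.ofReal_mul (by positivity), ENNReal.ofReal_mul hC1.le]
        exact mul_le_mul_right hh _

/-- the base interval in tau -/
abbrev nu : Measure ℝ := volume.restrict (Set.Icc (-π) π)

lemma rpowI {p : ℝ} (hp : -1 < p) : ∃ C : ℝ, 0 < C ∧
    ∫⁻ τ, ENNReal.ofReal (|τ| ^ p) ∂nu ≤ ENNReal.ofReal C := by
  refine ⟨2 * (π ^ (p + 1) / (p + 1)), by
    have : 0 < p + 1 := by linarith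
    positivity, ?_⟩
  rw [← lintegral_indicator measurableSet_Icc]
  have : ∀ τ : ℝ, (Set.Icc (-π) π).indicator (fun τ => ENNReal.ofReal (|τ| ^ p)) τ =
      (fun t => (Set.Iic π).indicator (fun t => ENNReal.ofReal (t ^ p)) t) |τ| := by
    intro τ
    simp only [Set.indicator, Set.mem_Icc, Set.mem_Iic, abs_le]
  simp_rw [this]
  rw [lint_abs (fun t => (Set.Iic π).indicator (fun t => ENNReal.ofReal (t ^ p)) t),
    setLIntegral_indicator measurableSet_Iic, Set.inter_comm, Set.Ioi_inter_Iic,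
    lint_rpow_Ioc hp Real.pi_pos.le, ENNReal.ofReal_mul (p := 2) (by norm_num)]
  simp

/-- weight condition -/
def DW (b e : ℝ) : Prop := ∃ C : ℝ, 0 < C ∧ ∀ k : ℤ,
    ∫⁻ τ, ENNReal.ofReal (|τ| ^ b * mw k τ ^ 2) ∂nu ≤ ENNReal.ofReal C * wt e k

lemma DW_A {θ : ℝ} (hθ : 0 < θ) (hθ1 : θ < 1 / 2) : DW (2 * θ) (3 - 2 * θ) := by
  obtain ⟨C, hC, h⟩ := Jabs (p := 2 * θ) (q := 2) (by linarith) (by linarith) two_ne_zero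
  refine ⟨C, hC, fun k => ?_⟩
  calc _ ≤ ∫⁻ τ : ℝ, ENNReal.ofReal (|τ| ^ (2 * θ) * mw k τ ^ 2) := setLIntegral_le_lintegral _ _
    _ = ENNReal.ofReal (|(k : ℝ)| ^ 2) *
        ∫⁻ τ : ℝ, ENNReal.ofReal (|τ| ^ (2 * θ) * (min |(k : ℝ)| (1 / |τ|)) ^ (2 : ℝ)) := by
        rw [← lintegral_const_mul' _ _ ENNReal.ofReal_ne_top]
        refine lintegral_congr fun τ => ?_
        rw [← ENNReal.ofReal_mul (by positivity), Real.rpow_two, mw]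
        congr 1; ring
    _ ≤ _ := by
        refine (mul_le_mul_right (h k) _).trans_eq ?_
        rw [wt, ← ENNReal.ofReal_mul hC.le, ← ENNReal.ofReal_mul (by positivity), mul_left_comm,
          ← Real.rpow_two, ← Real.rpow_add_of_nonneg (abs_nonneg _) (by norm_num) (by linarith)]
        congr 3; ring

lemma DW_B {γ : ℝ} (hγ : 0 < γ) : DW (1 + γ) 2 := by
  obtain ⟨C, hC, h⟩ := rpowI (p := γ - 1) (by linarith)
  refine ⟨C, hC, fun k => ?_⟩
  calc _ ≤ ∫⁻ τ, wt 2 k * ENNReal.ofReal (|τ| ^ (γ - 1)) ∂nu := by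
        refine lintegral_mono fun τ => ?_
        simp only
        rw [wt, ← ENNReal.ofReal_mul (by positivity)]
        refine ENNReal.ofReal_le_ofReal ?_
        rcases eq_or_ne τ 0 with rfl | h0
        · rw [abs_zero, Real.zero_rpow (by linarith), zero_mul]; positivity
        have ht : 0 < |τ| := abs_pos.2 h0
        have : mw k τ ≤ |(k : ℝ)| * (1 / |τ|) := by
          unfold mw; gcongr; exact min_le_right _ _
        have e : |τ| ^ (1 + γ) = |τ| ^ (γ - 1) * |τ| ^ 2 := by
          rw [← Real.rpow_two, ← Real.rpow_add ht]; congr 1; ring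
        calc _ ≤ |τ| ^ (1 + γ) * (|(k : ℝ)| * (1 / |τ|)) ^ 2 := by
              have := mw_nonneg k τ
              gcongr
          _ = _ := by rw [e, Real.rpow_two]; field_simp
    _ ≤ _ := by
        rw [lintegral_const_mul' _ _ (by unfold wt; exact ENNReal.ofReal_ne_top), mul_comm]
        gcongr

lemma lemL {u : ℝ → ℝ≥0∞} {f : ℝ → ℝ → ℝ≥0∞} (hu : Measurable u)
    (hf : Measurable (Function.uncurry f)) :
    ∫⁻ s, (∫⁻ τ, u τ * f s τ ∂nu) ^ 2 ∂mu ≤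
      (∫⁻ τ, u τ ^ 2 ∂nu) * ∫⁻ τ, ∫⁻ s, f s τ ^ 2 ∂mu ∂nu := by
  rw [lintegral_lintegral_swap (f := fun τ s => f s τ ^ 2)]
  · rw [← lintegral_const_mul'']
    · refine lintegral_mono fun s => ?_
      exact CS_lint nu hu.aemeasurable (hf.comp measurable_prodMk_left).aemeasurable
    · exact (Measurable.lintegral_prod_right' (f := fun p : ℝ × ℝ => f p.1 p.2 ^ 2)
        (by exact hf.pow_const 2)).aemeasurable
  · have : Measurable fun p : ℝ × ℝ => f p.2 p.1 := hf.comp measurable_swap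
    exact (this.pow_const 2).aemeasurable

section
variable {X x : ℝ → ℂ}
lemma meas_ell (h : PC X x) : Measurable fun p : ℝ × ℝ => ell X p.1 p.2 := by
  have := h.contX.measurable
  unfold ell; fun_prop
lemma meas_rho (h : PC X x) : Measurable fun p : ℝ × ℝ => rho X x p.1 p.2 := by
  have := meas_ell h
  have := h.cont.measurable
  unfold rho; fun_prop
lemma meas_kap (h : PC X x) : Measurable fun p : ℝ × ℝ => kap X x p.1 p.2 := by
  have := meas_ell h
  have := h.cont.measurable
  unfold kap; fun_prop

/-- Sobolev energy -/
def En (e : ℝ) (X : ℝ → ℂ) : ℝ≥0∞ := ∑' k, ‖fc X k‖ₑ ^ 2 * wt e k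

lemma ae_ne : ∀ᵐ τ ∂nu, τ ≠ 0 ∧ |τ| ≤ π := by
  filter_upwards [ae_restrict_mem measurableSet_Icc, ae_restrict_of_ae
    (compl_mem_ae_iff.2 (measure_singleton (μ := (volume : Measure ℝ)) (0 : ℝ)))] with τ h1 h2
  exact ⟨h2, abs_le.2 h1⟩

lemma DW_use {b e : ℝ} (hD : DW b e) : ∃ C : ℝ, 0 < C ∧ ∀ (X : ℝ → ℂ) (f : ℝ → ℝ → ℂ),
    (∀ τ, τ ≠ 0 → Q (fun s => f s τ) ≤ ∑' k, ‖fc X k‖ₑ ^ 2 * ENNReal.ofReal (mw k τ ^ 2)) →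
    ∫⁻ τ, ∫⁻ s, (ENNReal.ofReal (|τ| ^ (b / 2)) * ‖f s τ‖ₑ) ^ 2 ∂mu ∂nu ≤ ENNReal.ofReal C * En e X := by
  obtain ⟨C, hC, h⟩ := hD
  refine ⟨C, hC, fun X f hf => ?_⟩
  calc _ ≤ ∫⁻ τ, ∑' k, ‖fc X k‖ₑ ^ 2 * ENNReal.ofReal (|τ| ^ b * mw k τ ^ 2) ∂nu := by
        refine lintegral_mono_ae ?_
        filter_upwards [ae_ne] with τ hτ
        simp_rw [mul_pow]
        rw [lintegral_const_mul' _ _ (by simp)]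
        refine (mul_le_mul_right (hf τ hτ.1) _).trans ?_
        rw [← ENNReal.tsum_mul_left]
        refine ENNReal.tsum_le_tsum fun k => le_of_eq ?_
        rw [← ENNReal.ofReal_pow (by positivity), ENNReal.ofReal_mul (by positivity),
          ← Real.rpow_natCast, ← Real.rpow_mul (abs_nonneg _)]
        rw [show b / 2 * ((2 : ℕ) : ℝ) = b by push_cast; ring]
        ring
    _ = ∑' k, ‖fc X k‖ₑ ^ 2 * ∫⁻ τ, ENNReal.ofReal (|τ| ^ b * mw k τ ^ 2) ∂nu := by
        rw [lintegral_tsum]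
        · refine tsum_congr fun k => ?_
          rw [lintegral_const_mul]
          unfold mw; fun_prop
        · intro k; unfold mw; fun_prop
    _ ≤ ∑' k, ENNReal.ofReal C * (‖fc X k‖ₑ ^ 2 * wt e k) := by
        refine ENNReal.tsum_le_tsum fun k => ?_
        refine (mul_le_mul_right (h k) _).trans_eq (by ring)
    _ = _ := by rw [ENNReal.tsum_mul_left, En]
end

/-- combined amplitudes -/
def aa (X1 X2 : ℝ → ℂ) (k : ℤ) : ℝ≥0∞ := ‖fc X1 k‖ₑ + ‖fc X2 k‖ₑ
/-- real version of the sup bound -/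
def Pr (X1 X2 : ℝ → ℂ) (τ : ℝ) : ℝ := (PP (aa X1 X2) τ).toReal

/-- the working context -/
structure Ctx (θ M : ℝ) (X1 x1 X2 x2 : ℝ → ℂ) : Prop where
  n1 : Nice X1 x1
  n2 : Nice X2 x2
  hM : 1 ≤ M
  fin : ∀ τ, τ ≠ 0 → |τ| ≤ π → PP (aa X1 X2) τ ≠ ∞
  tP : ∀ τ, τ ≠ 0 → |τ| ≤ π → |τ| * Pr X1 X2 τ ≤ M
  wP : ∀ τ, τ ≠ 0 → |τ| ≤ π → Pr X1 X2 τ ≤ M * |τ| ^ ((θ - 1) / 2)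

lemma ofReal_to {x : ℝ≥0∞} {y : ℝ} (hy : 0 ≤ y) (h : x ≤ ENNReal.ofReal y) : x.toReal ≤ y := by
  have := ENNReal.toReal_mono ENNReal.ofReal_ne_top h
  rwa [ENNReal.toReal_ofReal hy] at this

lemma min_interp {A B α : ℝ} (hA : 0 ≤ A) (hB : 0 < B) (hα : 0 < α) (hα1 : α ≤ 1) :
    min A B ≤ A ^ α * B ^ (1 - α) := by
  rcases eq_or_lt_of_le hA with h | hA
  · rw [← h, Real.zero_rpow hα.ne', min_eq_left hB.le, zero_mul]
  have h0 : 0 < min A B := lt_min hA hB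
  calc min A B = (min A B) ^ α * (min A B) ^ (1 - α) := by
        rw [← Real.rpow_add h0]; simp
    _ ≤ _ := by
        have h1 : (min A B) ^ α ≤ A ^ α := Real.rpow_le_rpow h0.le (min_le_left _ _) hα.le
        have h2 : (min A B) ^ (1 - α) ≤ B ^ (1 - α) :=
          Real.rpow_le_rpow h0.le (min_le_right _ _) (by linarith)
        gcongr

lemma PP_le1 (a : ℤ → ℝ≥0∞) {τ : ℝ} (h0 : τ ≠ 0) :
    ENNReal.ofReal |τ| * PP a τ ≤ ∑' k, a k * wt 1 k := by
  have ht : 0 < |τ| := abs_pos.2 h0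
  unfold PP
  rw [← ENNReal.tsum_mul_left]
  refine ENNReal.tsum_le_tsum fun k => ?_
  rw [mul_left_comm, ← ENNReal.ofReal_mul ht.le]
  refine mul_le_mul_right (ENNReal.ofReal_le_ofReal ?_) _
  rw [Real.rpow_one, mw]
  have : |τ| * min |(k : ℝ)| (1 / |τ|) ≤ |τ| * (1 / |τ|) := by gcongr; exact min_le_right _ _
  have e : |τ| * (1 / |τ|) = 1 := by field_simp
  nlinarith [abs_nonneg (k : ℝ)]

lemma PP_le2 (a : ℤ → ℝ≥0∞) {θ : ℝ} (hθ : 0 < θ) (hθ1 : θ < 1) {τ : ℝ} (h0 : τ ≠ 0) :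
    PP a τ ≤ ENNReal.ofReal (|τ| ^ ((θ - 1) / 2)) * ∑' k, a k * wt (3 / 2 + θ / 2) k := by
  have ht : 0 < |τ| := abs_pos.2 h0
  unfold PP
  rw [← ENNReal.tsum_mul_left]
  refine ENNReal.tsum_le_tsum fun k => ?_
  rw [mul_left_comm, wt, ← ENNReal.ofReal_mul (by positivity)]
  refine mul_le_mul_right (ENNReal.ofReal_le_ofReal ?_) _
  have h := min_interp (A := |(k : ℝ)|) (B := 1 / |τ|) (α := (1 + θ) / 2) (abs_nonneg _) (by positivity)
    (by linarith) (by linarith)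
  have e : (1 / |τ|) ^ (1 - (1 + θ) / 2) = |τ| ^ ((θ - 1) / 2) := by
    rw [one_div, Real.inv_rpow ht.le, ← Real.rpow_neg ht.le]; congr 1; ring
  have e2 : |(k : ℝ)| ^ (3 / 2 + θ / 2) = |(k : ℝ)| * |(k : ℝ)| ^ ((1 + θ) / 2) := by
    rw [show 3 / 2 + θ / 2 = 1 + (1 + θ) / 2 by ring,
      Real.rpow_add_of_nonneg (abs_nonneg _) (by norm_num) (by linarith), Real.rpow_one]
  rw [e] at h
  rw [e2, mw]
  calc _ ≤ |(k : ℝ)| * (|(k : ℝ)| ^ ((1 + θ) / 2) * |τ| ^ ((θ - 1) / 2)) := by gcongr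
    _ = _ := by ring

lemma PP_le3 (a : ℤ → ℝ≥0∞) (τ : ℝ) : PP a τ ≤ ∑' k, a k * wt 2 k := by
  unfold PP
  refine ENNReal.tsum_le_tsum fun k => ?_
  refine mul_le_mul_right (ENNReal.ofReal_le_ofReal ?_) _
  rw [Real.rpow_two, mw, sq]
  gcongr; exact min_le_left _ _

lemma base {θ : ℝ} (hθ : 0 < θ) (hθ1 : θ < 1) : ∃ K : ℝ, 0 < K ∧ ∀ (X1 x1 X2 x2 : ℝ → ℂ) (N : ℝ),
    Nice X1 x1 → Nice X2 x2 → 0 ≤ N →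
    ∑' k, aa X1 X2 k ^ 2 * wt (4 + 2 * θ) k ≤ ENNReal.ofReal (N ^ 2) → 
    ∀ M, K * N ≤ M → Ctx θ M X1 x1 X2 x2 := by
  obtain ⟨C1, hC1, h1⟩ := sumCS (θ := θ) (σ := 1) one_pos (by linarith)
  obtain ⟨C2, hC2, h2⟩ := sumCS (θ := θ) (σ := 3 / 2 + θ / 2) (by linarith) (by linarith)
  refine ⟨C1 + C2, by positivity, fun X1 x1 X2 x2 N n1 n2 hN hs M hM => ?_⟩
  have s1 := h1 _ N hN hs
  have s2 := h2 _ N hN hs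
  have b1 : C1 * N ≤ M := le_trans (by nlinarith) hM
  have b2 : C2 * N ≤ M := le_trans (by nlinarith) hM
  have hM0 : 0 ≤ M := le_trans (by positivity) b1
  have w1 : ∀ τ, τ ≠ 0 → PP (aa X1 X2) τ ≤ ENNReal.ofReal (M * |τ| ^ ((θ - 1) / 2)) := by
    intro τ h0
    refine (PP_le2 _ hθ hθ1 h0).trans ?_
    rw [mul_comm, ENNReal.ofReal_mul hM0]
    gcongr
    exact s2.trans (ENNReal.ofReal_le_ofReal b2)
  have w2 : ∀ τ, τ ≠ 0 → PP (aa X1 X2) τ ≠ ∞ := fun τ h0 =>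
    ((w1 τ h0).trans_lt ENNReal.ofReal_lt_top).ne
  refine ⟨n1, n2, ?_, fun τ h0 _ => w2 τ h0, fun τ h0 _ => ?_, fun τ h0 _ =>
    ofReal_to (by positivity) (w1 τ h0)⟩
  · have e1 := n1.one_le (s := 0) (τ := 1) one_ne_zero (by rw [abs_one]; linarith [Real.two_le_pi])
    have e2 := ell_sup n1.pc (a := aa X1 X2) (fun k => le_self_add) (τ := 1) one_ne_zero 0
    have e3 : ‖ell X1 0 1‖ₑ ≤ ENNReal.ofReal M := by
      refine e2.trans (le_trans (le_of_eq (tsum_congr fun k => ?_)) (s1.trans (ENNReal.ofReal_le_ofReal b1)))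
      rw [wt, Real.rpow_one]
    have := ofReal_to hM0 e3
    rw [toReal_enorm] at this
    linarith
  · have := ofReal_to hM0 ((PP_le1 (aa X1 X2) h0).trans (s1.trans (ENNReal.ofReal_le_ofReal b1)))
    rwa [ENNReal.toReal_mul, ENNReal.toReal_ofReal (abs_nonneg _)] at this

lemma enorm_to {x : ℂ} {y : ℝ≥0∞} (hy : y ≠ ∞) (h : ‖x‖ₑ ≤ y) : ‖x‖ ≤ y.toReal := by
  have := ENNReal.toReal_mono hy h
  rwa [toReal_enorm] at this

section
variable {θ M : ℝ} {X1 x1 X2 x2 : ℝ → ℂ}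

lemma Ctx.r1 (c : Ctx θ M X1 x1 X2 x2) {s τ : ℝ} (h0 : τ ≠ 0) (hτ : |τ| ≤ π) :
    ‖rho X1 x1 s τ‖ ≤ Pr X1 X2 τ :=
  enorm_to (c.fin τ h0 hτ) (rho_sup c.n1.pc (fun _ => le_self_add) h0 s)
lemma Ctx.k1 (c : Ctx θ M X1 x1 X2 x2) {s τ : ℝ} (h0 : τ ≠ 0) (hτ : |τ| ≤ π) :
    ‖kap X1 x1 s τ‖ ≤ Pr X1 X2 τ :=
  enorm_to (c.fin τ h0 hτ) (kap_sup c.n1.pc (fun _ => le_self_add) h0 s)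
lemma Ctx.r2 (c : Ctx θ M X1 x1 X2 x2) {s τ : ℝ} (h0 : τ ≠ 0) (hτ : |τ| ≤ π) :
    ‖rho X2 x2 s τ‖ ≤ Pr X1 X2 τ :=
  enorm_to (c.fin τ h0 hτ) (rho_sup c.n2.pc (fun _ => le_add_self) h0 s)
lemma Ctx.k2 (c : Ctx θ M X1 x1 X2 x2) {s τ : ℝ} (h0 : τ ≠ 0) (hτ : |τ| ≤ π) :
    ‖kap X2 x2 s τ‖ ≤ Pr X1 X2 τ :=
  enorm_to (c.fin τ h0 hτ) (kap_sup c.n2.pc (fun _ => le_add_self) h0 s)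

lemma ell_sub (s τ : ℝ) : ell X1 s τ - ell X2 s τ = ell (fun s => X1 s - X2 s) s τ := by
  unfold ell; ring
lemma rho_sub (s τ : ℝ) : rho X1 x1 s τ - rho X2 x2 s τ =
    rho (fun s => X1 s - X2 s) (fun s => x1 s - x2 s) s τ := by
  unfold rho; rw [← ell_sub]; ring
lemma kap_sub (s τ : ℝ) : kap X1 x1 s τ - kap X2 x2 s τ =
    kap (fun s => X1 s - X2 s) (fun s => x1 s - x2 s) s τ := by
  unfold kap; rw [← ell_sub]; ring

lemma Ctx.dpc (c : Ctx θ M X1 x1 X2 x2) :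
    PC (fun s => X1 s - X2 s) (fun s => x1 s - x2 s) := c.n1.pc.sub c.n2.pc

/-- symmetric truncated integral -/
def II (ε : ℝ) (H : ℝ → ℝ → ℂ) (s : ℝ) : ℂ := (∫ t in ε..π, H s t) + ∫ t in (-π)..(-ε), H s t

lemma II_enorm {ε : ℝ} (h0 : 0 < ε) (hε : ε ≤ π) (H : ℝ → ℝ → ℂ) (s : ℝ) :
    ‖II ε H s‖ₑ ≤ ∫⁻ t, ‖H s t‖ₑ ∂nu := by
  unfold II
  rw [intervalIntegral.integral_of_le hε, intervalIntegral.integral_of_le (by linarith)]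
  refine (enorm_add_le _ _).trans ((add_le_add (enorm_integral_le_lintegral_enorm _)
    (enorm_integral_le_lintegral_enorm _)).trans ?_)
  rw [← lintegral_union measurableSet_Ioc]
  · refine lintegral_mono_set (Set.union_subset ?_ ?_)
    · exact fun t ht => ⟨by linarith [ht.1, Real.pi_pos], ht.2⟩
    · exact fun t ht => ⟨ht.1.le, by linarith [ht.2, Real.pi_pos]⟩
  · exact Set.disjoint_left.2 fun t ht ht' => by linarith [ht.1, ht'.2]

lemma sub1' {ε : ℝ} (h0 : 0 < ε) : ∀ t ∈ Set.Icc ε π, t ≠ 0 ∧ |t| ≤ π := fun t ht =>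
  ⟨(h0.trans_le ht.1).ne', abs_le.2 ⟨by linarith [ht.1, Real.pi_pos], ht.2⟩⟩
lemma sub2 {ε : ℝ} (h0 : 0 < ε) : ∀ t ∈ Set.Icc (-π) (-ε), t ≠ 0 ∧ |t| ≤ π := fun t ht =>
  ⟨(show t < 0 by linarith [ht.2]).ne, abs_le.2 ⟨ht.1, by linarith [ht.2, Real.pi_pos]⟩⟩

lemma II_cont {ε : ℝ} (h0 : 0 < ε) (hε : ε ≤ π) {H : ℝ → ℝ → ℂ}
    (hH : ContinuousOn (Function.uncurry H) reg) : Continuous (II ε H) :=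
  (cont_param hε (hH.mono (reg_sub (sub1' h0)))).add
    (cont_param (by linarith) (hH.mono (reg_sub (sub2 h0))))

lemma II_intble {ε : ℝ} (h0 : 0 < ε) (hε : ε ≤ π) {H : ℝ → ℝ → ℂ}
    (hH : ContinuousOn (Function.uncurry H) reg) (s : ℝ) :
    IntervalIntegrable (H s) volume ε π ∧ IntervalIntegrable (H s) volume (-π) (-ε) := by
  have := slice_cont hH s
  refine ⟨ContinuousOn.intervalIntegrable ?_, ContinuousOn.intervalIntegrable ?_⟩
  · rw [Set.uIcc_of_le hε]; exact this.mono (sub1' h0)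
  · rw [Set.uIcc_of_le (by linarith)]; exact this.mono (sub2 h0)

lemma II_sub {ε : ℝ} (h0 : 0 < ε) (hε : ε ≤ π) {H G : ℝ → ℝ → ℂ}
    (hH : ContinuousOn (Function.uncurry H) reg) (hG : ContinuousOn (Function.uncurry G) reg) (s : ℝ) :
    II ε (fun s t => H s t - G s t) s = II ε H s - II ε G s := by
  obtain ⟨a, b⟩ := II_intble h0 hε hH s
  obtain ⟨a', b'⟩ := II_intble h0 hε hG s
  unfold II
  rw [intervalIntegral.integral_sub a a', intervalIntegral.integral_sub b b']
  ring

lemma En_mono {e e' : ℝ} (he : 0 < e) (h : e ≤ e') (X : ℝ → ℂ) : En e X ≤ En e' X := by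
  unfold En
  refine ENNReal.tsum_le_tsum fun k => mul_le_mul_right ?_ _
  unfold wt
  refine ENNReal.ofReal_le_ofReal ?_
  rcases eq_or_ne k 0 with rfl | hk
  · rw [Int.cast_zero, abs_zero, Real.zero_rpow he.ne', Real.zero_rpow (by linarith)]
  · refine Real.rpow_le_rpow_of_exponent_le ?_ h
    exact_mod_cast Int.one_le_abs hk

lemma ell_Q' {X x : ℝ → ℂ} (h : PC X x) {τ : ℝ} (h0 : τ ≠ 0) :
    Q (fun s => ell X s τ) ≤ En 2 X := by
  refine (ell_Q h h0).trans_eq ?_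
  unfold En wt
  simp_rw [Real.rpow_two]

lemma ell_L {p : ℝ} (hp : -1 < p) : ∃ C : ℝ, 0 < C ∧ ∀ (X x : ℝ → ℂ), PC X x →
    ∫⁻ s, (∫⁻ τ, ENNReal.ofReal (|τ| ^ p) * ‖ell X s τ‖ₑ ∂nu) ^ 2 ∂mu ≤
      ENNReal.ofReal C * En 2 X := by
  obtain ⟨C, hC, h⟩ := rpowI hp
  refine ⟨C * C, by positivity, fun X x hX => ?_⟩
  have e : ∀ τ : ℝ, τ ≠ 0 → ENNReal.ofReal (|τ| ^ p) = ENNReal.ofReal (|τ| ^ (p / 2)) ^ 2 := by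
    intro τ h0
    rw [← ENNReal.ofReal_pow (by positivity), ← Real.rpow_natCast, ← Real.rpow_mul (abs_nonneg _)]
    congr 2; push_cast; ring
  have l := lemL (u := fun τ => ENNReal.ofReal (|τ| ^ (p / 2)))
    (f := fun s τ => ENNReal.ofReal (|τ| ^ (p / 2)) * ‖ell X s τ‖ₑ) (by fun_prop)
    (by
      have := (meas_ell hX).enorm
      have h2 : Measurable fun q : ℝ × ℝ => ENNReal.ofReal (|q.2| ^ (p / 2)) := by fun_prop
      exact h2.mul this)
  have e1 : ∀ s, ∫⁻ τ, ENNReal.ofReal (|τ| ^ p) * ‖ell X s τ‖ₑ ∂nu = ∫⁻ τ, ENNReal.ofReal (|τ| ^ (p / 2)) *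
      (ENNReal.ofReal (|τ| ^ (p / 2)) * ‖ell X s τ‖ₑ) ∂nu := fun s => by
    refine lintegral_congr_ae ?_
    filter_upwards [ae_ne] with τ hτ
    rw [e τ hτ.1]; ring
  simp_rw [e1]
  refine l.trans ?_
  have e2 : ∫⁻ τ, ENNReal.ofReal (|τ| ^ (p / 2)) ^ 2 ∂nu ≤ ENNReal.ofReal C := by
    refine le_trans (le_of_eq (lintegral_congr_ae ?_)) h
    filter_upwards [ae_ne] with τ hτ
    rw [e τ hτ.1]
  have e3 : ∫⁻ τ, ∫⁻ s, (ENNReal.ofReal (|τ| ^ (p / 2)) * ‖ell X s τ‖ₑ) ^ 2 ∂mu ∂nu ≤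
      ENNReal.ofReal C * En 2 X := by
    calc _ ≤ ∫⁻ τ, ENNReal.ofReal (|τ| ^ p) * En 2 X ∂nu := by
          refine lintegral_mono_ae ?_
          filter_upwards [ae_ne] with τ hτ
          simp_rw [mul_pow]
          rw [lintegral_const_mul' _ _ (by simp), ← e τ hτ.1]
          exact mul_le_mul_right (ell_Q' hX hτ.1) _
      _ = (∫⁻ τ, ENNReal.ofReal (|τ| ^ p) ∂nu) * En 2 X := by
          rw [lintegral_mul_const]; fun_prop
      _ ≤ _ := by gcongr
  calc _ ≤ ENNReal.ofReal C * (ENNReal.ofReal C * En 2 X) := mul_le_mul' e2 e3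
    _ = _ := by rw [ENNReal.ofReal_mul hC.le]; ring

lemma DW_L {b e : ℝ} (hD : DW b e) : ∃ C : ℝ, 0 < C ∧ ∀ (X : ℝ → ℂ) (f : ℝ → ℝ → ℂ) (u : ℝ → ℝ≥0∞),
    (∀ τ, τ ≠ 0 → Q (fun s => f s τ) ≤ ∑' k, ‖fc X k‖ₑ ^ 2 * ENNReal.ofReal (mw k τ ^ 2)) →
    Measurable (Function.uncurry f) → Measurable u →
    ∫⁻ s, (∫⁻ τ, u τ * ‖f s τ‖ₑ ∂nu) ^ 2 ∂mu ≤
      (∫⁻ τ, u τ ^ 2 * ENNReal.ofReal (|τ| ^ (-b)) ∂nu) * (ENNReal.ofReal C * En e X) := by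
  obtain ⟨C, hC, h⟩ := DW_use hD
  refine ⟨C, hC, fun X f u hQ hf hu => ?_⟩
  have l := lemL (u := fun τ => u τ * ENNReal.ofReal (|τ| ^ (-b / 2)))
    (f := fun s τ => ENNReal.ofReal (|τ| ^ (b / 2)) * ‖f s τ‖ₑ) (by fun_prop)
    (by
      have h2 : Measurable fun q : ℝ × ℝ => ENNReal.ofReal (|q.2| ^ (b / 2)) := by fun_prop
      exact h2.mul hf.enorm)
  have e1 : ∀ s, ∫⁻ τ, u τ * ‖f s τ‖ₑ ∂nu = ∫⁻ τ, u τ * ENNReal.ofReal (|τ| ^ (-b / 2)) *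
      (ENNReal.ofReal (|τ| ^ (b / 2)) * ‖f s τ‖ₑ) ∂nu := fun s => by
    refine lintegral_congr_ae ?_
    filter_upwards [ae_ne] with τ hτ
    have ht : 0 < |τ| := abs_pos.2 hτ.1
    have : ENNReal.ofReal (|τ| ^ (-b / 2)) * ENNReal.ofReal (|τ| ^ (b / 2)) = 1 := by
      rw [← ENNReal.ofReal_mul (by positivity), ← Real.rpow_add ht, show -b / 2 + b / 2 = 0 by ring]
      simp
    calc _ = (ENNReal.ofReal (|τ| ^ (-b / 2)) * ENNReal.ofReal (|τ| ^ (b / 2))) * (u τ * ‖f s τ‖ₑ) := by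
          rw [this, one_mul]
      _ = _ := by ring
  simp_rw [e1]
  refine l.trans (mul_le_mul' (le_of_eq (lintegral_congr fun τ => ?_)) (h X f hQ))
  rw [mul_pow, ← ENNReal.ofReal_pow (by positivity), ← Real.rpow_natCast, ← Real.rpow_mul (abs_nonneg _)]
  congr 3; push_cast; ring

lemma sq3 (a b c : ℝ≥0∞) : (a + b + c) ^ 2 ≤ 3 * (a ^ 2 + b ^ 2 + c ^ 2) := by
  by_cases ha : a = ∞
  · simp [ha]
  by_cases hb : b = ∞
  · simp [hb]
  by_cases hc : c = ∞
  · simp [hc]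
  lift a to NNReal using ha
  lift b to NNReal using hb
  lift c to NNReal using hc
  norm_cast
  rw [← NNReal.coe_le_coe]
  push_cast
  nlinarith [sq_nonneg ((a : ℝ) - b), sq_nonneg ((b : ℝ) - c), sq_nonneg ((a : ℝ) - c)]
end

lemma PP_meas (a : ℤ → ℝ≥0∞) : Measurable (PP a) := by
  unfold PP
  refine Measurable.tsum fun k => ?_
  unfold mw; fun_prop

lemma ofRealNorm (z : ℂ) : ENNReal.ofReal ‖z‖ = ‖z‖ₑ := ofReal_norm z

lemma Q_le3 {f : ℝ → ℂ} {c1 c2 c3 : ℝ≥0∞} {A B C : ℝ → ℝ≥0∞} (hA : Measurable A) (hB : Measurable B)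
    (hc1 : c1 ≠ ∞) (hc2 : c2 ≠ ∞) (hc3 : c3 ≠ ∞)
    (h : ∀ s, ‖f s‖ₑ ≤ c1 * A s + c2 * B s + c3 * C s) :
    Q f ≤ 3 * (c1 ^ 2 * ∫⁻ s, A s ^ 2 ∂mu) + 3 * (c2 ^ 2 * ∫⁻ s, B s ^ 2 ∂mu) +
      3 * (c3 ^ 2 * ∫⁻ s, C s ^ 2 ∂mu) := by
  unfold Q
  calc _ ≤ ∫⁻ s, (3 * (c1 ^ 2 * A s ^ 2) + 3 * (c2 ^ 2 * B s ^ 2)) + 3 * (c3 ^ 2 * C s ^ 2) ∂mu := by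
        refine lintegral_mono fun s => ?_
        refine (pow_le_pow_left₀ (by simp) (h s) 2).trans ((sq3 _ _ _).trans_eq ?_)
        ring
    _ = _ := by
        rw [lintegral_add_left, lintegral_add_left]
        · congr 1
          · congr 1
            · rw [lintegral_const_mul' _ _ (by simp), lintegral_const_mul' _ _ (by simp [hc1])]
            · rw [lintegral_const_mul' _ _ (by simp), lintegral_const_mul' _ _ (by simp [hc2])]
          · rw [lintegral_const_mul' _ _ (by simp), lintegral_const_mul' _ _ (by simp [hc3])]
        · fun_prop
        · fun_prop

lemma meas_in {f : ℝ → ℝ → ℂ} {u : ℝ → ℝ≥0∞} (hf : Measurable (Function.uncurry f)) (hu : Measurable u) :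
    Measurable fun s => ∫⁻ τ, u τ * ‖f s τ‖ₑ ∂nu := by
  refine Measurable.lintegral_prod_right' (f := fun p : ℝ × ℝ => u p.2 * ‖f p.1 p.2‖ₑ) ?_
  exact (hu.comp measurable_snd).mul hf.enorm

/-- main term, first case -/
lemma T1A {θ : ℝ} (hθ : 0 < θ) (hθ1 : θ < 1 / 2) : ∃ C : ℝ, 0 < C ∧
    ∀ (X1 x1 X2 x2 : ℝ → ℂ) (M N : ℝ), Ctx θ M X1 x1 X2 x2 → 0 ≤ N → N ≤ M →
    ∑' k, aa X1 X2 k ^ 2 * wt (4 + 2 * θ) k ≤ ENNReal.ofReal (N ^ 2) → ∀ ε, 0 < ε → ε ≤ π →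
    Q (II ε fun s t => rr X1 x1 s t - rr X2 x2 s t) ≤
      ENNReal.ofReal (C * M ^ 6) * En (3 - 2 * θ) (fun s => X1 s - X2 s) := by
  obtain ⟨Cp, hCp, hp⟩ := PP_int hθ hθ1
  obtain ⟨Cd, hCd, hd⟩ := DW_L (DW_A hθ hθ1)
  obtain ⟨Ce, hCe, he⟩ := ell_L (p := θ - 1) (by linarith)
  refine ⟨3 * (400 * (Cp * Cd)) + 3 * (400 * (Cp * Cd)) + 3 * (1600 * Ce), by positivity,
    fun X1 x1 X2 x2 M N c hN hNM hs ε h0 hε => ?_⟩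
  have hM := c.hM
  have hM0 : 0 ≤ M := by linarith
  set a := aa X1 X2 with ha
  set D := fun s => X1 s - X2 s with hD
  set d := fun s => x1 s - x2 s with hd'
  have pc : PC D d := c.dpc
  have pw : ∀ s τ, τ ≠ 0 ∧ |τ| ≤ π → ‖rr X1 x1 s τ - rr X2 x2 s τ‖ₑ ≤
      ENNReal.ofReal (20 * M) * (PP a τ * ‖rho D d s τ‖ₑ) +
      ENNReal.ofReal (20 * M) * (PP a τ * ‖kap D d s τ‖ₑ) +
      ENNReal.ofReal (40 * M ^ 3) * (ENNReal.ofReal (|τ| ^ (θ - 1)) * ‖ell D s τ‖ₑ) := by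
    intro s τ ⟨t0, tp⟩
    have b := rc_bd (c.n1.one_le (s := s) t0 tp) (c.n2.one_le (s := s) t0 tp) (c.r1 (s := s) t0 tp)
      (c.r2 (s := s) t0 tp) (c.k1 (s := s) t0 tp) (c.k2 (s := s) t0 tp) hM (c.tP τ t0 tp)
    have hP : 0 ≤ Pr X1 X2 τ := ENNReal.toReal_nonneg
    have hP2 : Pr X1 X2 τ ^ 2 ≤ M ^ 2 * |τ| ^ (θ - 1) := by
      calc _ ≤ (M * |τ| ^ ((θ - 1) / 2)) ^ 2 := by
            have := c.wP τ t0 tp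
            gcongr
        _ = _ := by
            rw [mul_pow]; congr 1
            rw [← Real.rpow_natCast, ← Real.rpow_mul (abs_nonneg _)]; congr 1; push_cast; ring
    rw [ell_sub, rho_sub, kap_sub] at b
    have e : ENNReal.ofReal (Pr X1 X2 τ) = PP a τ := ENNReal.ofReal_toReal (c.fin τ t0 tp)
    rw [← ofRealNorm, ← ofRealNorm, ← ofRealNorm, ← ofRealNorm, ← e,
      ← ENNReal.ofReal_mul (by positivity), ← ENNReal.ofReal_mul (by positivity),
      ← ENNReal.ofReal_mul (by positivity), ← ENNReal.ofReal_mul (by positivity),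
      ← ENNReal.ofReal_mul (by positivity), ← ENNReal.ofReal_mul (by positivity),
      ← ENNReal.ofReal_add (by positivity) (by positivity),
      ← ENNReal.ofReal_add (by positivity) (by positivity)]
    refine ENNReal.ofReal_le_ofReal (b.trans ?_)
    have : 20 * M * (2 * Pr X1 X2 τ ^ 2 * ‖ell D s τ‖) ≤
        20 * M * (2 * (M ^ 2 * |τ| ^ (θ - 1)) * ‖ell D s τ‖) := by gcongr
    linarith
  have m1 := meas_in (f := rho D d) (meas_rho pc) (PP_meas a)
  have m2 := meas_in (f := kap D d) (meas_kap pc) (PP_meas a)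
  have q := Q_le3 (f := II ε fun s t => rr X1 x1 s t - rr X2 x2 s t) (c1 := ENNReal.ofReal (20 * M))
    (c2 := ENNReal.ofReal (20 * M)) (c3 := ENNReal.ofReal (40 * M ^ 3))
    (C := fun s => ∫⁻ τ, ENNReal.ofReal (|τ| ^ (θ - 1)) * ‖ell D s τ‖ₑ ∂nu) m1 m2
    ENNReal.ofReal_ne_top ENNReal.ofReal_ne_top ENNReal.ofReal_ne_top (by
      intro s
      refine (II_enorm h0 hε _ s).trans ?_
      have n1 : Measurable fun τ => PP a τ * ‖rho D d s τ‖ₑ :=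
        (PP_meas a).mul ((meas_rho pc).comp measurable_prodMk_left).enorm
      have n2 : Measurable fun τ => PP a τ * ‖kap D d s τ‖ₑ :=
        (PP_meas a).mul ((meas_kap pc).comp measurable_prodMk_left).enorm
      have n12 : Measurable fun τ => ENNReal.ofReal (20 * M) * (PP a τ * ‖rho D d s τ‖ₑ) +
          ENNReal.ofReal (20 * M) * (PP a τ * ‖kap D d s τ‖ₑ) := (n1.const_mul _).add (n2.const_mul _)
      rw [← lintegral_const_mul' _ _ ENNReal.ofReal_ne_top, ← lintegral_const_mul' _ _ ENNReal.ofReal_ne_top,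
        ← lintegral_const_mul' _ _ ENNReal.ofReal_ne_top, ← lintegral_add_left (n1.const_mul _),
        ← lintegral_add_left n12]
      refine lintegral_mono_ae ?_
      filter_upwards [ae_ne] with τ hτ
      exact pw s τ hτ)
  have hPP : ∫⁻ τ, PP a τ ^ 2 * ENNReal.ofReal (|τ| ^ (-(2 * θ))) ∂nu ≤ ENNReal.ofReal (Cp * M ^ 2) := by
    refine (setLIntegral_le_lintegral _ _).trans ((hp a N hN hs).trans (ENNReal.ofReal_le_ofReal ?_))
    gcongr
  have a1 := hd D (rho D d) (PP a) (fun τ ht => rho_Q pc ht) (meas_rho pc) (PP_meas a)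
  have a2 := hd D (kap D d) (PP a) (fun τ ht => kap_Q pc ht) (meas_kap pc) (PP_meas a)
  have a3 := (he D d pc).trans (mul_le_mul_right (En_mono two_pos (show 2 ≤ 3 - 2 * θ by linarith) D) _)
  set E := En (3 - 2 * θ) D
  have a1' := a1.trans (mul_le_mul_left hPP _)
  have a2' := a2.trans (mul_le_mul_left hPP _)
  have hM4 : M ^ 4 ≤ M ^ 6 := pow_le_pow_right₀ hM (by norm_num)
  have k1 : ENNReal.ofReal (20 * M) ^ 2 * (ENNReal.ofReal (Cp * M ^ 2) * (ENNReal.ofReal Cd * E)) ≤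
      ENNReal.ofReal (400 * (Cp * Cd) * M ^ 6) * E := by
    rw [← ENNReal.ofReal_pow (by positivity), ← mul_assoc, ← mul_assoc, ← ENNReal.ofReal_mul (by positivity),
      ← ENNReal.ofReal_mul (by positivity)]
    refine mul_le_mul_left (ENNReal.ofReal_le_ofReal ?_) _
    have : 400 * (Cp * Cd) * M ^ 4 ≤ 400 * (Cp * Cd) * M ^ 6 := by gcongr
    nlinarith
  have k3 : ENNReal.ofReal (40 * M ^ 3) ^ 2 * (ENNReal.ofReal Ce * E) ≤
      ENNReal.ofReal (1600 * Ce * M ^ 6) * E := by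
    rw [← ENNReal.ofReal_pow (by positivity), ← mul_assoc, ← ENNReal.ofReal_mul (by positivity)]
    refine mul_le_mul_left (ENNReal.ofReal_le_ofReal ?_) _
    nlinarith
  calc _ ≤ 3 * (ENNReal.ofReal (400 * (Cp * Cd) * M ^ 6) * E) + 3 * (ENNReal.ofReal (400 * (Cp * Cd) * M ^ 6) * E) +
        3 * (ENNReal.ofReal (1600 * Ce * M ^ 6) * E) := by
        refine q.trans ?_
        exact add_le_add (add_le_add (mul_le_mul_right ((mul_le_mul_right a1' _).trans k1) _)
          (mul_le_mul_right ((mul_le_mul_right a2' _).trans k1) _))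
          (mul_le_mul_right ((mul_le_mul_right a3 _).trans k3) _)
    _ = _ := by
        rw [add_mul, add_mul, ENNReal.ofReal_add (by positivity) (by positivity),
          ENNReal.ofReal_add (by positivity) (by positivity), mul_assoc 3, mul_assoc 3,
          ENNReal.ofReal_mul (p := 3) (by norm_num), ENNReal.ofReal_mul (p := 3) (by norm_num)]
        simp only [ENNReal.ofReal_ofNat]
        ring

lemma fc_swap {H : ℝ → ℝ → ℂ} {a b : ℝ} (hab : a ≤ b)
    (hH : ContinuousOn (Function.uncurry H) (Set.univ ×ˢ Set.Icc a b)) (k : ℤ) :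
    fc (fun s => ∫ t in a..b, H s t) k = ∫ t in a..b, fc (fun s => H s t) k := by
  unfold fc
  rw [← swap_cont hab]
  · refine intervalIntegral.integral_congr fun s _ => ?_
    exact (intervalIntegral.integral_mul_const _ _).symm
  · have : Continuous fun p : ℝ × ℝ => Complex.exp (-Complex.I * (k : ℂ) * (p.1 : ℂ)) := by fun_prop
    exact hH.mul this.continuousOn

lemma fr_mul {γ : ℝ} {k : ℤ} {τ : ℝ} (h0 : τ ≠ 0) {z : ℂ} {c : ℝ}
    (hz : ‖z + ((k * τ : ℝ) : ℂ) ^ 2 / 2‖ ≤ c * |(k * τ : ℝ)| ^ (2 + γ)) :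
    ‖z / (τ : ℂ) ^ 2 + (k : ℂ) ^ 2 / 2‖ ≤ c * (|(k : ℝ)| ^ (2 + γ) * |τ| ^ γ) := by
  have ht : 0 < |τ| := abs_pos.2 h0
  have hc : (τ : ℂ) ≠ 0 := by exact_mod_cast h0
  have e : z / (τ : ℂ) ^ 2 + (k : ℂ) ^ 2 / 2 = (z + ((k * τ : ℝ) : ℂ) ^ 2 / 2) / (τ : ℂ) ^ 2 := by
    push_cast; field_simp
  rw [e, norm_div, norm_pow, Complex.norm_real, Real.norm_eq_abs, div_le_iff₀ (by positivity)]
  refine hz.trans_eq ?_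
  rw [abs_mul, Real.mul_rpow (abs_nonneg _) ht.le, Real.rpow_add ht, Real.rpow_two]
  ring

lemma freeze {θ γ : ℝ} (hγ : 0 < γ) (hγ1 : γ ≤ 1) (hθ : 2 + γ < θ + 3 / 2) : ∃ C : ℝ, 0 < C ∧
    ∀ (X x : ℝ → ℂ) (a : ℤ → ℝ≥0∞) (N : ℝ), PC X x → (∀ k, ‖fc X k‖ₑ ≤ a k) → 0 ≤ N →
    ∑' k, a k ^ 2 * wt (4 + 2 * θ) k ≤ ENNReal.ofReal (N ^ 2) → ∀ ε s τ, 0 < ε → ε ≤ |τ| →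
    ‖kap X x s τ - kap X x s ε‖ ≤ C * N * |τ| ^ γ ∧ ‖rho X x s τ - kap X x s ε‖ ≤ C * N * |τ| ^ γ := by
  obtain ⟨C, hC, h⟩ := sumCS (θ := θ) (σ := 2 + γ) (by linarith) hθ
  refine ⟨10 * C, by positivity, fun X x a N pc ha hN hs ε s τ h0 hτ => ?_⟩
  have ht : 0 < |τ| := h0.trans_le hτ
  have t0 : τ ≠ 0 := abs_pos.1 ht
  have hεγ : |ε| ^ γ ≤ |τ| ^ γ := by
    rw [abs_of_pos h0]; exact Real.rpow_le_rpow h0.le hτ hγ.le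
  have key : ∀ f : ℝ → ℂ, Continuous f → Function.Periodic f (2 * π) → ∀ m : ℤ → ℂ,
      (∀ k, fc f k = m k * fc X k) → (∀ k, ‖m k / 1 + (k : ℂ) ^ 2 / 2‖ ≤ 5 * (|(k : ℝ)| ^ (2 + γ) * |τ| ^ γ)) →
      ‖f s - kap X x s ε‖ ≤ 10 * C * N * |τ| ^ γ := by
    intro f hf hfp m hm hb
    have := supF_mul (f := fun s => f s - kap X x s ε) (X := X)
      (hfp.sub (pkap pc ε)) (hf.sub (ckap pc ε))
      (m := fun k => m k - mkap (k * ε) / ε ^ 2) (fun k => by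
        rw [fc_sub hf (ckap pc ε), hm, fc_kap pc h0.ne']; ring)
      (b := fun k => 10 * |τ| ^ γ * |(k : ℝ)| ^ (2 + γ)) (c := 1) (by linarith [Real.two_le_pi])
      (fun k => by
        have h1 := hb k
        have h2 := fr_mul (γ := γ) (k := k) h0.ne' (mk_fr hγ hγ1 (k * ε))
        rw [div_one] at h1
        have e : m k - mkap (k * ε) / (ε : ℂ) ^ 2 = (m k + (k : ℂ) ^ 2 / 2) -
          (mkap (k * ε) / (ε : ℂ) ^ 2 + (k : ℂ) ^ 2 / 2) := by ring
        rw [e]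
        refine (norm_sub_le _ _).trans ?_
        have h3 : |(k : ℝ)| ^ (2 + γ) * |ε| ^ γ ≤ |(k : ℝ)| ^ (2 + γ) * |τ| ^ γ := by gcongr
        have h4 : 0 ≤ |(k : ℝ)| ^ (2 + γ) * |τ| ^ γ := by positivity
        linarith)
      (fun k => by positivity) ha s
    have h5 : ∑' k, a k * ENNReal.ofReal (10 * |τ| ^ γ * |(k : ℝ)| ^ (2 + γ)) ≤
        ENNReal.ofReal (10 * C * N * |τ| ^ γ) := by
      calc _ = ENNReal.ofReal (10 * |τ| ^ γ) * ∑' k, a k * wt (2 + γ) k := by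
            rw [← ENNReal.tsum_mul_left]
            refine tsum_congr fun k => ?_
            rw [ENNReal.ofReal_mul (by positivity), wt]; ring
        _ ≤ ENNReal.ofReal (10 * |τ| ^ γ) * ENNReal.ofReal (C * N) := by
            gcongr; exact h a N hN hs
        _ = _ := by
            rw [← ENNReal.ofReal_mul (by positivity)]; congr 1; ring
    have := ofReal_to (by positivity) (this.trans h5)
    rwa [toReal_enorm] at this
  refine ⟨key _ (ckap pc τ) (pkap pc τ) _ (fc_kap pc t0) fun k => ?_,
    key _ (crho pc τ) (prho pc τ) _ (fc_rho pc t0) fun k => ?_⟩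
  · rw [div_one]
    refine (fr_mul t0 (mk_fr hγ hγ1 _)).trans ?_
    gcongr; norm_num
  · rw [div_one]
    exact fr_mul t0 (mr_fr hγ hγ1 _)

lemma PC.dell {X x : ℝ → ℂ} (h : PC X x) {s τ : ℝ} (h0 : τ ≠ 0) :
    HasDerivAt (fun t => ell X s t) (rho X x s τ) τ := by
  have hc : (τ : ℂ) ≠ 0 := by exact_mod_cast h0
  have h1 : HasDerivAt (fun t : ℝ => X (s + t)) (x (s + τ)) τ := by
    exact (h.der (s + τ)).comp_const_add s τ
  have h2 : HasDerivAt (fun t : ℝ => (t : ℂ)) 1 τ := Complex.ofRealCLM.hasDerivAt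
  have := (h1.sub_const (X s)).div h2 hc
  convert! this using 1
  unfold rho ell
  field_simp

lemma II_rho {X x : ℝ → ℂ} (h : PC X x) {ε : ℝ} (h0 : 0 < ε) (hε : ε ≤ π) (s : ℝ) :
    II ε (rho X x) s = (ell X s π - ell X s ε) + (ell X s (-ε) - ell X s (-π)) := by
  obtain ⟨a, b⟩ := II_intble h0 hε (cont_rho h.contX h.cont) s
  unfold II
  rw [intervalIntegral.integral_eq_sub_of_hasDerivAt _ a, intervalIntegral.integral_eq_sub_of_hasDerivAt _ b]
  · intro t ht
    rw [Set.uIcc_of_le (by linarith)] at ht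
    exact h.dell (sub2 h0 t ht).1
  · intro t ht
    rw [Set.uIcc_of_le hε] at ht
    exact h.dell (sub1' h0 t ht).1

lemma sq4 (a b c d : ℝ≥0∞) : (a + b + c + d) ^ 2 ≤ 12 * (a ^ 2 + b ^ 2 + c ^ 2 + d ^ 2) := by
  have h1 := sq3 (a + b) c d
  have h2 := sq3 a b 0
  simp only [add_zero, ne_eq, OfNat.ofNat_ne_zero, not_false_eq_true, zero_pow] at h2
  calc _ ≤ 3 * ((a + b) ^ 2 + c ^ 2 + d ^ 2) := h1
    _ ≤ 3 * (3 * (a ^ 2 + b ^ 2) + c ^ 2 + d ^ 2) := by gcongr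
    _ ≤ 3 * (3 * (a ^ 2 + b ^ 2) + 3 * c ^ 2 + 3 * d ^ 2) := by
        gcongr
        · exact le_mul_of_one_le_left' (by norm_num)
        · exact le_mul_of_one_le_left' (by norm_num)
    _ = 9 * (a ^ 2 + b ^ 2 + c ^ 2 + d ^ 2) := by ring
    _ ≤ _ := by gcongr; norm_num

lemma II_rho_Q {X x : ℝ → ℂ} (h : PC X x) {ε : ℝ} (h0 : 0 < ε) (hε : ε ≤ π) :
    Q (II ε (rho X x)) ≤ 48 * En 2 X := by
  have hp := Real.pi_pos
  have q1 := ell_Q' h hp.ne'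
  have q2 := ell_Q' h h0.ne'
  have q3 := ell_Q' h (neg_ne_zero.2 h0.ne')
  have q4 := ell_Q' h (neg_ne_zero.2 hp.ne')
  have m : ∀ τ, Measurable fun s => ‖ell X s τ‖ₑ ^ 2 := fun τ => by
    have := (cell h τ).measurable
    fun_prop
  calc _ ≤ ∫⁻ s, 12 * (‖ell X s π‖ₑ ^ 2 + ‖ell X s ε‖ₑ ^ 2 + ‖ell X s (-ε)‖ₑ ^ 2 + ‖ell X s (-π)‖ₑ ^ 2) ∂mu := by
        refine lintegral_mono fun s => ?_
        refine le_trans (pow_le_pow_left₀ (by simp) ?_ 2) (sq4 _ _ _ _)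
        rw [II_rho h h0 hε]
        refine (enorm_add_le _ _).trans ?_
        rw [add_assoc (‖ell X s π‖ₑ + ‖ell X s ε‖ₑ)]
        exact add_le_add (enorm_sub_le) (enorm_sub_le)
    _ = 12 * (Q (fun s => ell X s π) + Q (fun s => ell X s ε) + Q (fun s => ell X s (-ε)) +
          Q (fun s => ell X s (-π))) := by
        rw [lintegral_const_mul' _ _ (by simp)]
        unfold Q
        rw [lintegral_add_right _ (m _), lintegral_add_right _ (m _), lintegral_add_right _ (m _)]
    _ ≤ 12 * (En 2 X + En 2 X + En 2 X + En 2 X) := by gcongr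
    _ = _ := by ring

lemma mkpm2 (ξ : ℝ) : ‖mkap ξ + mkap (-ξ)‖ ≤ 4 * min |ξ| 1 ^ 2 := by
  have e : mkap ξ + mkap (-ξ) = ((2 * Real.cos ξ - 2 : ℝ) : ℂ) := by
    unfold mkap
    push_cast
    rw [Complex.cos]
    rw [mul_comm Complex.I, mul_comm Complex.I]
    ring
  rw [e, Complex.norm_real, Real.norm_eq_abs]
  have h1 := Real.cos_le_one ξ
  have h2 := Real.one_sub_sq_div_two_le_cos (x := ξ)
  have h3 := Real.neg_one_le_cos ξ
  rw [abs_of_nonpos (by linarith)]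
  rcases le_total |ξ| 1 with h | h
  · rw [min_eq_left h, sq_abs]; nlinarith [sq_nonneg ξ]
  · rw [min_eq_right h]; linarith

lemma II_kap_Q : ∃ C : ℝ, 0 < C ∧ ∀ (X x : ℝ → ℂ), PC X x → ∀ ε, 0 < ε → ε ≤ π →
    Q (II ε (kap X x)) ≤ ENNReal.ofReal C * En 2 X := by
  obtain ⟨C, hC, hJ⟩ := Jabs (p := 0) (q := 2) (by norm_num) (by norm_num) two_ne_zero
  refine ⟨(2 * C) ^ 2, by positivity, fun X x h ε h0 hε => ?_⟩
  have hc := cont_kap h.contX h.cont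
  have hcc : ∀ k : ℤ, Continuous fun t : ℝ => mkap (k * t) := fun k => by unfold mkap; fun_prop
  have b := Q_mul (f := II ε (kap X x)) (X := X) (II_cont h0 hε hc)
    (m := fun k => ∫ t in ε..π, (mkap (k * t) + mkap (-(k * t))) / (t : ℂ) ^ 2)
    (fun k => by
      unfold II
      rw [fc_add (cont_param hε (hc.mono (reg_sub (sub1' h0))))
        (cont_param (by linarith) (hc.mono (reg_sub (sub2 h0)))),
        fc_swap hε (hc.mono (reg_sub (sub1' h0))),
        fc_swap (by linarith) (hc.mono (reg_sub (sub2 h0)))]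
      have e1 : ∫ t in ε..π, fc (fun s => kap X x s t) k =
          (∫ t in ε..π, mkap (k * t) / (t : ℂ) ^ 2) * fc X k := by
        rw [← intervalIntegral.integral_mul_const]
        refine intervalIntegral.integral_congr fun t ht => ?_
        rw [Set.uIcc_of_le hε] at ht
        exact fc_kap h (sub1' h0 t ht).1 k
      have e2 : ∫ t in (-π)..(-ε), fc (fun s => kap X x s t) k =
          (∫ t in ε..π, mkap (-(k * t)) / (t : ℂ) ^ 2) * fc X k := by
        have := intervalIntegral.integral_comp_neg (a := ε) (b := π) (fun t => mkap (k * t) / (t : ℂ) ^ 2)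
        have e3 : ∫ t in ε..π, mkap (-(k * t)) / (t : ℂ) ^ 2 = ∫ t in (-π)..(-ε), mkap (k * t) / (t : ℂ) ^ 2 := by
          rw [← this]
          refine intervalIntegral.integral_congr fun t ht => ?_
          rw [mul_neg]; push_cast; rw [neg_sq]
        rw [e3, ← intervalIntegral.integral_mul_const]
        refine intervalIntegral.integral_congr fun t ht => ?_
        rw [Set.uIcc_of_le (by linarith)] at ht
        exact fc_kap h (sub2 h0 t ht).1 k
      rw [e1, e2, ← add_mul, ← intervalIntegral.integral_add]
      · congr 1
        refine intervalIntegral.integral_congr fun t ht => ?_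
        rw [add_div]
      · refine ContinuousOn.intervalIntegrable ?_
        rw [Set.uIcc_of_le hε]
        refine ContinuousOn.div (hcc k).continuousOn (by fun_prop) fun t ht => ?_
        exact pow_ne_zero _ (by exact_mod_cast (sub1' h0 t ht).1)
      · refine ContinuousOn.intervalIntegrable ?_
        rw [Set.uIcc_of_le hε]
        refine ContinuousOn.div ?_ (by fun_prop) fun t ht => ?_
        · have := hcc (-k)
          push_cast at this
          simp only [neg_mul] at this
          exact this.continuousOn
        · exact pow_ne_zero _ (by exact_mod_cast (sub1' h0 t ht).1))
    (b := fun k => 2 * C * |(k : ℝ)|) (fun k => by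
      have : ‖∫ t in ε..π, (mkap (k * t) + mkap (-(k * t))) / (t : ℂ) ^ 2‖ₑ ≤ ENNReal.ofReal (4 * (C * |(k : ℝ)|)) := by
        rw [intervalIntegral.integral_of_le hε]
        refine (enorm_integral_le_lintegral_enorm _).trans ?_
        have J : ∫⁻ τ : ℝ, ENNReal.ofReal (min |(k : ℝ)| (1 / |τ|) ^ 2) ≤ ENNReal.ofReal (C * |(k : ℝ)|) := by
          refine le_trans (le_of_eq ?_) ((hJ k).trans_eq ?_)
          · simp only [Real.rpow_zero, one_mul, Real.rpow_two]
          · rw [show (2 : ℝ) - 0 - 1 = 1 by norm_num, Real.rpow_one]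
        rw [ENNReal.ofReal_mul (by norm_num)]
        refine le_trans ?_ (mul_le_mul_right J _)
        rw [← lintegral_const_mul' _ _ (by simp)]
        refine le_trans ?_ (setLIntegral_le_lintegral (Set.Ioc ε π) _)
        refine setLIntegral_mono' measurableSet_Ioc fun t ht => ?_
        have ht0 : 0 < t := h0.trans ht.1
        rw [← ofRealNorm, ← ENNReal.ofReal_mul (by norm_num)]
        refine ENNReal.ofReal_le_ofReal ?_
        rw [norm_div, norm_pow, Complex.norm_real, Real.norm_eq_abs, div_le_iff₀ (by positivity)]
        refine (mkpm2 _).trans_eq ?_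
        have e : min |(k * t : ℝ)| 1 = |t| * min |(k : ℝ)| (1 / |t|) := by
          have h1 : 1 / |t| * |t| = 1 := by field_simp
          have h2 := min_mul_of_nonneg |(k : ℝ)| (1 / |t|) (abs_nonneg t)
          rw [h1] at h2
          rw [abs_mul, ← h2, mul_comm]
        rw [e]; ring
      have := ofReal_to (by positivity) this
      rw [toReal_enorm] at this
      linarith)
  refine b.trans_eq ?_
  unfold En
  rw [← ENNReal.tsum_mul_left]
  refine tsum_congr fun k => ?_
  rw [wt, Real.rpow_two, mul_pow, ENNReal.ofReal_mul (by positivity)]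
  ring

lemma Q_le3F {F : ℝ → ℝ≥0∞} {c1 c2 c3 : ℝ≥0∞} {A B C : ℝ → ℝ≥0∞} (hA : Measurable A) (hB : Measurable B)
    (hc1 : c1 ≠ ∞) (hc2 : c2 ≠ ∞) (hc3 : c3 ≠ ∞)
    (h : ∀ s, F s ≤ c1 * A s + c2 * B s + c3 * C s) :
    ∫⁻ s, F s ^ 2 ∂mu ≤ 3 * (c1 ^ 2 * ∫⁻ s, A s ^ 2 ∂mu) + 3 * (c2 ^ 2 * ∫⁻ s, B s ^ 2 ∂mu) +
      3 * (c3 ^ 2 * ∫⁻ s, C s ^ 2 ∂mu) := by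
  calc _ ≤ ∫⁻ s, (3 * (c1 ^ 2 * A s ^ 2) + 3 * (c2 ^ 2 * B s ^ 2)) + 3 * (c3 ^ 2 * C s ^ 2) ∂mu := by
        refine lintegral_mono fun s => ?_
        refine (pow_le_pow_left₀ (by simp) (h s) 2).trans ((sq3 _ _ _).trans_eq ?_)
        ring
    _ = _ := by
        rw [lintegral_add_left, lintegral_add_left]
        · congr 1
          · congr 1
            · rw [lintegral_const_mul' _ _ (by simp), lintegral_const_mul' _ _ (by simp [hc1])]
            · rw [lintegral_const_mul' _ _ (by simp), lintegral_const_mul' _ _ (by simp [hc2])]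
          · rw [lintegral_const_mul' _ _ (by simp), lintegral_const_mul' _ _ (by simp [hc3])]
        · fun_prop
        · fun_prop

lemma II_enorm' {ε : ℝ} (h0 : 0 < ε) (hε : ε ≤ π) (H : ℝ → ℝ → ℂ) (s : ℝ) {G : ℝ → ℝ≥0∞}
    (hG : ∀ t, ε ≤ |t| → |t| ≤ π → ‖H s t‖ₑ ≤ G t) :
    ‖II ε H s‖ₑ ≤ ∫⁻ t, G t ∂nu := by
  unfold II
  rw [intervalIntegral.integral_of_le hε, intervalIntegral.integral_of_le (by linarith)]
  have hpi := Real.pi_pos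
  refine (enorm_add_le _ _).trans ((add_le_add (enorm_integral_le_lintegral_enorm _)
    (enorm_integral_le_lintegral_enorm _)).trans ?_)
  rw [← lintegral_union measurableSet_Ioc]
  · refine (setLIntegral_mono' (measurableSet_Ioc.union measurableSet_Ioc) (g := G) ?_).trans
      (lintegral_mono_set (Set.union_subset ?_ ?_))
    · rintro t (ht | ht)
      · rw [Set.mem_Ioc] at ht
        have : 0 < t := by linarith
        exact hG t (by rw [abs_of_pos this]; linarith) (by rw [abs_of_pos this]; linarith)
      · rw [Set.mem_Ioc] at ht
        have : t < 0 := by linarith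
        exact hG t (by rw [abs_of_neg this]; linarith) (by rw [abs_of_neg this]; linarith)
    · exact fun t ht => ⟨by linarith [ht.1, Real.pi_pos], ht.2⟩
    · exact fun t ht => ⟨ht.1.le, by linarith [ht.2, Real.pi_pos]⟩
  · exact Set.disjoint_left.2 fun t ht ht' => by linarith [ht.1, ht'.2]

lemma ell_fr {X x : ℝ → ℂ} {s ε τ M : ℝ} (h0 : 0 < ε) (hτ : ε ≤ |τ|) (hM : 0 ≤ M)
    (h1 : ‖kap X x s τ‖ ≤ M) (h2 : ‖kap X x s ε‖ ≤ M) :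
    ‖ell X s τ - ell X s ε‖ ≤ 2 * |τ| * M := by
  have t0 : τ ≠ 0 := abs_pos.1 (h0.trans_le hτ)
  have c1 : (τ : ℂ) ≠ 0 := by exact_mod_cast t0
  have c2 : (ε : ℂ) ≠ 0 := by exact_mod_cast h0.ne'
  have e : ell X s τ - ell X s ε = τ * kap X x s τ - ε * kap X x s ε := by
    unfold kap; field_simp; ring
  rw [e]
  refine (norm_sub_le _ _).trans ?_
  rw [norm_mul, norm_mul, Complex.norm_real, Complex.norm_real, Real.norm_eq_abs, Real.norm_eq_abs,
    abs_of_pos h0]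
  have : |τ| * ‖kap X x s τ‖ ≤ |τ| * M := by gcongr
  have : ε * ‖kap X x s ε‖ ≤ |τ| * M := by gcongr
  linarith

lemma abs_gam {γ t : ℝ} (hγ : 0 < γ) (hγ1 : γ ≤ 1) (h0 : 0 < |t|) (ht : |t| ≤ π) : |t| ≤ 4 * |t| ^ γ := by
  have e : |t| = |t| ^ (1 - γ) * |t| ^ γ := by rw [← Real.rpow_add h0]; simp
  have h1 : |t| ^ (1 - γ) ≤ 4 := by
    calc |t| ^ (1 - γ) ≤ 4 ^ (1 - γ) := Real.rpow_le_rpow h0.le (ht.trans Real.pi_le_four) (by linarith)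
      _ ≤ 4 ^ (1 : ℝ) := Real.rpow_le_rpow_of_exponent_le (by norm_num) (by linarith)
      _ = 4 := by norm_num
  calc |t| = |t| ^ (1 - γ) * |t| ^ γ := e
    _ ≤ _ := by gcongr

lemma II_lin {ε : ℝ} (h0 : 0 < ε) (hε : ε ≤ π) {r k : ℝ → ℝ → ℂ} {s : ℝ}
    (hr : ContinuousOn (Function.uncurry r) reg) (hk : ContinuousOn (Function.uncurry k) reg)
    (c1 c2 c3 c4 : ℂ) :
    II ε (fun s t => c1 * r s t + c2 * conj (r s t) + c3 * k s t + c4 * conj (k s t)) s =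
      c1 * II ε r s + c2 * conj (II ε r s) + c3 * II ε k s + c4 * conj (II ε k s) := by
  obtain ⟨a, b⟩ := II_intble h0 hε hr s
  obtain ⟨a', b'⟩ := II_intble h0 hε hk s
  have cj : ∀ (f : ℝ → ℂ) (u v : ℝ), ∫ t in u..v, conj (f t) = conj (∫ t in u..v, f t) :=
    fun f u v => by simp only [intervalIntegral, integral_conj, map_sub]
  have ij : ∀ (f : ℝ → ℂ) (u v : ℝ), IntervalIntegrable f volume u v →
      IntervalIntegrable (fun t => conj (f t)) volume u v := fun f u v h => by
    rw [intervalIntegrable_iff] at h ⊢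
    exact (Complex.conjCLE.integrable_comp_iff).2 h
  have key : ∀ u v : ℝ, IntervalIntegrable (r s) volume u v → IntervalIntegrable (k s) volume u v →
      ∫ t in u..v, (c1 * r s t + c2 * conj (r s t) + c3 * k s t + c4 * conj (k s t)) =
      c1 * (∫ t in u..v, r s t) + c2 * conj (∫ t in u..v, r s t) + c3 * (∫ t in u..v, k s t) +
        c4 * conj (∫ t in u..v, k s t) := by
    intro u v h1 h2
    rw [intervalIntegral.integral_add, intervalIntegral.integral_add, intervalIntegral.integral_add,
      intervalIntegral.integral_const_mul, intervalIntegral.integral_const_mul,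
      intervalIntegral.integral_const_mul, intervalIntegral.integral_const_mul, cj, cj]
    · exact h1.const_mul _
    · exact (ij _ _ _ h1).const_mul _
    · exact (h1.const_mul _).add ((ij _ _ _ h1).const_mul _)
    · exact h2.const_mul _
    · exact ((h1.const_mul _).add ((ij _ _ _ h1).const_mul _)).add (h2.const_mul _)
    · exact (ij _ _ _ h2).const_mul _
  unfold II
  rw [key _ _ a a', key _ _ b b']
  simp only [map_add]
  ring

lemma c_mul {a b c M : ℝ} {E : ℝ≥0∞} {n : ℕ} (hn : n ≤ 6) (ha : 0 ≤ a) (hb : 0 ≤ b)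
    (hM : 1 ≤ M) (h : b * a ≤ c * M ^ n) (hc : 0 ≤ c) :
    ENNReal.ofReal b * (ENNReal.ofReal a * E) ≤ ENNReal.ofReal (c * M ^ 6) * E := by
  rw [← mul_assoc, ← ENNReal.ofReal_mul hb]
  refine mul_le_mul_left (ENNReal.ofReal_le_ofReal (h.trans ?_)) _
  have := pow_le_pow_right₀ hM hn
  gcongr

/-- main term, second case -/
lemma T1B {θ : ℝ} (hθ : 1 / 2 < θ) (hθ1 : θ < 1) : ∃ C K : ℝ, 0 < C ∧ 0 < K ∧
    ∀ (X1 x1 X2 x2 : ℝ → ℂ) (M N : ℝ), Ctx θ M X1 x1 X2 x2 → 0 ≤ N → K * N ≤ M →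
    ∑' k, aa X1 X2 k ^ 2 * wt (4 + 2 * θ) k ≤ ENNReal.ofReal (N ^ 2) → ∀ ε, 0 < ε → ε ≤ π →
    Q (II ε fun s t => rr X1 x1 s t - rr X2 x2 s t) ≤
      ENNReal.ofReal (C * M ^ 6) * En 2 (fun s => X1 s - X2 s) := by
  obtain ⟨γ, hγ⟩ : ∃ γ, γ = (θ - 1 / 2) / 2 := ⟨_, rfl⟩
  have g0 : 0 < γ := by rw [hγ]; linarith
  have g1 : γ ≤ 1 := by rw [hγ]; linarith
  obtain ⟨C2, hC2, s2⟩ := sumCS (θ := θ) (σ := 2) two_pos (by linarith)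
  obtain ⟨Cf, hCf, hf⟩ := freeze (θ := θ) g0 g1 (by rw [hγ]; linarith)
  obtain ⟨Cd, hCd, hd⟩ := DW_L (DW_B g0)
  obtain ⟨Cg, hCg, hg⟩ := rpowI (p := γ - 1) (by linarith)
  obtain ⟨Ce, hCe, he⟩ := ell_L (p := 0) (by norm_num)
  obtain ⟨Ck, hCk, hk⟩ := II_kap_Q
  refine ⟨3 * (36 * 48) + 3 * (36 * Ck) + 3 * (3 * (740 ^ 2 * (Cg * Cd)) + 3 * (740 ^ 2 * (Cg * Cd)) + 3 * (160 ^ 2 * Ce)),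
    C2 + Cf, by positivity, by positivity, fun X1 x1 X2 x2 M N c hN hNM hs ε h0 hε => ?_⟩
  have hM := c.hM
  have hM0 : 0 ≤ M := by linarith
  have b2 : C2 * N ≤ M := le_trans (by nlinarith) hNM
  have bf : Cf * N ≤ M := le_trans (by nlinarith) hNM
  set a := aa X1 X2 with ha
  set D := fun s => X1 s - X2 s with hD
  set d := fun s => x1 s - x2 s with hd'
  have pc : PC D d := c.dpc
  have hP : ∀ τ, Pr X1 X2 τ ≤ M := fun τ =>
    ofReal_to hM0 ((PP_le3 a τ).trans ((s2 a N hN hs).trans (ENNReal.ofReal_le_ofReal b2)))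
  have habs : |ε| ≤ π := by rwa [abs_of_pos h0]
  have pw : ∀ s τ, ε ≤ |τ| → |τ| ≤ π →
      ‖rr X1 x1 s τ - rr X2 x2 s τ - Lam (ell X1 s ε) (kap X1 x1 s ε) (kap X2 x2 s ε) (rho D d s τ) (kap D d s τ)‖ₑ ≤
      ENNReal.ofReal (740 * M ^ 2) * (ENNReal.ofReal (|τ| ^ γ) * ‖rho D d s τ‖ₑ) +
      ENNReal.ofReal (740 * M ^ 2) * (ENNReal.ofReal (|τ| ^ γ) * ‖kap D d s τ‖ₑ) +
      ENNReal.ofReal (160 * M ^ 3) * (ENNReal.ofReal (|τ| ^ (0 : ℝ)) * ‖ell D s τ‖ₑ) := by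
    intro s τ te tp
    have tpos : 0 < |τ| := h0.trans_le te
    have t0 : τ ≠ 0 := abs_pos.1 tpos
    have f1 := hf X1 x1 a N c.n1.pc (fun _ => le_self_add) hN hs ε s τ h0 te
    have f2 := hf X2 x2 a N c.n2.pc (fun _ => le_add_self) hN hs ε s τ h0 te
    have hMγ : Cf * N * |τ| ^ γ ≤ M * |τ| ^ γ := by gcongr
    have k1 := (c.k1 (s := s) t0 tp).trans (hP τ)
    have z1 := (c.k1 (s := s) h0.ne' habs).trans (hP ε)
    have z2 := (c.k2 (s := s) h0.ne' habs).trans (hP ε)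
    have b := rc_fr (t := τ) (P := M) (M := 4 * M) (δ := M * |τ| ^ γ) (η := 8 * |τ| * M)
      (c.n1.one_le (s := s) t0 tp) (c.n2.one_le (s := s) t0 tp)
      (c.n1.one_le (s := s) h0.ne' habs) ((c.r1 (s := s) t0 tp).trans (hP τ))
      ((c.r2 (s := s) t0 tp).trans (hP τ)) k1 ((c.k2 (s := s) t0 tp).trans (hP τ)) (by linarith)
      (by have := tp.trans Real.pi_le_four; gcongr) z1 z2 (f1.2.trans hMγ) (f2.2.trans hMγ) (f2.1.trans hMγ)
      (by have := ell_fr h0 te hM0 k1 z1; linarith)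
    rw [ell_sub, rho_sub, kap_sub] at b
    rw [← ofRealNorm, ← ofRealNorm, ← ofRealNorm, ← ofRealNorm, 
      ← ENNReal.ofReal_mul (by positivity), ← ENNReal.ofReal_mul (by positivity),
      ← ENNReal.ofReal_mul (by positivity), ← ENNReal.ofReal_mul (by positivity),
      ← ENNReal.ofReal_mul (by positivity), ← ENNReal.ofReal_mul (by positivity),
      ← ENNReal.ofReal_add (by positivity) (by positivity),
      ← ENNReal.ofReal_add (by positivity) (by positivity)]
    refine ENNReal.ofReal_le_ofReal (b.trans ?_)
    have q1 := abs_gam g0 g1 tpos tp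
    have q2 : M * |τ| ^ γ + 8 * |τ| * M * M + |τ| * M ^ 2 ≤ 37 * M ^ 2 * |τ| ^ γ := by
      have : M * |τ| ^ γ ≤ M ^ 2 * |τ| ^ γ := by gcongr; nlinarith
      have : |τ| * M ^ 2 ≤ 4 * |τ| ^ γ * M ^ 2 := by gcongr
      nlinarith
    have q3 : 20 * (M * |τ| ^ γ + 8 * |τ| * M * M + |τ| * M ^ 2) * (‖rho D d s τ‖ + ‖kap D d s τ‖) ≤
        20 * (37 * M ^ 2 * |τ| ^ γ) * (‖rho D d s τ‖ + ‖kap D d s τ‖) := by gcongr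
    rw [Real.rpow_zero]
    calc _ ≤ 20 * (37 * M ^ 2 * |τ| ^ γ) * (‖rho D d s τ‖ + ‖kap D d s τ‖) +
          40 * (4 * M) * M ^ 2 * ‖ell D s τ‖ := by gcongr
      _ = _ := by ring
  have cr := cont_rho pc.contX pc.cont
  have ck := cont_kap pc.contX pc.cont
  have mu1 : Measurable fun τ : ℝ => ENNReal.ofReal (|τ| ^ γ) := by fun_prop
  have m1 := meas_in (f := rho D d) (meas_rho pc) mu1
  have m2 := meas_in (f := kap D d) (meas_kap pc) mu1
  set A := fun s => ∫⁻ τ, ENNReal.ofReal (|τ| ^ γ) * ‖rho D d s τ‖ₑ ∂nu with hA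
  set B := fun s => ∫⁻ τ, ENNReal.ofReal (|τ| ^ γ) * ‖kap D d s τ‖ₑ ∂nu with hB
  set L := fun s => ∫⁻ τ, ENNReal.ofReal (|τ| ^ (0 : ℝ)) * ‖ell D s τ‖ₑ ∂nu with hL
  set G := fun s => ENNReal.ofReal (740 * M ^ 2) * A s + ENNReal.ofReal (740 * M ^ 2) * B s +
    ENNReal.ofReal (160 * M ^ 3) * L s with hG
  have qG := Q_le3F (F := G) (C := L) m1 m2 ENNReal.ofReal_ne_top ENNReal.ofReal_ne_top
    ENNReal.ofReal_ne_top (fun s => le_rfl)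
  have qT := Q_le3F (F := fun s => ‖II ε (fun s t => rr X1 x1 s t - rr X2 x2 s t) s‖ₑ)
    (A := fun s => ‖II ε (rho D d) s‖ₑ) (B := fun s => ‖II ε (kap D d) s‖ₑ) (C := G)
    (c1 := ENNReal.ofReal (6 * M)) (c2 := ENNReal.ofReal (6 * M)) (c3 := 1)
    (II_cont h0 hε cr).measurable.enorm (II_cont h0 hε ck).measurable.enorm
    ENNReal.ofReal_ne_top ENNReal.ofReal_ne_top (by simp) (fun s => by
      obtain ⟨c1, c2, c3, c4, hl, hb⟩ := Lam_int (v := ell X1 s ε) (z1 := kap X1 x1 s ε) (z2 := kap X2 x2 s ε)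
      obtain ⟨hb1, hb2, hb3, hb4⟩ := hb M (c.n1.one_le (s := s) h0.ne' habs)
        ((c.k1 (s := s) h0.ne' habs).trans (hP ε)) ((c.k2 (s := s) h0.ne' habs).trans (hP ε))
      set Lm := fun (σ t : ℝ) => c1 * rho D d σ t + c2 * conj (rho D d σ t) + c3 * kap D d σ t +
        c4 * conj (kap D d σ t) with hLm
      have cL : ContinuousOn (Function.uncurry Lm) reg := by
        have h1 : ContinuousOn (fun p : ℝ × ℝ => rho D d p.1 p.2) reg := cr
        have h2 : ContinuousOn (fun p : ℝ × ℝ => kap D d p.1 p.2) reg := ck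
        have h3 := cont_conj h1
        have h4 := cont_conj h2
        exact (((h1.const_mul c1).add (h3.const_mul c2)).add (h2.const_mul c3)).add (h4.const_mul c4)
      have cR : ContinuousOn (Function.uncurry fun s t => rr X1 x1 s t - rr X2 x2 s t) reg :=
        (contOns c.n1).2.1.sub (contOns c.n2).2.1
      have e1 := II_sub h0 hε cR cL s
      have e2 : II ε Lm s = _ := II_lin h0 hε cr ck c1 c2 c3 c4
      have e3 : ‖II ε Lm s‖ₑ ≤ ENNReal.ofReal (6 * M) * ‖II ε (rho D d) s‖ₑ +
          ENNReal.ofReal (6 * M) * ‖II ε (kap D d) s‖ₑ := by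
        rw [← ofRealNorm, ← ofRealNorm, ← ofRealNorm, ← ENNReal.ofReal_mul (by positivity),
          ← ENNReal.ofReal_mul (by positivity), ← ENNReal.ofReal_add (by positivity) (by positivity)]
        refine ENNReal.ofReal_le_ofReal ?_
        rw [e2]
        refine (norm_add_le _ _).trans ((add_le_add_left (norm_add₃_le) _).trans ?_)
        rw [norm_mul, norm_mul, norm_mul, norm_mul, nconj, nconj]
        have i1 := mul_le_mul_of_nonneg_right hb1 (norm_nonneg (II ε (rho D d) s))
        have i2 := mul_le_mul_of_nonneg_right hb2 (norm_nonneg (II ε (rho D d) s))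
        have i3 := mul_le_mul_of_nonneg_right hb3 (norm_nonneg (II ε (kap D d) s))
        have i4 := mul_le_mul_of_nonneg_right hb4 (norm_nonneg (II ε (kap D d) s))
        linarith
      have e4 : ‖II ε (fun s t => rr X1 x1 s t - rr X2 x2 s t - Lm s t) s‖ₑ ≤ G s := by
        have n1 : Measurable fun τ => ENNReal.ofReal (|τ| ^ γ) * ‖rho D d s τ‖ₑ :=
          mu1.mul ((meas_rho pc).comp measurable_prodMk_left).enorm
        have n2 : Measurable fun τ => ENNReal.ofReal (|τ| ^ γ) * ‖kap D d s τ‖ₑ :=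
          mu1.mul ((meas_kap pc).comp measurable_prodMk_left).enorm
        have n12 : Measurable fun τ => ENNReal.ofReal (740 * M ^ 2) * (ENNReal.ofReal (|τ| ^ γ) * ‖rho D d s τ‖ₑ) +
          ENNReal.ofReal (740 * M ^ 2) * (ENNReal.ofReal (|τ| ^ γ) * ‖kap D d s τ‖ₑ) :=
            (n1.const_mul _).add (n2.const_mul _)
        refine (II_enorm' h0 hε _ s (G := fun τ =>
          ENNReal.ofReal (740 * M ^ 2) * (ENNReal.ofReal (|τ| ^ γ) * ‖rho D d s τ‖ₑ) +
          ENNReal.ofReal (740 * M ^ 2) * (ENNReal.ofReal (|τ| ^ γ) * ‖kap D d s τ‖ₑ) +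
          ENNReal.ofReal (160 * M ^ 3) * (ENNReal.ofReal (|τ| ^ (0 : ℝ)) * ‖ell D s τ‖ₑ)) ?_).trans_eq ?_
        · intro t ht1 ht2
          have := pw s t ht1 ht2
          rwa [hl] at this
        · rw [lintegral_add_left n12, lintegral_add_left (n1.const_mul _),
            lintegral_const_mul' _ _ ENNReal.ofReal_ne_top, lintegral_const_mul' _ _ ENNReal.ofReal_ne_top,
            lintegral_const_mul' _ _ ENNReal.ofReal_ne_top]
      have e5 : II ε (fun s t => rr X1 x1 s t - rr X2 x2 s t) s =
          II ε Lm s + II ε (fun s t => rr X1 x1 s t - rr X2 x2 s t - Lm s t) s := by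
        rw [e1]; ring
      rw [e5, one_mul]
      exact (enorm_add_le _ _).trans (add_le_add e3 e4))
  have hu : ∫⁻ τ, ENNReal.ofReal (|τ| ^ γ) ^ 2 * ENNReal.ofReal (|τ| ^ (-(1 + γ))) ∂nu ≤ ENNReal.ofReal Cg := by
    refine le_trans (le_of_eq (lintegral_congr_ae ?_)) hg
    filter_upwards [ae_ne] with τ hτ
    have ht : 0 < |τ| := abs_pos.2 hτ.1
    rw [← ENNReal.ofReal_pow (by positivity), ← ENNReal.ofReal_mul (by positivity), ← Real.rpow_natCast,
      ← Real.rpow_mul ht.le, ← Real.rpow_add ht]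
    congr 2; push_cast; ring
  have a1 := (hd D (rho D d) _ (fun τ ht => rho_Q pc ht) (meas_rho pc) mu1).trans (mul_le_mul_left hu _)
  have a2 := (hd D (kap D d) _ (fun τ ht => kap_Q pc ht) (meas_kap pc) mu1).trans (mul_le_mul_left hu _)
  have a3 := he D d pc
  have a4 := II_rho_Q pc h0 hε
  have a5 := hk D d pc ε h0 hε
  set E := En 2 D
  rw [← mul_assoc, ← ENNReal.ofReal_mul hCg.le] at a1 a2
  have k1 : ENNReal.ofReal (740 * M ^ 2) ^ 2 * (ENNReal.ofReal (Cg * Cd) * E) ≤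
      ENNReal.ofReal (740 ^ 2 * (Cg * Cd) * M ^ 6) * E := by
    rw [← ENNReal.ofReal_pow (by positivity)]
    exact c_mul (n := 4) (by norm_num) (by positivity) (by positivity) hM (le_of_eq (by ring)) (by positivity)
  have k3 : ENNReal.ofReal (160 * M ^ 3) ^ 2 * (ENNReal.ofReal Ce * E) ≤
      ENNReal.ofReal (160 ^ 2 * Ce * M ^ 6) * E := by
    rw [← ENNReal.ofReal_pow (by positivity)]
    exact c_mul (n := 6) (by norm_num) (by positivity) (by positivity) hM (le_of_eq (by ring)) (by positivity)
  have k4 : ENNReal.ofReal (6 * M) ^ 2 * (ENNReal.ofReal 48 * E) ≤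
      ENNReal.ofReal (36 * 48 * M ^ 6) * E := by
    rw [← ENNReal.ofReal_pow (by positivity)]
    exact c_mul (n := 2) (by norm_num) (by positivity) (by positivity) hM (le_of_eq (by ring)) (by positivity)
  have k5 : ENNReal.ofReal (6 * M) ^ 2 * (ENNReal.ofReal Ck * E) ≤
      ENNReal.ofReal (36 * Ck * M ^ 6) * E := by
    rw [← ENNReal.ofReal_pow (by positivity)]
    exact c_mul (n := 2) (by norm_num) (by positivity) (by positivity) hM (le_of_eq (by ring)) (by positivity)
  rw [ENNReal.ofReal_ofNat] at k4
  have qG' := qG.trans (add_le_add (add_le_add (mul_le_mul_right ((mul_le_mul_right a1 _).trans k1) _)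
          (mul_le_mul_right ((mul_le_mul_right a2 _).trans k1) _))
          (mul_le_mul_right ((mul_le_mul_right a3 _).trans k3) _))
  rw [one_pow, one_mul] at qT
  refine (qT.trans (add_le_add (add_le_add (mul_le_mul_right ((mul_le_mul_right a4 _).trans k4) _)
          (mul_le_mul_right ((mul_le_mul_right a5 _).trans k5) _))
          (mul_le_mul_right qG' _))).trans_eq ?_
  have e3 : (3 : ℝ≥0∞) = ENNReal.ofReal 3 := by simp
  simp only [e3, ← mul_assoc]
  simp only [← add_mul, ← ENNReal.ofReal_mul (show (0 : ℝ) ≤ 3 by norm_num), mul_assoc]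
  simp only [← mul_assoc]
  rw [← ENNReal.ofReal_add (by positivity) (by positivity), ← ENNReal.ofReal_add (by positivity) (by positivity),
    ← ENNReal.ofReal_add (by positivity) (by positivity)]
  rw [← ENNReal.ofReal_mul (by norm_num), ← add_mul, ← ENNReal.ofReal_add (by positivity) (by positivity)]
  congr 2
  ring

lemma rpow_ii {p : ℝ} (hp : -1 < p) (a b : ℝ) : IntervalIntegrable (fun t : ℝ => |t| ^ p) volume a b := by
  have pos : ∀ b : ℝ, 0 ≤ b → IntervalIntegrable (fun t : ℝ => |t| ^ p) volume 0 b := fun b hb => by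
    refine (intervalIntegral.intervalIntegrable_rpow' (a := 0) (b := b) hp).congr ?_
    intro t ht
    rw [Set.uIoc_of_le hb] at ht
    simp only [abs_of_pos ht.1]
  have all : ∀ b : ℝ, IntervalIntegrable (fun t : ℝ => |t| ^ p) volume 0 b := fun b => by
    rcases le_total 0 b with h | h
    · exact pos b h
    · rw [IntervalIntegrable.iff_comp_neg]
      simpa using pos (-b) (by linarith)
  exact (all a).symm.trans (all b)

/-- Mass of the weight near the origin. -/
def om (p ε : ℝ) : ℝ := ∫ t in (-ε)..ε, |t| ^ p

lemma om_lim {p : ℝ} (hp : -1 < p) : Tendsto (om p) (𝓝 0) (𝓝 0) := by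
  have c : Continuous fun b : ℝ => ∫ t in (0:ℝ)..b, |t| ^ p :=
    intervalIntegral.continuous_primitive (fun a b => rpow_ii hp a b) 0
  have e : om p = fun ε => (∫ t in (0:ℝ)..ε, |t| ^ p) - ∫ t in (0:ℝ)..(-ε), |t| ^ p := by
    funext ε
    exact (intervalIntegral.integral_interval_sub_left (rpow_ii hp _ _) (rpow_ii hp _ _)).symm
  have c2 : Continuous fun ε : ℝ => (∫ t in (0:ℝ)..ε, |t| ^ p) - ∫ t in (0:ℝ)..(-ε), |t| ^ p :=
    c.sub (c.comp continuous_neg)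
  have := c2.tendsto 0
  rw [e]
  simpa using this

structure Sg (θ M : ℝ) (X x : ℝ → ℂ) : Prop where
  n : Nice X x
  hM : 1 ≤ M
  r : ∀ s τ : ℝ, τ ≠ 0 → |τ| ≤ π → ‖rho X x s τ‖ ≤ M * |τ| ^ ((θ - 1) / 2)
  k : ∀ s τ : ℝ, τ ≠ 0 → |τ| ≤ π → ‖kap X x s τ‖ ≤ M * |τ| ^ ((θ - 1) / 2)
  tr : ∀ s τ : ℝ, τ ≠ 0 → |τ| ≤ π → |τ| * ‖rho X x s τ‖ ≤ M

section
variable {θ M : ℝ} {X x X1 x1 X2 x2 : ℝ → ℂ}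

lemma Ctx.s1 (c : Ctx θ M X1 x1 X2 x2) : Sg θ M X1 x1 where
  n := c.n1
  hM := c.hM
  r := fun s τ h h' => (c.r1 h h').trans (c.wP τ h h')
  k := fun s τ h h' => (c.k1 h h').trans (c.wP τ h h')
  tr := fun s τ h h' => (mul_le_mul_of_nonneg_left (c.r1 h h') (abs_nonneg _)).trans (c.tP τ h h')

lemma Ctx.s2 (c : Ctx θ M X1 x1 X2 x2) : Sg θ M X2 x2 where
  n := c.n2
  hM := c.hM
  r := fun s τ h h' => (c.r2 h h').trans (c.wP τ h h')
  k := fun s τ h h' => (c.k2 h h').trans (c.wP τ h h')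
  tr := fun s τ h h' => (mul_le_mul_of_nonneg_left (c.r2 h h') (abs_nonneg _)).trans (c.tP τ h h')

lemma Sg.F0_bd (c : Sg θ M X x) (s : ℝ) {τ : ℝ} (h : τ ≠ 0) (h' : |τ| ≤ π) :
    ‖F0 X x s τ‖ ≤ 3 * M ^ 2 * |τ| ^ ((θ - 1) / 2) := by
  have hM := c.hM
  have := F0c_bd (c.n.one_le (s := s) h h') le_rfl c.hM (c.tr s τ h h')
  unfold F0
  refine this.trans ?_
  have := mul_le_mul_of_nonneg_left (c.r s τ h h') (show 0 ≤ 3 * M by linarith)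
  nlinarith

def g0 (X x : ℝ → ℂ) (s : ℝ) : ℂ := ∫ t in (-π)..π, F0 X x s t

lemma Sg.int (c : Sg θ M X x) (hθ : 0 < θ) (s : ℝ) : IntervalIntegrable (F0 X x s) volume (-π) π := by
  have hp : -1 < (θ - 1) / 2 := by linarith
  have i := ((rpow_ii hp (-π) π).const_mul (3 * M ^ 2))
  rw [intervalIntegrable_iff_integrableOn_Ioc_of_le negpi_lt_pi.le] at i ⊢
  have hs : ∀ᵐ t ∂(volume.restrict (Set.Ioc (-π) π)), t ≠ 0 ∧ |t| ≤ π := by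
    filter_upwards [ae_restrict_mem measurableSet_Ioc, ae_restrict_of_ae
      (Measure.ae_ne volume (0:ℝ))] with t ht h0
    exact ⟨h0, abs_le.2 ⟨ht.1.le, ht.2⟩⟩
  refine Integrable.mono' i ?_ ?_
  · have := slice_cont (contOns c.n).1 s
    have m : MeasurableSet {t : ℝ | t ≠ 0 ∧ |t| ≤ π} :=
      (measurableSet_singleton (0:ℝ)).compl.inter (isClosed_le continuous_abs continuous_const).measurableSet
    have a := this.aestronglyMeasurable (μ := volume) m
    refine a.mono_measure ?_
    have : (volume.restrict (Set.Ioc (-π) π)) = (volume.restrict (Set.Ioc (-π) π)).restrict {t : ℝ | t ≠ 0 ∧ |t| ≤ π} :=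
      (Measure.restrict_eq_self_of_ae_mem hs).symm
    rw [this]
    exact Measure.restrict_mono_measure Measure.restrict_le_self _
  · filter_upwards [hs] with t ht
    exact c.F0_bd s ht.1 ht.2

lemma Sg.small (c : Sg θ M X x) (hθ : 0 < θ) (s : ℝ) {ε : ℝ} (h0 : 0 < ε) (hε : ε ≤ π) :
    ‖g0 X x s - II ε (F0 X x) s‖ ≤ 3 * M ^ 2 * om ((θ - 1) / 2) ε := by
  have hp : -1 < (θ - 1) / 2 := by linarith
  have i := c.int hθ s
  have sub : ∀ a b : ℝ, -π ≤ a → a ≤ b → b ≤ π → IntervalIntegrable (F0 X x s) volume a b := fun a b h1 h2 h3 =>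
    i.mono_set (by rw [Set.uIcc_of_le h2, Set.uIcc_of_le negpi_lt_pi.le]; exact Set.Icc_subset_Icc h1 h3)
  have e : g0 X x s - II ε (F0 X x) s = ∫ t in (-ε)..ε, F0 X x s t := by
    unfold g0 II
    rw [← intervalIntegral.integral_add_adjacent_intervals (sub (-π) (-ε) le_rfl (by linarith) (by linarith))
      (sub (-ε) π (by linarith) (by linarith) le_rfl),
      ← intervalIntegral.integral_add_adjacent_intervals (sub (-ε) ε (by linarith) (by linarith) (by linarith))
      (sub ε π (by linarith) (by linarith) le_rfl)]
    ring
  rw [e, om, ← intervalIntegral.integral_const_mul]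
  refine intervalIntegral.norm_integral_le_of_norm_le (by linarith) ?_ ((rpow_ii hp _ _).const_mul _)
  filter_upwards [Measure.ae_ne volume (0:ℝ)] with t ht h
  exact c.F0_bd s ht (abs_le.2 ⟨by linarith [h.1], by linarith [h.2]⟩)

lemma eps_ev : ∀ᶠ ε : ℝ in 𝓝[>] 0, 0 < ε ∧ ε ≤ π := by
  filter_upwards [Ioo_mem_nhdsGT Real.pi_pos] with ε h
  exact ⟨h.1, h.2.le⟩

lemma om_lim' {p : ℝ} (hp : -1 < p) (C : ℝ) : Tendsto (fun ε => C * om p ε) (𝓝[>] 0) (𝓝 0) := by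
  have := ((om_lim hp).mono_left (nhdsWithin_le_nhds (s := Set.Ioi 0))).const_mul C
  simpa using this

lemma Sg.contg (c : Sg θ M X x) (hθ : 0 < θ) : Continuous (g0 X x) := by
  have hp : -1 < (θ - 1) / 2 := by linarith
  have u : TendstoUniformly (fun ε => II ε (F0 X x)) (g0 X x) (𝓝[>] (0:ℝ)) := by
    rw [Metric.tendstoUniformly_iff]
    intro δ hδ
    filter_upwards [eps_ev, (om_lim' hp (3 * M ^ 2)).eventually_lt_const hδ] with ε h1 h2 s
    rw [dist_eq_norm]
    exact (c.small hθ s h1.1 h1.2).trans_lt h2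
  refine u.continuous (Eventually.frequently ?_)
  filter_upwards [eps_ev] with ε h
  exact II_cont h.1 h.2 (contOns c.n).1

lemma fc_bd {f : ℝ → ℂ} {B : ℝ} (h : ∀ s, ‖f s‖ ≤ B) (k : ℤ) : ‖fc f k‖ ≤ B * (2 * π) := by
  unfold fc
  have := intervalIntegral.norm_integral_le_of_norm_le_const (a := -π) (b := π) (C := B)
    (f := fun s : ℝ => f s * Complex.exp (-Complex.I * k * s)) (fun s _ => by
      rw [norm_mul]
      have : ‖Complex.exp (-Complex.I * k * s)‖ = 1 := by
        rw [Complex.norm_exp]; simp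
      rw [this, mul_one]; exact h s)
  refine this.trans_eq ?_
  rw [show π - -π = 2 * π by ring, abs_of_pos (by positivity)]

lemma Sg.fc_lim (c : Sg θ M X x) (hθ : 0 < θ) (k : ℤ) :
    Tendsto (fun ε => fc (II ε (F0 X x)) k) (𝓝[>] 0) (𝓝 (fc (g0 X x) k)) := by
  have hp : -1 < (θ - 1) / 2 := by linarith
  rw [tendsto_iff_norm_sub_tendsto_zero]
  refine squeeze_zero' (Eventually.of_forall fun _ => norm_nonneg _) ?_ (om_lim' hp (2 * π * (3 * M ^ 2)))
  filter_upwards [eps_ev] with ε h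
  rw [norm_sub_rev, ← fc_sub (c.contg hθ) (II_cont h.1 h.2 (contOns c.n).1)]
  refine (fc_bd (fun s => c.small hθ s h.1 h.2) k).trans_eq (by ring)

end

section
variable {θ M : ℝ} {X x X1 x1 X2 x2 : ℝ → ℂ}

lemma mw_pi_Q (X : ℝ → ℂ) {τ : ℝ} (h : |τ| = π) :
    ∑' k, ‖fc X k‖ₑ ^ 2 * ENNReal.ofReal (mw k τ ^ 2) ≤ En 2 X := by
  unfold En
  refine ENNReal.tsum_le_tsum fun k => mul_le_mul_right (ENNReal.ofReal_le_ofReal ?_) _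
  rw [Real.rpow_two]
  refine pow_le_pow_left₀ (mw_nonneg _ _) ?_ 2
  unfold mw
  rw [h]
  refine mul_le_of_le_one_right (abs_nonneg _) ((min_le_right _ _).trans ?_)
  rw [div_le_one Real.pi_pos]
  linarith [Real.pi_gt_three]

lemma T2 (c : Ctx θ M X1 x1 X2 x2) {τ : ℝ} (h : |τ| = π) :
    Q (fun s => W X1 x1 s τ - W X2 x2 s τ) ≤ ENNReal.ofReal (576 * M ^ 6) * En 2 (fun s => X1 s - X2 s) := by
  have hM := c.hM
  have h0 : τ ≠ 0 := by rintro rfl; simp at h; linarith [Real.pi_pos]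
  have h1 : |τ| ≤ π := h.le
  have d := c.dpc
  set D : ℝ → ℂ := fun s => X1 s - X2 s with hD
  set y : ℝ → ℂ := fun s => x1 s - x2 s with hy
  set P := Pr X1 X2 τ with hP
  have P0 : 0 ≤ P := ENNReal.toReal_nonneg
  have tP : π * P ≤ M := by have := c.tP τ h0 h1; rwa [h] at this
  have PM : P ≤ M := by nlinarith [Real.pi_gt_three]
  have key : ∀ s, ‖W X1 x1 s τ - W X2 x2 s τ‖ₑ ≤
      ENNReal.ofReal (8 * M ^ 2) * ‖rho D y s τ‖ₑ + ENNReal.ofReal (8 * M ^ 2) * ‖kap D y s τ‖ₑ +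
      ENNReal.ofReal (8 * M ^ 2) * ‖ell D s τ‖ₑ := fun s => by
    have := Wc_diff (t := τ) (c.n1.one_le (s := s) h0 h1) (c.n2.one_le (s := s) h0 h1)
      (c.r1 (s := s) h0 h1) (c.r2 (s := s) h0 h1) (k1 := kap X1 x1 s τ) (c.k2 (s := s) h0 h1)
    rw [show rho X1 x1 s τ + kap X1 x1 s τ - (rho X2 x2 s τ + kap X2 x2 s τ) =
      (rho X1 x1 s τ - rho X2 x2 s τ) + (kap X1 x1 s τ - kap X2 x2 s τ) by ring,
      ell_sub, rho_sub, kap_sub, h] at this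
    have n := norm_add_le (rho D y s τ) (kap D y s τ)
    have a1 := norm_nonneg (rho D y s τ)
    have a2 := norm_nonneg (kap D y s τ)
    have a3 := norm_nonneg (ell D s τ)
    have M2 : M ≤ M ^ 2 := by nlinarith
    have b1 : π * P * ‖rho D y s τ‖ ≤ M ^ 2 * ‖rho D y s τ‖ := mul_le_mul_of_nonneg_right (tP.trans M2) a1
    have b3 : P * ‖ell D s τ‖ ≤ M ^ 2 * ‖ell D s τ‖ := mul_le_mul_of_nonneg_right (PM.trans M2) a3
    have b4 : π * P * P * ‖ell D s τ‖ ≤ M ^ 2 * ‖ell D s τ‖ := by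
      refine mul_le_mul_of_nonneg_right ?_ a3
      nlinarith [mul_le_mul tP PM P0 (by linarith)]
    have c1 : ‖rho D y s τ‖ ≤ M ^ 2 * ‖rho D y s τ‖ := le_mul_of_one_le_left a1 (by nlinarith)
    have c2 : ‖kap D y s τ‖ ≤ M ^ 2 * ‖kap D y s τ‖ := le_mul_of_one_le_left a2 (by nlinarith)
    have f : ‖W X1 x1 s τ - W X2 x2 s τ‖ ≤ 8 * M ^ 2 * ‖rho D y s τ‖ + 8 * M ^ 2 * ‖kap D y s τ‖ +
      8 * M ^ 2 * ‖ell D s τ‖ := by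
      refine this.trans ?_
      nlinarith
    rw [← ofRealNorm, ← ofRealNorm, ← ofRealNorm, ← ofRealNorm, ← ENNReal.ofReal_mul (by positivity),
      ← ENNReal.ofReal_mul (by positivity), ← ENNReal.ofReal_mul (by positivity),
      ← ENNReal.ofReal_add (by positivity) (by positivity), ← ENNReal.ofReal_add (by positivity) (by positivity)]
    exact ENNReal.ofReal_le_ofReal f
  have q := Q_le3 (f := fun s => W X1 x1 s τ - W X2 x2 s τ) (crho d τ).enorm.measurable
    (ckap d τ).enorm.measurable ENNReal.ofReal_ne_top ENNReal.ofReal_ne_top ENNReal.ofReal_ne_top key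
  refine q.trans ?_
  have r1 := (rho_Q d h0).trans (mw_pi_Q D h)
  have r2 := (kap_Q d h0).trans (mw_pi_Q D h)
  have r3 := ell_Q' d h0
  unfold Q at r1 r2 r3
  refine (add_le_add (add_le_add (mul_le_mul_right (mul_le_mul_right r1 _) _)
    (mul_le_mul_right (mul_le_mul_right r2 _) _)) (mul_le_mul_right (mul_le_mul_right r3 _) _)).trans ?_
  rw [← ENNReal.ofReal_pow (by positivity)]
  have e3 : (3 : ℝ≥0∞) = ENNReal.ofReal 3 := by simp
  simp only [e3, ← mul_assoc]
  simp only [← add_mul]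
  rw [← ENNReal.ofReal_add (by positivity) (by positivity), ← ENNReal.ofReal_add (by positivity) (by positivity),
    ← ENNReal.ofReal_mul (by norm_num)]
  refine mul_le_mul_left (ENNReal.ofReal_le_ofReal ?_) _
  have : M ^ 4 ≤ M ^ 6 := pow_le_pow_right₀ hM (by norm_num)
  nlinarith

lemma ell_x (X x : ℝ → ℂ) (s : ℝ) {τ : ℝ} (h0 : τ ≠ 0) : ell X s τ = x s + τ * kap X x s τ := by
  unfold kap
  have : (τ : ℂ) ≠ 0 := by exact_mod_cast h0
  field_simp
  ring

lemma T3 (c : Sg θ M X x) (hθ : 0 < θ) (hθ1 : θ ≤ 1) {ε : ℝ} (h0 : 0 < ε) (hε : ε ≤ π) :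
    Q (fun s => W X x s ε - W X x s (-ε)) ≤ ENNReal.ofReal (ε ^ (2 * θ)) *
      (48 * En (4 + 2 * θ) X + ENNReal.ofReal (300 * M ^ 4 * (2 * π))) := by
  have hM := c.hM
  have n0 : ε ≠ 0 := h0.ne'
  have m0 : -ε ≠ 0 := by simpa using n0
  have a0 : |ε| ≤ π := by rwa [abs_of_pos h0]
  have a1 : |-ε| ≤ π := by rwa [abs_neg]
  set P := M * ε ^ ((θ - 1) / 2) with hP
  have P2 : ε * P ^ 2 = M ^ 2 * ε ^ θ := by
    rw [hP, mul_pow, ← Real.rpow_natCast (ε ^ ((θ - 1) / 2)), ← Real.rpow_mul h0.le]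
    have : ε ^ θ = ε * ε ^ ((θ - 1) / 2 * (2 : ℕ)) := by
      rw [show θ = 1 + (θ - 1) / 2 * (2 : ℕ) by push_cast; ring, Real.rpow_add h0, Real.rpow_one]
      congr 2
      push_cast; ring
    rw [this]; ring
  have key : ∀ s, ‖W X x s ε - W X x s (-ε)‖ₑ ≤ 2 * ‖sig X x s ε - sig X x s (-ε)‖ₑ + 0 * 0 +
      ENNReal.ofReal (10 * M ^ 2 * ε ^ θ) * 1 := fun s => by
    have r1 := c.r s ε n0 a0
    have r2 := c.r s (-ε) m0 a1
    have k1 := c.k s ε n0 a0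
    have k2 := c.k s (-ε) m0 a1
    rw [abs_neg] at r2 k2
    rw [abs_of_pos h0, ← hP] at r1 r2 k1 k2
    have hl : ‖ell X s ε - ell X s (-ε)‖ ≤ |ε| * (2 * P) := by
      rw [ell_x X x s n0, ell_x X x s m0]
      rw [show (x s + (ε : ℂ) * kap X x s ε - (x s + ((-ε : ℝ) : ℂ) * kap X x s (-ε))) =
        (ε : ℂ) * (kap X x s ε + kap X x s (-ε)) by push_cast; ring, norm_mul, Complex.norm_real, Real.norm_eq_abs]
      exact mul_le_mul_of_nonneg_left ((norm_add_le _ _).trans (by linarith)) (abs_nonneg _)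
    have := Wc_pm (t := ε) (c.n.one_le (s := s) n0 a0) (c.n.one_le (s := s) m0 a1) r1 r2 (k1 := kap X x s ε) k2 hl
    rw [abs_of_pos h0, mul_assoc 10, P2] at this
    have f : ‖W X x s ε - W X x s (-ε)‖ ≤ 2 * ‖sig X x s ε - sig X x s (-ε)‖ + 10 * M ^ 2 * ε ^ θ := by
      refine this.trans (le_of_eq ?_)
      unfold sig
      ring
    rw [← ofRealNorm, ← ofRealNorm, zero_mul, add_zero, mul_one, ← ENNReal.ofReal_ofNat 2, ← ENNReal.ofReal_mul (by norm_num),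
      ← ENNReal.ofReal_add (by positivity) (by positivity)]
    exact ENNReal.ofReal_le_ofReal f
  have q := Q_le3 (f := fun s => W X x s ε - W X x s (-ε)) (((csig c.n.pc ε).sub (csig c.n.pc (-ε))).enorm.measurable)
    (B := fun _ => 0) measurable_const (by simp) (by simp) ENNReal.ofReal_ne_top (C := fun _ => 1) key
  refine q.trans ?_
  have r := sig_pm_Q c.n.pc hθ hθ1 h0
  unfold Q at r
  have vol : (∫⁻ _ : ℝ, (1 : ℝ≥0∞) ^ 2 ∂mu) = ENNReal.ofReal (2 * π) := by
    simp only [one_pow, lintegral_const, Measure.restrict_apply MeasurableSet.univ, Set.univ_inter, one_mul,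
      Real.volume_Ioc]
    ring_nf
  rw [vol]
  have rs : ∑' k, ‖fc X k‖ₑ ^ 2 * ENNReal.ofReal ((2 * ε ^ θ * |(k:ℝ)| ^ (2 + θ)) ^ 2) =
      ENNReal.ofReal (4 * ε ^ (2 * θ)) * En (4 + 2 * θ) X := by
    unfold En
    rw [← ENNReal.tsum_mul_left]
    refine tsum_congr fun k => ?_
    unfold wt
    rw [mul_left_comm, ← ENNReal.ofReal_mul (by positivity)]
    congr 2
    rw [mul_pow, mul_pow, ← Real.rpow_natCast (ε ^ θ), ← Real.rpow_natCast (|(k:ℝ)| ^ (2 + θ)),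
      ← Real.rpow_mul h0.le, ← Real.rpow_mul (abs_nonneg _)]
    push_cast
    rw [show θ * 2 = 2 * θ by ring, show (2 + θ) * 2 = 4 + 2 * θ by ring]
    norm_num
  rw [rs] at r
  refine (add_le_add (add_le_add (mul_le_mul_right (mul_le_mul_right r _) _) le_rfl) le_rfl).trans ?_
  simp only [mul_add]
  have e2 : ε ^ (2 * θ) = (ε ^ θ) ^ 2 := by
    rw [← Real.rpow_natCast (ε ^ θ), ← Real.rpow_mul h0.le]; push_cast; ring_nf
  refine add_le_add ?_ ?_
  · simp only [ne_eq, OfNat.ofNat_ne_zero, not_false_eq_true, zero_pow, zero_mul, mul_zero, add_zero]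
    rw [ENNReal.ofReal_mul (by norm_num)]
    refine le_of_eq ?_
    simp only [ENNReal.ofReal_ofNat]
    ring
  · rw [← ENNReal.ofReal_pow (by positivity), ← ENNReal.ofReal_mul (by positivity), ← ENNReal.ofReal_mul (by positivity),
      ← ENNReal.ofReal_ofNat 3, ← ENNReal.ofReal_mul (by norm_num), e2]
    refine le_of_eq ?_
    congr 1
    ring

lemma Q_add {f g : ℝ → ℂ} (hf : Continuous f) : Q (fun s => f s + g s) ≤ 2 * Q f + 2 * Q g := by
  unfold Q
  rw [← lintegral_const_mul _ (hf.enorm.measurable.pow_const 2), ← lintegral_const_mul' _ _ (by simp),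
    ← lintegral_add_left ((hf.enorm.measurable.pow_const 2).const_mul 2)]
  refine lintegral_mono fun s => ?_
  have h1 : ‖f s + g s‖ₑ ≤ ‖f s‖ₑ + ‖g s‖ₑ := enorm_add_le _ _
  refine (pow_le_pow_left' h1 2).trans ?_
  have h2 : (‖f s‖₊ + ‖g s‖₊) ^ 2 ≤ 2 * ‖f s‖₊ ^ 2 + 2 * ‖g s‖₊ ^ 2 := by
    rw [← NNReal.coe_le_coe]
    push_cast
    nlinarith [sq_nonneg (‖f s‖ - ‖g s‖)]
  simp only [enorm_eq_nnnorm]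
  exact_mod_cast h2

lemma Q_neg {g : ℝ → ℂ} : Q (fun s => - g s) = Q g := by
  unfold Q; simp

end

section
variable {θ M : ℝ} {X x X1 x1 X2 x2 : ℝ → ℂ}

lemma contW (h : Nice X x) {t : ℝ} (h0 : t ≠ 0) (ht : |t| ≤ π) : Continuous fun s => W X x s t :=
  (slice_cont' (contOns h).1 h0 ht).add (slice_cont' (contOns h).2.2.1 h0 ht)

lemma weak_II (h : Nice X x) {ε : ℝ} (h0 : 0 < ε) (hε : ε ≤ π) (k : ℤ) :
    Complex.I * k * fc (II ε (F0 X x)) k =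
      fc (fun s => II ε (rr X x) s + ((W X x s π - W X x s (-π)) - (W X x s ε - W X x s (-ε)))) k := by
  have cF := (contOns h).1
  have cR := (contOns h).2.1
  have a0 : |ε| ≤ π := by rwa [abs_of_pos h0]
  have a1 : |-ε| ≤ π := by rwa [abs_neg]
  have p0 : |π| ≤ π := by rw [abs_of_pos Real.pi_pos]
  have p1 : |-π| ≤ π := by rwa [abs_neg]
  have w1 := contW h h0.ne' a0
  have w2 := contW h (neg_ne_zero.2 h0.ne') a1
  have w3 := contW h Real.pi_pos.ne' p0
  have w4 := contW h (neg_ne_zero.2 Real.pi_pos.ne') p1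
  have e1 : Continuous fun s => ∫ t in ε..π, F0 X x s t :=
    cont_param hε (cF.mono (reg_sub (sub1' h0)))
  have e2 : Continuous fun s => ∫ t in (-π)..(-ε), F0 X x s t :=
    cont_param (by linarith) (cF.mono (reg_sub (sub2 h0)))
  have r1 : Continuous fun s => ∫ t in ε..π, rr X x s t :=
    cont_param hε (cR.mono (reg_sub (sub1' h0)))
  have r2 : Continuous fun s => ∫ t in (-π)..(-ε), rr X x s t :=
    cont_param (by linarith) (cR.mono (reg_sub (sub2 h0)))
  have : II ε (F0 X x) = fun s => (∫ t in ε..π, F0 X x s t) + ∫ t in (-π)..(-ε), F0 X x s t := rfl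
  rw [this, fc_add e1 e2, mul_add, weak_F0 h hε (sub1' h0), weak_F0 h (by linarith) (sub2 h0),
    ← fc_add (f := fun s => (∫ t in ε..π, rr X x s t) + (W X x s π - W X x s ε))
      (g := fun s => (∫ t in (-π)..(-ε), rr X x s t) + (W X x s (-ε) - W X x s (-π)))
      (r1.add (w3.sub w1)) (r2.add (w2.sub w4))]
  congr 1
  funext s
  unfold II
  ring

lemma core {A T : ℝ≥0∞} (c : Ctx θ M X1 x1 X2 x2) (hθ : 0 < θ) (hθ1 : θ ≤ 1)
    (f1 : En (4 + 2 * θ) X1 ≠ ∞) (f2 : En (4 + 2 * θ) X2 ≠ ∞)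
    (hA : ∀ ε, 0 < ε → ε ≤ π → Q (II ε fun s t => rr X1 x1 s t - rr X2 x2 s t) ≤ A)
    (hT : ∀ τ, |τ| = π → Q (fun s => W X1 x1 s τ - W X2 x2 s τ) ≤ T) :
    ∑' k, ‖fc (g0 X1 x1) k - fc (g0 X2 x2) k‖ₑ ^ 2 * wt 2 k ≤ ENNReal.ofReal (2 * π) * (2 * A + 12 * T) := by
  have p0 : |π| = π := by rw [abs_of_pos Real.pi_pos]
  have p1 : |-π| = π := by rwa [abs_neg]
  have pn : π ≠ 0 := Real.pi_pos.ne'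
  have pm : -π ≠ 0 := neg_ne_zero.2 pn
  set S1 := (48 * En (4 + 2 * θ) X1 + ENNReal.ofReal (300 * M ^ 4 * (2 * π))) with hS1
  set S2 := (48 * En (4 + 2 * θ) X2 + ENNReal.ofReal (300 * M ^ 4 * (2 * π))) with hS2
  have fS1 : S1 ≠ ∞ := ENNReal.add_ne_top.2 ⟨ENNReal.mul_ne_top (by simp) f1, ENNReal.ofReal_ne_top⟩
  have fS2 : S2 ≠ ∞ := ENNReal.add_ne_top.2 ⟨ENNReal.mul_ne_top (by simp) f2, ENNReal.ofReal_ne_top⟩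
  have step : ∀ ε, 0 < ε → ε ≤ π →
      ∑' k, ‖fc (II ε (F0 X1 x1)) k - fc (II ε (F0 X2 x2)) k‖ₑ ^ 2 * wt 2 k ≤
        ENNReal.ofReal (2 * π) * (2 * A + 12 * T + ENNReal.ofReal (ε ^ (2 * θ)) * (16 * (S1 + S2))) := fun ε h0 hε => by
    have a0 : |ε| ≤ π := by rwa [abs_of_pos h0]
    have a1 : |-ε| ≤ π := by rwa [abs_neg]
    have cw : ∀ {X x : ℝ → ℂ}, Nice X x → Continuous (fun s => (W X x s π - W X x s (-π)) - (W X x s ε - W X x s (-ε))) :=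
      fun h => ((contW h pn p0.le).sub (contW h pm p1.le)).sub
        ((contW h h0.ne' a0).sub (contW h (neg_ne_zero.2 h0.ne') a1))
    have cr1 := II_cont h0 hε (contOns c.n1).2.1
    have cr2 := II_cont h0 hε (contOns c.n2).2.1
    set hh : ℝ → ℂ := fun s => II ε (fun s t => rr X1 x1 s t - rr X2 x2 s t) s +
      ((W X1 x1 s π - W X2 x2 s π) + (-(W X1 x1 s (-π) - W X2 x2 s (-π)) +
        (-(W X1 x1 s ε - W X1 x1 s (-ε)) + (W X2 x2 s ε - W X2 x2 s (-ε))))) with hhh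
    have eh : hh = fun s => (II ε (rr X1 x1) s + ((W X1 x1 s π - W X1 x1 s (-π)) - (W X1 x1 s ε - W X1 x1 s (-ε)))) -
        (II ε (rr X2 x2) s + ((W X2 x2 s π - W X2 x2 s (-π)) - (W X2 x2 s ε - W X2 x2 s (-ε)))) := by
      funext s
      rw [hhh]
      simp only
      rw [II_sub h0 hε (contOns c.n1).2.1 (contOns c.n2).2.1]
      ring
    have ch : Continuous hh := by
      rw [eh]
      exact (cr1.add (cw c.n1)).sub (cr2.add (cw c.n2))
    have fh : ∀ k : ℤ, fc hh k = Complex.I * k * (fc (II ε (F0 X1 x1)) k - fc (II ε (F0 X2 x2)) k) := fun k => by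
      rw [eh, fc_sub (f := fun s => II ε (rr X1 x1) s + ((W X1 x1 s π - W X1 x1 s (-π)) - (W X1 x1 s ε - W X1 x1 s (-ε))))
        (g := fun s => II ε (rr X2 x2) s + ((W X2 x2 s π - W X2 x2 s (-π)) - (W X2 x2 s ε - W X2 x2 s (-ε))))
        (cr1.add (cw c.n1)) (cr2.add (cw c.n2)), mul_sub, weak_II c.n1 h0 hε, weak_II c.n2 h0 hε]
    have qh := Q_fc ch
    have qb : Q hh ≤ 2 * A + 12 * T + ENNReal.ofReal (ε ^ (2 * θ)) * (16 * (S1 + S2)) := by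
      have t1 := T3 c.s1 hθ hθ1 h0 hε
      have t2 := T3 c.s2 hθ hθ1 h0 hε
      have c1 : Continuous (fun s => -(W X1 x1 s ε - W X1 x1 s (-ε))) :=
        ((contW c.n1 h0.ne' a0).sub (contW c.n1 (neg_ne_zero.2 h0.ne') a1)).neg
      have c2 : Continuous (fun s => -(W X1 x1 s (-π) - W X2 x2 s (-π))) :=
        ((contW c.n1 pm p1.le).sub (contW c.n2 pm p1.le)).neg
      have c3 : Continuous (fun s => (W X1 x1 s π - W X2 x2 s π)) :=
        ((contW c.n1 pn p0.le).sub (contW c.n2 pn p0.le))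
      have c4 : Continuous (II ε (fun s t => rr X1 x1 s t - rr X2 x2 s t)) := by
        have : (II ε (fun s t => rr X1 x1 s t - rr X2 x2 s t)) = fun s => II ε (rr X1 x1) s - II ε (rr X2 x2) s :=
          funext fun s => II_sub h0 hε (contOns c.n1).2.1 (contOns c.n2).2.1 s
        rw [this]
        exact cr1.sub cr2
      have q1 := (Q_add (g := fun s => W X2 x2 s ε - W X2 x2 s (-ε)) c1).trans
        (add_le_add (mul_le_mul_right (Q_neg.le.trans t1) _) (mul_le_mul_right t2 _))
      have q2 := (Q_add (g := fun s => -(W X1 x1 s ε - W X1 x1 s (-ε)) + (W X2 x2 s ε - W X2 x2 s (-ε))) c2).trans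
        (add_le_add (mul_le_mul_right (Q_neg.le.trans (hT (-π) p1)) _) (mul_le_mul_right q1 _))
      have q3 := (Q_add (g := fun s => -(W X1 x1 s (-π) - W X2 x2 s (-π)) +
        (-(W X1 x1 s ε - W X1 x1 s (-ε)) + (W X2 x2 s ε - W X2 x2 s (-ε)))) c3).trans
        (add_le_add (mul_le_mul_right (hT π p0) _) (mul_le_mul_right q2 _))
      have q4 := (Q_add (g := fun s => (W X1 x1 s π - W X2 x2 s π) + (-(W X1 x1 s (-π) - W X2 x2 s (-π)) +
        (-(W X1 x1 s ε - W X1 x1 s (-ε)) + (W X2 x2 s ε - W X2 x2 s (-ε))))) c4).trans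
        (add_le_add (mul_le_mul_right (hA ε h0 hε) _) (mul_le_mul_right q3 _))
      refine q4.trans (le_of_eq ?_)
      ring
    rw [qh] at qb
    have e : ∑' k, ‖fc (II ε (F0 X1 x1)) k - fc (II ε (F0 X2 x2)) k‖ₑ ^ 2 * wt 2 k = ∑' k, ‖fc hh k‖ₑ ^ 2 := by
      refine tsum_congr fun k => ?_
      rw [fh, enorm_mul, mul_pow, mul_comm]
      congr 1
      rw [← ofRealNorm, ← ENNReal.ofReal_pow (norm_nonneg _)]
      unfold wt
      simp
    rw [e]
    refine le_trans (le_of_eq ?_) (mul_le_mul_right qb _)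
    rw [← mul_assoc, ← ENNReal.ofReal_mul (by positivity), mul_inv_cancel₀ (by positivity), ENNReal.ofReal_one, one_mul]
  rw [ENNReal.tsum_eq_iSup_sum]
  refine iSup_le fun F => ?_
  have l1 : Tendsto (fun ε => ∑ k ∈ F, ‖fc (II ε (F0 X1 x1)) k - fc (II ε (F0 X2 x2)) k‖ₑ ^ 2 * wt 2 k) (𝓝[>] 0)
      (𝓝 (∑ k ∈ F, ‖fc (g0 X1 x1) k - fc (g0 X2 x2) k‖ₑ ^ 2 * wt 2 k)) := by
    refine tendsto_finsetSum _ fun k _ => ?_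
    refine ENNReal.Tendsto.mul_const ?_ (Or.inr ENNReal.ofReal_ne_top)
    have := ((c.s1.fc_lim hθ k).sub (c.s2.fc_lim hθ k)).enorm
    exact ENNReal.Tendsto.pow this
  have l2 : Tendsto (fun ε : ℝ => ENNReal.ofReal (2 * π) * (2 * A + 12 * T + ENNReal.ofReal (ε ^ (2 * θ)) * (16 * (S1 + S2))))
      (𝓝[>] 0) (𝓝 (ENNReal.ofReal (2 * π) * (2 * A + 12 * T))) := by
    have r : Tendsto (fun ε : ℝ => ENNReal.ofReal (ε ^ (2 * θ))) (𝓝[>] 0) (𝓝 0) := by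
      have : Tendsto (fun ε : ℝ => ε ^ (2 * θ)) (𝓝[>] 0) (𝓝 0) := by
        have := (Real.continuousAt_rpow_const 0 (2 * θ) (Or.inr (by linarith))).tendsto
        rw [Real.zero_rpow (by linarith)] at this
        exact this.mono_left nhdsWithin_le_nhds
      simpa using ENNReal.tendsto_ofReal this
    have fin : (16 * (S1 + S2)) ≠ ∞ := ENNReal.mul_ne_top (by simp) (ENNReal.add_ne_top.2 ⟨fS1, fS2⟩)
    have := ENNReal.Tendsto.mul_const (b := 16 * (S1 + S2)) r (Or.inr fin)
    rw [zero_mul] at this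
    have := (tendsto_const_nhds (x := 2 * A + 12 * T)).add this
    rw [add_zero] at this
    exact ENNReal.Tendsto.const_mul this (Or.inr ENNReal.ofReal_ne_top)
  refine le_of_tendsto_of_tendsto l1 l2 ?_
  filter_upwards [eps_ev] with ε h
  exact (ENNReal.sum_le_tsum F).trans (step ε h.1 h.2)

end

/-- The estimate for the main part of the remainder, in the complex normalised setting. -/
def Core (θ e : ℝ) : Prop := ∃ C : ℝ, 0 < C ∧ ∀ (X1 x1 X2 x2 : ℝ → ℂ) (N : ℝ), Nice X1 x1 → Nice X2 x2 → 0 ≤ N →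
  ∑' (k : ℤ), aa X1 X2 k ^ 2 * wt (4 + 2 * θ) k ≤ ENNReal.ofReal (N ^ 2) →
  (Continuous (g0 X1 x1) ∧ Continuous (g0 X2 x2) ∧ (∀ s, IntervalIntegrable (F0 X1 x1 s) volume (-π) π) ∧
    (∀ s, IntervalIntegrable (F0 X2 x2 s) volume (-π) π)) ∧ 1 ≤ C * N ^ 6 ∧
  ∑' k, ‖fc (g0 X1 x1) k - fc (g0 X2 x2) k‖ₑ ^ 2 * wt 2 k ≤ ENNReal.ofReal (C * N ^ 6) * En e (fun s => X1 s - X2 s)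

lemma core_gen {θ e : ℝ} (hθ : 0 < θ) (hθ1 : θ < 1) (he : 2 ≤ e)
    (H : ∃ C K : ℝ, 0 < C ∧ 0 < K ∧ ∀ (X1 x1 X2 x2 : ℝ → ℂ) (M N : ℝ), Ctx θ M X1 x1 X2 x2 → 0 ≤ N → K * N ≤ M →
      ∑' (k : ℤ), aa X1 X2 k ^ 2 * wt (4 + 2 * θ) k ≤ ENNReal.ofReal (N ^ 2) → ∀ ε : ℝ, 0 < ε → ε ≤ π →
      Q (II ε fun s t => rr X1 x1 s t - rr X2 x2 s t) ≤ ENNReal.ofReal (C * M ^ 6) * En e fun s => X1 s - X2 s) :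
    Core θ e := by
  obtain ⟨C, K, C0, K0, H⟩ := H
  obtain ⟨L, L0, B⟩ := base hθ hθ1
  set R := max K L with hR
  have R0 : 0 < R := lt_max_of_lt_left K0
  refine ⟨(2 * π * (2 * C + 12 * 576) + 1) * R ^ 6, by positivity, fun X1 x1 X2 x2 N n1 n2 hN h => ?_⟩
  have c := B X1 x1 X2 x2 N n1 n2 hN h (R * N) (mul_le_mul_of_nonneg_right (le_max_right _ _) hN)
  have hM := c.hM
  have hA := H X1 x1 X2 x2 (R * N) N c hN (mul_le_mul_of_nonneg_right (le_max_left _ _) hN) h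
  have M6 : 1 ≤ (R * N) ^ 6 := one_le_pow₀ hM
  refine ⟨⟨c.s1.contg hθ, c.s2.contg hθ, c.s1.int hθ, c.s2.int hθ⟩, ?_, ?_⟩
  · rw [mul_assoc, ← mul_pow]
    have : 1 ≤ (2 * π * (2 * C + 12 * 576) + 1) := by
      have : 0 < 2 * π * (2 * C + 12 * 576) := by positivity
      linarith
    nlinarith
  have f1 : En (4 + 2 * θ) X1 ≠ ∞ := by
    refine ne_top_of_le_ne_top ENNReal.ofReal_ne_top (le_trans ?_ h)
    exact ENNReal.tsum_le_tsum fun k => mul_le_mul_left (pow_le_pow_left' (le_self_add) 2) _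
  have f2 : En (4 + 2 * θ) X2 ≠ ∞ := by
    refine ne_top_of_le_ne_top ENNReal.ofReal_ne_top (le_trans ?_ h)
    exact ENNReal.tsum_le_tsum fun k => mul_le_mul_left (pow_le_pow_left' (le_add_self) 2) _
  have em := En_mono (by norm_num) he (fun s => X1 s - X2 s)
  refine (core c hθ hθ1.le f1 f2 hA (fun τ hτ => (T2 c hτ).trans (mul_le_mul_right em _))).trans ?_
  simp only [← mul_assoc]
  rw [← add_mul, ← mul_assoc]
  refine mul_le_mul_left ?_ _
  rw [← ENNReal.ofReal_ofNat 2, ← ENNReal.ofReal_ofNat 12, ← ENNReal.ofReal_mul (by norm_num),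
    ← ENNReal.ofReal_mul (by norm_num), ← ENNReal.ofReal_add (by positivity) (by positivity),
    ← ENNReal.ofReal_mul (by positivity)]
  refine ENNReal.ofReal_le_ofReal ?_
  rw [mul_assoc _ (R ^ 6), ← mul_pow]
  nlinarith

lemma core_A {θ : ℝ} (hθ : 0 < θ) (hθ1 : θ < 1 / 2) : Core θ (3 - 2 * θ) := by
  obtain ⟨C, C0, H⟩ := T1A hθ hθ1
  exact core_gen hθ (by linarith) (by linarith) ⟨C, 1, C0, one_pos, fun X1 x1 X2 x2 M N c h h' => H X1 x1 X2 x2 M N c h (by linarith)⟩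

lemma core_B {θ : ℝ} (hθ : 1 / 2 < θ) (hθ1 : θ < 1) : Core θ 2 :=
  core_gen (by linarith) hθ1 le_rfl (T1B hθ hθ1)

/-- The (bounded) kernel of the lower order linear term. -/
def dd (τ : ℝ) : ℝ := (1 / τ - τ / (4 * Real.sin (τ / 2) ^ 2)) / τ

lemma dd_neg (τ : ℝ) : dd (-τ) = dd τ := by
  unfold dd
  rw [show -τ / 2 = -(τ / 2) by ring, Real.sin_neg, neg_sq, one_div_neg_eq_neg_one_div,
    show -τ / (4 * Real.sin (τ / 2) ^ 2) = -(τ / (4 * Real.sin (τ / 2) ^ 2)) by ring, ← neg_sub', neg_div_neg_eq]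

lemma dd_pos_bd {τ : ℝ} (h0 : 0 < τ) (h : τ ≤ π) : |dd τ| ≤ 1 := by
  obtain ⟨y, rfl⟩ : ∃ y, τ = 2 * y := ⟨τ / 2, by ring⟩
  have y0 : 0 < y := by linarith
  have yp : y ≤ π / 2 := by linarith
  have s1 : 2 / π * y ≤ Real.sin y := Real.mul_le_sin y0.le yp
  have s2 : Real.sin y < y := Real.sin_lt y0
  have s0 : 0 < Real.sin y := lt_of_lt_of_le (by positivity) s1
  have e : dd (2 * y) = -((y ^ 2 - Real.sin y ^ 2) / (4 * y ^ 2 * Real.sin y ^ 2)) := by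
    unfold dd
    rw [show 2 * y / 2 = y by ring]
    field_simp
    ring
  rw [e, abs_neg, abs_of_nonneg (div_nonneg (by nlinarith) (by positivity)), div_le_one (by positivity)]
  have a : y / 2 ≤ Real.sin y := by
    refine le_trans ?_ s1
    rw [div_mul_eq_mul_div, le_div_iff₀ Real.pi_pos]
    nlinarith [Real.pi_le_four]
  have b : y ^ 4 ≤ 4 * y ^ 2 * Real.sin y ^ 2 := by
    have : (y / 2) ^ 2 ≤ Real.sin y ^ 2 := pow_le_pow_left₀ (by linarith) a 2
    nlinarith [sq_nonneg y]
  refine le_trans ?_ b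
  have := Real.sin_gt_sub_cube y0
  have c : (y - Real.sin y) * (y + Real.sin y) ≤ (y ^ 3 / 6) * (2 * y) :=
    mul_le_mul (by linarith) (by linarith) (by linarith) (by positivity)
  nlinarith [pow_pos y0 4]

lemma dd_bd {τ : ℝ} (h : |τ| ≤ π) : |dd τ| ≤ 1 := by
  rcases lt_trichotomy τ 0 with h0 | h0 | h0
  · rw [← dd_neg]
    exact dd_pos_bd (by linarith) (by rwa [abs_of_neg h0] at h)
  · subst h0; simp [dd]
  · exact dd_pos_bd h0 (by rwa [abs_of_pos h0] at h)

lemma dd_meas : Measurable dd := by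
  unfold dd
  fun_prop

def gc (X : ℝ → ℂ) (s : ℝ) : ℂ := ∫ τ in (-π)..π, (dd τ : ℂ) * (X (s + τ) - X s)

lemma per_bdd {X : ℝ → ℂ} (hp : Function.Periodic X (2 * π)) (hc : Continuous X) : ∃ B : ℝ, ∀ s, ‖X s‖ ≤ B := by
  obtain ⟨B, hB⟩ := (hp.isBounded_of_continuous (by positivity) hc).exists_norm_le
  exact ⟨B, fun s => hB _ ⟨s, rfl⟩⟩

lemma gc_int {X : ℝ → ℂ} (hc : Continuous X) (s : ℝ) :
    IntervalIntegrable (fun τ => (dd τ : ℂ) * (X (s + τ) - X s)) volume (-π) π := by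
  have c : Continuous fun τ => X (s + τ) - X s := by fun_prop
  have i : IntervalIntegrable (fun τ => X (s + τ) - X s) volume (-π) π := c.intervalIntegrable _ _
  refine i.mono_fun ?_ ?_
  · exact ((Complex.measurable_ofReal.comp dd_meas).aestronglyMeasurable).mul c.aestronglyMeasurable
  · rw [Set.uIoc_of_le negpi_lt_pi.le]
    filter_upwards [ae_restrict_mem measurableSet_Ioc] with t ht
    rw [norm_mul, Complex.norm_real, Real.norm_eq_abs]
    exact mul_le_of_le_one_left (norm_nonneg _) (dd_bd (abs_le.2 ⟨ht.1.le, ht.2⟩))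

lemma gc_cont {X : ℝ → ℂ} (hp : Function.Periodic X (2 * π)) (hc : Continuous X) : Continuous (gc X) := by
  obtain ⟨B, hB⟩ := per_bdd hp hc
  unfold gc
  refine intervalIntegral.continuous_of_dominated_interval (bound := fun _ => 2 * B) ?_ ?_ ?_ ?_
  · intro s
    have c : Continuous fun τ => X (s + τ) - X s := by fun_prop
    exact ((Complex.measurable_ofReal.comp dd_meas).aestronglyMeasurable).mul c.aestronglyMeasurable
  · intro s
    refine Eventually.of_forall fun t ht => ?_
    rw [Set.uIoc_of_le negpi_lt_pi.le] at ht
    rw [norm_mul, Complex.norm_real, Real.norm_eq_abs]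
    refine (mul_le_of_le_one_left (norm_nonneg _) (dd_bd (abs_le.2 ⟨ht.1.le, ht.2⟩))).trans ?_
    refine (norm_sub_le _ _).trans ?_
    linarith [hB s, hB (s + t)]
  · simp
  · refine Eventually.of_forall fun t ht => ?_
    fun_prop

lemma gc_sub {X1 X2 : ℝ → ℂ} (h1 : Continuous X1) (h2 : Continuous X2) (s : ℝ) :
    gc X1 s - gc X2 s = gc (fun s => X1 s - X2 s) s := by
  unfold gc
  rw [← intervalIntegral.integral_sub (gc_int h1 s) (gc_int h2 s)]
  congr 1
  funext t
  ring

lemma fc_gc {X x : ℝ → ℂ} (h : PC X x) (k : ℤ) :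
    fc (gc X) k = (∫ τ in (-π)..π, (dd τ : ℂ) * (Complex.exp (Complex.I * ((k * τ : ℝ) : ℂ)) - 1)) * fc X k := by
  have hc := h.contX
  obtain ⟨B, hB⟩ := per_bdd h.per hc
  have pw : ∀ τ : ℝ, ∫ s in (-π)..π, (dd τ : ℂ) * (X (s + τ) - X s) * Complex.exp (-Complex.I * k * s) =
      (dd τ : ℂ) * (Complex.exp (Complex.I * ((k * τ : ℝ) : ℂ)) - 1) * fc X k := fun τ => by
    have e := fc_const_mul (dd τ : ℂ) (fun s => X (s + τ) - X s) k
    have e1 : fc (fun s => X (s + τ) - X s) k = (Complex.exp (Complex.I * ((k * τ : ℝ) : ℂ)) - 1) * fc X k := by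
      by_cases h0 : τ = 0
      · subst h0; simp [fc]
      · have := fc_ell h τ k
        unfold ell at this
        have t0 : (τ : ℂ) ≠ 0 := by exact_mod_cast h0
        rw [fc_div, div_mul_eq_mul_div, div_left_inj' t0] at this
        exact this
    rw [e1] at e
    unfold fc at e ⊢
    rw [e]; ring
  rw [← intervalIntegral.integral_mul_const]
  simp only [← pw]
  unfold fc gc
  simp only [← intervalIntegral.integral_mul_const]
  simp only [intervalIntegral.integral_of_le negpi_lt_pi.le]
  refine integral_integral_swap ?_
  have fm : IsFiniteMeasure (mu.prod mu) := by infer_instance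
  refine Integrable.of_bound (C := 2 * B) ?_ ?_
  · refine Measurable.aestronglyMeasurable ?_
    have : Continuous fun p : ℝ × ℝ => (X (p.1 + p.2) - X p.1) := by fun_prop
    have h2 : Continuous fun p : ℝ × ℝ => Complex.exp (-Complex.I * k * p.1) := by fun_prop
    exact (((Complex.measurable_ofReal.comp (dd_meas.comp measurable_snd))).mul this.measurable).mul h2.measurable
  · have hm : ∀ᵐ p ∂(mu.prod mu), p ∈ (Set.Ioc (-π) π) ×ˢ (Set.Ioc (-π) π) := by
      rw [Measure.prod_restrict]
      exact ae_restrict_mem (measurableSet_Ioc.prod measurableSet_Ioc)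
    filter_upwards [hm] with p hp
    obtain ⟨-, ht⟩ := hp
    simp only [Function.uncurry]
    have : ‖Complex.exp (-Complex.I * k * p.1)‖ = 1 := by rw [Complex.norm_exp]; simp
    rw [norm_mul, this, mul_one, norm_mul, Complex.norm_real, Real.norm_eq_abs]
    refine (mul_le_of_le_one_left (norm_nonneg _) (dd_bd (abs_le.2 ⟨ht.1.le, ht.2⟩))).trans ?_
    refine (norm_sub_le _ _).trans ?_
    linarith [hB p.1, hB (p.1 + p.2)]

lemma fc_gc_bd {X x : ℝ → ℂ} (h : PC X x) (k : ℤ) : ‖fc (gc X) k‖ ≤ 4 * π * ‖fc X k‖ := by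
  rw [fc_gc h, norm_mul]
  refine mul_le_mul_of_nonneg_right ?_ (norm_nonneg _)
  have := intervalIntegral.norm_integral_le_of_norm_le_const (a := -π) (b := π) (C := 2)
    (f := fun τ : ℝ => (dd τ : ℂ) * (Complex.exp (Complex.I * ((k * τ : ℝ) : ℂ)) - 1)) (fun t ht => by
      rw [Set.uIoc_of_le negpi_lt_pi.le] at ht
      rw [norm_mul, Complex.norm_real, Real.norm_eq_abs]
      exact (mul_le_of_le_one_left (norm_nonneg _) (dd_bd (abs_le.2 ⟨ht.1.le, ht.2⟩))).trans (eI_sub2 _))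
  refine this.trans_eq ?_
  rw [show π - -π = 2 * π by ring, abs_of_pos (by positivity)]
  ring

/-- Algebraic identity: the kernel of the remainder in complex form. -/
lemma alg_id {l r : ℂ} {lam t : ℝ} (hl : l ≠ 0) (h : lam ≠ 0) (ht : t ≠ 0) :
    (((-‖(lam : ℂ) * (l + t * r)‖ ^ 2 / ‖(lam : ℂ) * l‖ ^ 2 +
      2 * (⟪(lam : ℂ) * l, (lam : ℂ) * (l + t * r)⟫) ^ 2 / ‖(lam : ℂ) * l‖ ^ 4 - 1) / t : ℝ) : ℂ) * (lam * l) =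
      lam * F0c l r t := by
  have nsq : ∀ z : ℂ, ((‖z‖ : ℝ) : ℂ) ^ 2 = z * conj z := fun z => by
    rw [Complex.mul_conj, Complex.normSq_eq_norm_sq]; push_cast; rfl
  have inn : ∀ z w : ℂ, ((⟪z, w⟫ : ℝ) : ℂ) = (z * conj w + conj z * w) / 2 := fun z w => by
    rw [Complex.inner]
    apply Complex.ext <;> simp <;> ring
  have n4 : ∀ z : ℂ, ((‖z‖ : ℝ) : ℂ) ^ 4 = (z * conj z) ^ 2 := fun z => by rw [← nsq]; ring
  push_cast
  simp only [nsq, inn, n4, map_mul, map_add, Complex.conj_ofReal]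
  have hl' : conj l ≠ 0 := by simpa using hl
  have h' : (lam : ℂ) ≠ 0 := by exact_mod_cast h
  have t' : (t : ℂ) ≠ 0 := by exact_mod_cast ht
  unfold F0c
  generalize conj l = m at *
  generalize conj r = q at *
  field_simp
  ring

/-- Identification of the plane with the complex numbers. -/
def ph : E2 ≃ₗᵢ[ℝ] ℂ := Complex.orthonormalBasisOneI.repr.symm

lemma ph_apply (v : E2) : ph v = (v 0 : ℂ) + Complex.I * (v 1 : ℂ) := by
  have h : v = ph.symm ((v 0 : ℂ) + Complex.I * (v 1 : ℂ)) := by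
    ext j
    unfold ph
    fin_cases j <;> simp [Complex.orthonormalBasisOneI]
  conv_lhs => rw [h]
  simp

lemma fc_comp {u : ℝ → ℝ} (k : ℤ) : fc (fun s => (u s : ℂ)) (-k) = conj (fc (fun s => (u s : ℂ)) k) := by
  unfold fc
  simp only [intervalIntegral, ← integral_conj, map_sub]
  congr 2 <;>
  · congr 1
    funext s
    rw [map_mul, Complex.conj_ofReal, ← Complex.exp_conj]
    congr 2
    simp

lemma coef_eq {g : ℝ → E2} (hg : Continuous g) (k : ℤ) :
    ‖fc (fun s => ph (g s)) k‖ ^ 2 + ‖fc (fun s => ph (g s)) (-k)‖ ^ 2 = 2 * coefSq g k := by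
  have c0 : Continuous fun s => (g s 0 : ℂ) := by fun_prop
  have c1 : Continuous fun s => Complex.I * (g s 1 : ℂ) := by fun_prop
  have e : ∀ k, fc (fun s => ph (g s)) k = fc (fun s => (g s 0 : ℂ)) k + Complex.I * fc (fun s => (g s 1 : ℂ)) k :=
    fun k => by
      simp only [ph_apply]
      rw [fc_add c0 c1, fc_const_mul]
  rw [e, e, fc_comp (u := fun s => g s 0), fc_comp (u := fun s => g s 1)]
  have : coefSq g k = Complex.normSq (fc (fun s => (g s 0 : ℂ)) k) + Complex.normSq (fc (fun s => (g s 1 : ℂ)) k) := by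
    unfold coefSq fc
    rw [Fin.sum_univ_two]
  rw [this, ← Complex.normSq_eq_norm_sq, ← Complex.normSq_eq_norm_sq]
  simp only [Complex.normSq_apply]
  simp
  ring

lemma summand_nonneg (σ : ℝ) (g : ℝ → E2) (k : ℤ) : 0 ≤ sobSummand σ g k := by
  unfold sobSummand coefSq
  split_ifs
  · exact le_rfl
  · exact mul_nonneg (Real.rpow_nonneg (by positivity) _) (Finset.sum_nonneg fun j _ => Complex.normSq_nonneg _)

lemma sob_En {g : ℝ → E2} (hg : Continuous g) {σ : ℝ} (hσ : 0 < σ) :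
    En (2 * σ) (fun s => ph (g s)) = ∑' k, ENNReal.ofReal (sobSummand σ g k) := by
  set f : ℤ → ℝ≥0∞ := fun k => ‖fc (fun s => ph (g s)) k‖ₑ ^ 2 * wt (2 * σ) k with hf
  have e1 : En (2 * σ) (fun s => ph (g s)) = ∑' k, f k := rfl
  have e2 : ∑' k, f (-k) = ∑' k, f k := (Equiv.neg ℤ).tsum_eq f
  have e3 : ∀ k, f k + f (-k) = 2 * ENNReal.ofReal (sobSummand σ g k) := fun k => by
    have w : wt (2 * σ) (-k) = wt (2 * σ) k := by unfold wt; simp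
    have c : sobSummand σ g k = |(k : ℝ)| ^ (2 * σ) * coefSq g k := by
      unfold sobSummand
      split_ifs with h
      · subst h; simp [Real.zero_rpow (show 2 * σ ≠ 0 by linarith)]
      · push_cast; rfl
    simp only [hf]
    rw [w, ← add_mul, ← ofRealNorm, ← ofRealNorm, ← ENNReal.ofReal_pow (norm_nonneg _), ← ENNReal.ofReal_pow (norm_nonneg _),
      ← ENNReal.ofReal_add (by positivity) (by positivity), coef_eq hg, c, ← ENNReal.ofReal_ofNat 2]
    unfold wt
    rw [← ENNReal.ofReal_mul' (by positivity), ← ENNReal.ofReal_mul (by norm_num)]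
    congr 1
    ring
  have e4 : 2 * ∑' k, f k = 2 * ∑' k, ENNReal.ofReal (sobSummand σ g k) := by
    rw [← ENNReal.tsum_mul_left (a := 2) (f := fun k => ENNReal.ofReal (sobSummand σ g k))]
    simp only [← e3]
    rw [ENNReal.tsum_add, e2, two_mul]
  rw [e1]
  exact (ENNReal.mul_right_inj (by norm_num) (by norm_num)).1 e4

lemma sob_sq (σ : ℝ) (g : ℝ → E2) : sobNorm σ g ^ 2 = ∑' k, sobSummand σ g k :=
  Real.sq_sqrt (tsum_nonneg fun k => summand_nonneg σ g k)

lemma En_sob {g : ℝ → E2} (hg : Continuous g) {σ : ℝ} (hσ : 0 < σ) (h : Summable (sobSummand σ g)) :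
    En (2 * σ) (fun s => ph (g s)) = ENNReal.ofReal (sobNorm σ g ^ 2) := by
  rw [sob_En hg hσ, sob_sq, ENNReal.ofReal_tsum_of_nonneg (summand_nonneg σ g) h]

lemma sob_summable {g : ℝ → E2} (hg : Continuous g) {σ : ℝ} (hσ : 0 < σ)
    (h : En (2 * σ) (fun s => ph (g s)) ≠ ∞) : Summable (sobSummand σ g) := by
  rw [sob_En hg hσ] at h
  have := ENNReal.summable_toReal h
  refine this.congr fun k => ?_
  rw [ENNReal.toReal_ofReal (summand_nonneg σ g k)]

/-- The remainder in complex form, after scaling. -/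
lemma gY_ph {Y Y' : ℝ → E2} {lam : ℝ} (hl : 0 < lam) {X x : ℝ → ℂ} (hX : ∀ s, ph (Y s) = lam * X s)
    (hx : ∀ s, ph (Y' s) = lam * x s) (n : Nice X x) (hi : ∀ s, IntervalIntegrable (F0 X x s) volume (-π) π) (s : ℝ) :
    ph (gY Y Y' s) = ((4 * π)⁻¹ : ℝ) * (lam * (g0 X x s + gc X s)) := by
  unfold gY
  rw [map_smul, Complex.real_smul]
  congr 1
  have e : ∀ f : ℝ → E2, ph (∫ τ in (-π)..π, f τ) = ∫ τ in (-π)..π, ph (f τ) := fun f => by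
    simp only [intervalIntegral, map_sub]
    congr 1 <;> exact (ph.toContinuousLinearEquiv.integral_comp_comm f).symm
  rw [e]
  unfold g0 gc
  rw [← intervalIntegral.integral_add (hi s) (gc_int n.contX s), ← intervalIntegral.integral_const_mul]
  refine intervalIntegral.integral_congr_ae ?_
  filter_upwards [Measure.ae_ne volume (0:ℝ)] with t ht h
  rw [Set.uIoc_of_le negpi_lt_pi.le] at h
  have tp : |t| ≤ π := abs_le.2 ⟨h.1.le, h.2⟩
  have t' : (t : ℂ) ≠ 0 := by exact_mod_cast ht
  have l' : (lam : ℂ) ≠ 0 := by exact_mod_cast hl.ne'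
  have pL : ph (t⁻¹ • (Y (s + t) - Y s)) = lam * ell X s t := by
    rw [map_smul, map_sub, hX, hX, Complex.real_smul]
    unfold ell
    push_cast
    field_simp
  have pY : ph (Y' (s + t)) = lam * (ell X s t + t * rho X x s t) := by
    rw [hx]
    unfold rho
    field_simp
    ring
  rw [map_smul, ← ph.norm_map (Y' (s + t)), ← ph.norm_map (t⁻¹ • (Y (s + t) - Y s)), ← ph.inner_map_map, pL, pY,
    Complex.real_smul]
  have a := alg_id (l := ell X s t) (r := rho X x s t) (n.ne (s := s) ht tp) hl.ne' ht
  rw [Complex.ofReal_add, add_mul, a, mul_add]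
  congr 1
  unfold dd ell
  push_cast
  field_simp

lemma mkNice {Y Y' : ℝ → E2} {lam : ℝ} (hl : 0 < lam) (hp : Function.Periodic Y (2 * π))
    (hd : ∀ s, HasDerivAt Y (Y' s) s) (hc : Continuous Y')
    (hs : ∀ s₁ s₂ : ℝ, |s₁ - s₂| ≤ π → lam * |s₁ - s₂| ≤ ‖Y s₁ - Y s₂‖) :
    Nice (fun s => ((lam⁻¹ : ℝ) : ℂ) * ph (Y s)) (fun s => ((lam⁻¹ : ℝ) : ℂ) * ph (Y' s)) where
  per := fun s => by simp only [hp s]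
  der := fun s => by
    have := (ph.toContinuousLinearEquiv.toContinuousLinearMap.hasFDerivAt (x := Y s)).comp_hasDerivAt s (hd s)
    exact this.const_mul _
  cont := continuous_const.mul (ph.continuous.comp hc)
  str := fun s τ h => by
    have := hs (s + τ) s (by simpa using h)
    rw [add_sub_cancel_left] at this
    rw [← mul_sub, ← map_sub, norm_mul, Complex.norm_real, ph.norm_map, Real.norm_eq_abs, abs_of_pos (inv_pos.2 hl)]
    rw [inv_mul_eq_div, le_div_iff₀ hl, mul_comm]
    exact this

lemma En_smul (e c : ℝ) (X : ℝ → ℂ) : En e (fun s => (c : ℂ) * X s) = ENNReal.ofReal (c ^ 2) * En e X := by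
  unfold En
  rw [← ENNReal.tsum_mul_left]
  refine tsum_congr fun k => ?_
  rw [fc_const_mul, enorm_mul, mul_pow, mul_assoc, ← ofRealNorm (c : ℂ), ← ENNReal.ofReal_pow (norm_nonneg _),
    Complex.norm_real, Real.norm_eq_abs, sq_abs]

lemma sq_add_E (a b : ℝ≥0∞) : (a + b) ^ 2 ≤ 2 * (a ^ 2 + b ^ 2) := by
  have := sq3 a b 0
  by_cases ha : a = ∞
  · subst ha; simp
  by_cases hb : b = ∞
  · subst hb; simp
  lift a to NNReal using ha
  lift b to NNReal using hb
  have h2 : (a + b) ^ 2 ≤ 2 * (a ^ 2 + b ^ 2) := by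
    rw [← NNReal.coe_le_coe]
    push_cast
    nlinarith [sq_nonneg ((a : ℝ) - b)]
  exact_mod_cast h2

lemma aa_En (e : ℝ) (X1 X2 : ℝ → ℂ) : ∑' (k : ℤ), aa X1 X2 k ^ 2 * wt e k ≤ 2 * (En e X1 + En e X2) := by
  unfold En
  rw [← ENNReal.tsum_add, ← ENNReal.tsum_mul_left]
  refine ENNReal.tsum_le_tsum fun k => ?_
  rw [← add_mul, ← mul_assoc]
  exact mul_le_mul_left (sq_add_E _ _) _

lemma En_diff (e : ℝ) {X1 X2 : ℝ → ℂ} (h1 : Continuous X1) (h2 : Continuous X2) :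
    En e (fun s => X1 s - X2 s) ≤ ∑' (k : ℤ), aa X1 X2 k ^ 2 * wt e k := by
  unfold En
  refine ENNReal.tsum_le_tsum fun k => mul_le_mul_left (pow_le_pow_left' ?_ 2) _
  rw [fc_sub h1 h2]
  exact enorm_sub_le

lemma params {θ β : ℝ} (hθ1 : 1 / 4 ≤ θ) (hθ2 : θ < 1)
    (hβ1 : 0 < β) (hβ2 : β ≤ min θ (1 / 2)) (hβ3 : θ = 1 / 2 → β ≠ 1 / 2) :
    ∃ θ' e : ℝ, 0 < θ' ∧ θ' ≤ θ ∧ 2 ≤ e ∧ e ≤ 3 - 2 * β ∧ Core θ' e := by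
  have b1 := hβ2.trans (min_le_left _ _)
  have b2 := hβ2.trans (min_le_right _ _)
  rcases lt_trichotomy θ (1 / 2) with h | h | h
  · exact ⟨θ, 3 - 2 * θ, by linarith, le_rfl, by linarith, by linarith, core_A (by linarith) h⟩
  · have : β < 1 / 2 := lt_of_le_of_ne b2 (hβ3 h)
    exact ⟨β, 3 - 2 * β, hβ1, b1, by linarith, le_rfl, core_A hβ1 this⟩
  · exact ⟨θ, 2, by linarith, le_rfl, le_rfl, by linarith, core_B h hθ2⟩

/-- Assembly of the main and lower order parts. -/
lemma full {X1 x1 X2 x2 : ℝ → ℂ} {A : ℝ} {E : ℝ≥0∞} (n1 : Nice X1 x1) (n2 : Nice X2 x2)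
    (c1 : Continuous (g0 X1 x1)) (c2 : Continuous (g0 X2 x2)) (hA : 1 ≤ A)
    (h : ∑' k, ‖fc (g0 X1 x1) k - fc (g0 X2 x2) k‖ₑ ^ 2 * wt 2 k ≤ ENNReal.ofReal A * E)
    (hE : En 2 (fun s => X1 s - X2 s) ≤ E) :
    En 2 (fun s => (g0 X1 x1 s + gc X1 s) - (g0 X2 x2 s + gc X2 s)) ≤ ENNReal.ofReal ((2 + 32 * π ^ 2) * A) * E := by
  have k1 := gc_cont n1.per n1.contX
  have k2 := gc_cont n2.per n2.contX
  have d : PC (fun s => X1 s - X2 s) (fun s => x1 s - x2 s) := n1.pc.sub n2.pc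
  have kd := gc_cont d.per d.contX
  have e : (fun s => (g0 X1 x1 s + gc X1 s) - (g0 X2 x2 s + gc X2 s)) =
      fun s => (g0 X1 x1 s - g0 X2 x2 s) + gc (fun s => X1 s - X2 s) s := by
    funext s
    rw [← gc_sub n1.contX n2.contX]
    ring
  rw [e]
  have b : ∀ k, ‖fc (fun s => (g0 X1 x1 s - g0 X2 x2 s) + gc (fun s => X1 s - X2 s) s) k‖ₑ ^ 2 * wt 2 k ≤
      2 * (‖fc (g0 X1 x1) k - fc (g0 X2 x2) k‖ₑ ^ 2 * wt 2 k) +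
      ENNReal.ofReal (32 * π ^ 2) * (‖fc (fun s => X1 s - X2 s) k‖ₑ ^ 2 * wt 2 k) := fun k => by
    rw [fc_add (f := fun s => g0 X1 x1 s - g0 X2 x2 s) (c1.sub c2) kd, fc_sub c1 c2]
    have g : ‖fc (gc (fun s => X1 s - X2 s)) k‖ₑ ^ 2 ≤ ENNReal.ofReal (16 * π ^ 2) * ‖fc (fun s => X1 s - X2 s) k‖ₑ ^ 2 := by
      have := pow_le_pow_left₀ (norm_nonneg _) (fc_gc_bd d k) 2
      rw [← ofRealNorm, ← ofRealNorm, ← ENNReal.ofReal_pow (norm_nonneg _), ← ENNReal.ofReal_pow (norm_nonneg _),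
        ← ENNReal.ofReal_mul (by positivity)]
      refine ENNReal.ofReal_le_ofReal (this.trans_eq (by ring))
    have s := (pow_le_pow_left' (enorm_add_le (fc (g0 X1 x1) k - fc (g0 X2 x2) k) (fc (gc (fun s => X1 s - X2 s)) k)) 2).trans
      (sq_add_E _ _)
    refine (mul_le_mul_left (s.trans (mul_le_mul_right (add_le_add_right g _) _)) _).trans_eq ?_
    rw [show (32 : ℝ) * π ^ 2 = 2 * (16 * π ^ 2) by ring, ENNReal.ofReal_mul (by norm_num : (0:ℝ) ≤ 2), ENNReal.ofReal_ofNat]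
    ring
  refine (ENNReal.tsum_le_tsum b).trans ?_
  rw [ENNReal.tsum_add, ENNReal.tsum_mul_left, ENNReal.tsum_mul_left]
  refine (add_le_add (mul_le_mul_right h _) (mul_le_mul_right hE _)).trans ?_
  rw [← mul_assoc, ← add_mul, ← ENNReal.ofReal_ofNat 2, ← ENNReal.ofReal_mul (by norm_num),
    ← ENNReal.ofReal_add (by positivity) (by positivity)]
  refine mul_le_mul_left (ENNReal.ofReal_le_ofReal ?_) _
  nlinarith [sq_nonneg π]

/-- The improved `Ḣ¹` estimate for `g_{Y₁} − g_{Y₂}`. -/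
theorem statement19 (θ β : ℝ) (hθ1 : 1 / 4 ≤ θ) (hθ2 : θ < 1)
    (hβ1 : 0 < β) (hβ2 : β ≤ min θ (1 / 2)) (hβ3 : θ = 1 / 2 → β ≠ 1 / 2) :
    ∃ C : ℝ, 0 < C ∧
      ∀ (Y₁ Y₁' Y₁'' Y₂ Y₂' Y₂'' : ℝ → E2) (lam : ℝ),
        0 < lam →
        Function.Periodic Y₁ (2 * π) →
        (∀ s, HasDerivAt Y₁ (Y₁' s) s) →
        Continuous Y₁' →
        LocallyIntegrable Y₁'' volume →
        (∀ a b : ℝ, a ≤ b → Y₁' b - Y₁' a = ∫ u in a..b, Y₁'' u) →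
        Function.Periodic Y₂ (2 * π) →
        (∀ s, HasDerivAt Y₂ (Y₂' s) s) →
        Continuous Y₂' →
        LocallyIntegrable Y₂'' volume →
        (∀ a b : ℝ, a ≤ b → Y₂' b - Y₂' a = ∫ u in a..b, Y₂'' u) →
        -- both satisfy the well-stretched condition with constant `lam`
        (∀ s₁ s₂ : ℝ, |s₁ - s₂| ≤ π → lam * |s₁ - s₂| ≤ ‖Y₁ s₁ - Y₁ s₂‖) →
        (∀ s₁ s₂ : ℝ, |s₁ - s₂| ≤ π → lam * |s₁ - s₂| ≤ ‖Y₂ s₁ - Y₂ s₂‖) →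
        -- `‖Y₁‖_{Ḣ^{2+θ}(𝕋)}, ‖Y₂‖_{Ḣ^{2+θ}(𝕋)} < ∞`
        Summable (sobSummand (2 + θ) Y₁) →
        Summable (sobSummand (2 + θ) Y₂) →
        Summable (sobSummand 1 (fun s => gY Y₁ Y₁' s - gY Y₂ Y₂' s)) ∧
        sobNorm 1 (fun s => gY Y₁ Y₁' s - gY Y₂ Y₂' s)
          ≤ C / lam ^ 3 * (sobNorm (2 + θ) Y₁ + sobNorm (2 + θ) Y₂) ^ 3 *
              sobNorm (3 / 2 - β) (fun s => Y₁ s - Y₂ s) := by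
  obtain ⟨θ', e, t0, t1, e2, e3, C, C0, H⟩ := params hθ1 hθ2 hβ1 hβ2 hβ3
  have b2 := hβ2.trans (min_le_right _ _)
  refine ⟨8 * Real.sqrt ((2 + 32 * π ^ 2) * C), by positivity, ?_⟩
  intro Y₁ Y₁' Y₁'' Y₂ Y₂' Y₂'' lam hl p1 d1 c1 _ _ p2 d2 c2 _ _ w1 w2 S1 S2
  have cY1 : Continuous Y₁ := continuous_iff_continuousAt.2 fun s => (d1 s).continuousAt
  have cY2 : Continuous Y₂ := continuous_iff_continuousAt.2 fun s => (d2 s).continuousAt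
  have n1 := mkNice hl p1 d1 c1 w1
  have n2 := mkNice hl p2 d2 c2 w2
  set X1 : ℝ → ℂ := fun s => ((lam⁻¹ : ℝ) : ℂ) * ph (Y₁ s) with hX1
  set x1 : ℝ → ℂ := fun s => ((lam⁻¹ : ℝ) : ℂ) * ph (Y₁' s) with hx1
  set X2 : ℝ → ℂ := fun s => ((lam⁻¹ : ℝ) : ℂ) * ph (Y₂ s) with hX2
  set x2 : ℝ → ℂ := fun s => ((lam⁻¹ : ℝ) : ℂ) * ph (Y₂' s) with hx2
  set a1 := sobNorm (2 + θ) Y₁ with ha1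
  set a2 := sobNorm (2 + θ) Y₂ with ha2
  have a10 : 0 ≤ a1 := Real.sqrt_nonneg _
  have a20 : 0 ≤ a2 := Real.sqrt_nonneg _
  have l' : (lam : ℂ) ≠ 0 := by exact_mod_cast hl.ne'
  have E1 : En (4 + 2 * θ) X1 = ENNReal.ofReal (lam⁻¹ ^ 2 * a1 ^ 2) := by
    rw [hX1, En_smul, show 4 + 2 * θ = 2 * (2 + θ) by ring, En_sob cY1 (by linarith) S1,
      ← ENNReal.ofReal_mul (by positivity)]
  have E2' : En (4 + 2 * θ) X2 = ENNReal.ofReal (lam⁻¹ ^ 2 * a2 ^ 2) := by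
    rw [hX2, En_smul, show 4 + 2 * θ = 2 * (2 + θ) by ring, En_sob cY2 (by linarith) S2,
      ← ENNReal.ofReal_mul (by positivity)]
  set N := 2 * (a1 + a2) / lam with hN
  have N0 : 0 ≤ N := by positivity
  have hNb : ∑' (k : ℤ), aa X1 X2 k ^ 2 * wt (4 + 2 * θ) k ≤ ENNReal.ofReal (N ^ 2) := by
    refine (aa_En _ _ _).trans ?_
    rw [E1, E2', ← ENNReal.ofReal_add (by positivity) (by positivity), ← ENNReal.ofReal_ofNat 2,
      ← ENNReal.ofReal_mul (by norm_num)]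
    refine ENNReal.ofReal_le_ofReal ?_
    rw [hN, div_pow, inv_pow, ← mul_add, inv_mul_eq_div, ← mul_div_assoc]
    refine div_le_div_of_nonneg_right ?_ (by positivity)
    nlinarith [mul_nonneg a10 a20]
  have wm : ∀ {u v : ℝ}, 0 < u → u ≤ v → ∑' (k : ℤ), aa X1 X2 k ^ 2 * wt u k ≤ ∑' (k : ℤ), aa X1 X2 k ^ 2 * wt v k := by
    intro u v hu huv
    refine ENNReal.tsum_le_tsum fun k => mul_le_mul_right ?_ _
    unfold wt
    refine ENNReal.ofReal_le_ofReal ?_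
    by_cases hk : k = 0
    · subst hk; simp [Real.zero_rpow hu.ne', Real.zero_rpow (hu.trans_le huv).ne']
    · refine Real.rpow_le_rpow_of_exponent_le ?_ huv
      have := Int.one_le_abs hk
      exact_mod_cast this
  obtain ⟨⟨g1, g2, i1, i2⟩, hC1, hg⟩ := H X1 x1 X2 x2 N n1 n2 N0 ((wm (by linarith) (by linarith)).trans hNb)
  have hF := full n1 n2 g1 g2 hC1 hg (En_mono (by norm_num) e2 _)
  -- the difference of the remainders
  have hp1 := gY_ph (Y := Y₁) (Y' := Y₁') hl (X := X1) (x := x1) (fun s => by rw [hX1]; push_cast; field_simp)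
    (fun s => by rw [hx1]; push_cast; field_simp) n1 i1
  have hp2 := gY_ph (Y := Y₂) (Y' := Y₂') hl (X := X2) (x := x2) (fun s => by rw [hX2]; push_cast; field_simp)
    (fun s => by rw [hx2]; push_cast; field_simp) n2 i2
  have cg1 : Continuous (gY Y₁ Y₁') := by
    have : Continuous fun s => ph (gY Y₁ Y₁' s) := by
      simp only [hp1]
      exact continuous_const.mul (continuous_const.mul (g1.add (gc_cont n1.per n1.contX)))
    have e0 : gY Y₁ Y₁' = fun s => ph.symm (ph (gY Y₁ Y₁' s)) := by funext s; simp
    rw [e0]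
    exact ph.symm.continuous.comp this
  have cg2 : Continuous (gY Y₂ Y₂') := by
    have : Continuous fun s => ph (gY Y₂ Y₂' s) := by
      simp only [hp2]
      exact continuous_const.mul (continuous_const.mul (g2.add (gc_cont n2.per n2.contX)))
    have e0 : gY Y₂ Y₂' = fun s => ph.symm (ph (gY Y₂ Y₂' s)) := by funext s; simp
    rw [e0]
    exact ph.symm.continuous.comp this
  have cg : Continuous fun s => gY Y₁ Y₁' s - gY Y₂ Y₂' s := cg1.sub cg2
  have eG : (fun s => ph (gY Y₁ Y₁' s - gY Y₂ Y₂' s)) =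
      fun s => (((4 * π)⁻¹ * lam : ℝ) : ℂ) * ((g0 X1 x1 s + gc X1 s) - (g0 X2 x2 s + gc X2 s)) := by
    funext s
    rw [map_sub, hp1, hp2]
    push_cast
    ring
  -- the difference of the curves
  have eD : (fun s => X1 s - X2 s) = fun s => ((lam⁻¹ : ℝ) : ℂ) * ph (Y₁ s - Y₂ s) := by
    funext s
    rw [map_sub, hX1, hX2]
    ring
  have cD : Continuous fun s => Y₁ s - Y₂ s := cY1.sub cY2
  have DS : Summable (sobSummand (3 / 2 - β) (fun s => Y₁ s - Y₂ s)) := by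
    refine sob_summable cD (by linarith) ?_
    have h1 : En (2 * (3 / 2 - β)) (fun s => X1 s - X2 s) ≠ ∞ :=
      ne_top_of_le_ne_top ENNReal.ofReal_ne_top
        (((En_diff _ n1.contX n2.contX).trans (wm (by linarith) (by linarith))).trans hNb)
    rw [eD, En_smul] at h1
    intro h2
    rw [h2, ENNReal.mul_top] at h1
    · exact h1 rfl
    · rw [Ne, ENNReal.ofReal_eq_zero, not_le]; positivity
  set dn := sobNorm (3 / 2 - β) (fun s => Y₁ s - Y₂ s) with hdn
  have dn0 : 0 ≤ dn := Real.sqrt_nonneg _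
  have ED : En e (fun s => X1 s - X2 s) ≤ ENNReal.ofReal (lam⁻¹ ^ 2 * dn ^ 2) := by
    refine (En_mono (by linarith) e3 _).trans ?_
    rw [eD, En_smul, show 3 - 2 * β = 2 * (3 / 2 - β) by ring, En_sob cD (by linarith) DS,
      ← ENNReal.ofReal_mul (by positivity)]
  have EG : En (2 * 1) (fun s => ph (gY Y₁ Y₁' s - gY Y₂ Y₂' s)) ≤
      ENNReal.ofReal ((2 + 32 * π ^ 2) * (C * N ^ 6) * dn ^ 2) := by
    rw [eG, En_smul, mul_one]
    refine (mul_le_mul_right (hF.trans (mul_le_mul_right ED _)) _).trans ?_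
    rw [← ENNReal.ofReal_mul (by positivity), ← ENNReal.ofReal_mul (by positivity)]
    refine ENNReal.ofReal_le_ofReal ?_
    have p : (4 * π)⁻¹ ^ 2 ≤ 1 := by
      refine pow_le_one₀ (by positivity) (inv_le_one_of_one_le₀ ?_)
      linarith [Real.pi_gt_three]
    have q : ((4 * π)⁻¹ * lam) ^ 2 * ((2 + 32 * π ^ 2) * (C * N ^ 6) * (lam⁻¹ ^ 2 * dn ^ 2)) =
        (4 * π)⁻¹ ^ 2 * ((2 + 32 * π ^ 2) * (C * N ^ 6) * dn ^ 2) := by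
      field_simp
    rw [q]
    exact mul_le_of_le_one_left (by positivity) p
  have GS := sob_summable cg one_pos (ne_top_of_le_ne_top ENNReal.ofReal_ne_top EG)
  refine ⟨GS, ?_⟩
  rw [En_sob cg one_pos GS, ENNReal.ofReal_le_ofReal_iff (by positivity)] at EG
  refine (Real.le_sqrt_of_sq_le EG).trans_eq ?_
  rw [show (2 + 32 * π ^ 2) * (C * N ^ 6) * dn ^ 2 = ((2 + 32 * π ^ 2) * C) * (N ^ 3 * dn) ^ 2 by ring,
    Real.sqrt_mul (by positivity), Real.sqrt_sq (by positivity), hN]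
  field_simp
  ring
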